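/- Let F be a totally real number field of even degree over ℚ, and D the unique (up to isomorphism) totally definite quaternion F-algebra unramified at all finite places of F. Then h(D)/h(F) is an integer. -/

import Mathlib

/-!
STATEMENT 15: Let `F` be a totally real number field of even degree over `ℚ`, and
`D = ℍ[F,c₁,c₂]` the (unique up to isomorphism) totally definite quaternion `F`-algebra
unramified at all finite places of `F`.  Then `h(D)/h(F)` is an integer, i.e. `h(F)`
divides `h(D)`, where `h(D) = |Cl(O)|` for a maximal `O_F`-order `O` in `D` and `h(F)` is
the class number of `F`.
-/

noncomputable section
set_option synthInstance.maxHeartbeats 1000000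
set_option maxHeartbeats 1000000

/-- `F` is totally real: every complex embedding of `F` is real. -/
def TotReal (F : Type*) [Field F] [NumberField F] : Prop :=
  ∀ φ : F →+* ℂ, NumberField.ComplexEmbedding.IsReal φ

section PicardConstruction

open scoped Pointwise

variable {L : Type*} [CommRing L]

instance unitsCommGroup (A : Subalgebra ℤ L) : CommGroup (Submodule ↥A L)ˣ :=
  Units.instCommGroupUnits (α := Submodule ↥A L)

/-- The subgroup of principal invertible fractional ideals (those generated by a single
invertible element of `L`). -/
def principalSub (A : Subalgebra ℤ L) : Subgroup (Submodule ↥A L)ˣ where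
  carrier := {u | ∃ x : L, IsUnit x ∧ (u : Submodule ↥A L) = Submodule.span ↥A {x}}
  one_mem' := ⟨1, isUnit_one, by simp [Submodule.one_eq_span]⟩
  mul_mem' := by
    rintro u v ⟨x, hx, hux⟩ ⟨y, hy, hvy⟩
    exact ⟨x * y, hx.mul hy, by
      push_cast [hux, hvy]
      rw [Submodule.span_mul_span, Set.singleton_mul_singleton]⟩
  inv_mem' := by
    rintro u ⟨x, hx, hux⟩
    refine ⟨(hx.unit⁻¹ : Lˣ), Units.isUnit _, ?_⟩
    have h1 : (u : Submodule ↥A L) * Submodule.span ↥A {((hx.unit⁻¹ : Lˣ) : L)} = 1 := by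
      rw [hux, Submodule.span_mul_span, Set.singleton_mul_singleton]
      simp [Submodule.one_eq_span]
    calc ((u⁻¹ : (Submodule ↥A L)ˣ) : Submodule ↥A L)
        = (u⁻¹ : (Submodule ↥A L)ˣ) * ((u : Submodule ↥A L) *
            Submodule.span ↥A {((hx.unit⁻¹ : Lˣ) : L)}) := by
            rw [h1]; exact (mul_one ((u⁻¹ : (Submodule ↥A L)ˣ) : Submodule ↥A L)).symm
      _ = Submodule.span ↥A {((hx.unit⁻¹ : Lˣ) : L)} := by
            rw [← mul_assoc, ← Units.val_mul, inv_mul_cancel, Units.val_one]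
            exact one_mul (Submodule.span ↥A {((hx.unit⁻¹ : Lˣ) : L)})

/-- The Picard group of a `ℤ`-order `A` realized inside `L`: invertible (equivalently,
locally principal) fractional `A`-ideals modulo principal fractional `A`-ideals. -/
def Picard (A : Subalgebra ℤ L) : Type _ := (Submodule ↥A L)ˣ ⧸ principalSub A

noncomputable instance (A : Subalgebra ℤ L) : CommGroup (Picard A) :=
  QuotientGroup.Quotient.commGroup (principalSub A)

/-- The ideal class of an invertible fractional ideal in the Picard group. -/
def picCls (A : Subalgebra ℤ L) (u : (Submodule ↥A L)ˣ) : Picard A := QuotientGroup.mk u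

/-- The class number `h(A) = |Pic(A)|` of a `ℤ`-order `A` realized in `L`. -/
noncomputable def hPic (A : Subalgebra ℤ L) : ℕ := Nat.card (Picard A)

end PicardConstruction
open scoped Quaternion Pointwise

/-- A `ℤ`-order in a `ℚ`-algebra `V`: a subring, finitely generated as a `ℤ`-module,
containing a `ℚ`-basis of `V` (i.e. spanning `V` over `ℚ`). -/
def IsZOrder {V : Type*} [Ring V] [Algebra ℚ V] (O : Subalgebra ℤ V) : Prop :=
  (Subalgebra.toSubmodule O).FG ∧ Submodule.span ℚ (O : Set V) = ⊤

variable {F : Type*} [Field F] [NumberField F] {c₁ c₂ : F}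

/-- The reduced norm on the quaternion algebra `ℍ[F, c₁, c₂]`. -/
def quatNrd (x : ℍ[F, c₁, c₂]) : F :=
  x.re * x.re - c₁ * x.imI * x.imI - c₂ * x.imJ * x.imJ + c₁ * c₂ * x.imK * x.imK

/-- `O` is a proper `A`-order in the quaternion algebra `D = ℍ[F,c₁,c₂]`:
a `ℤ`-order of full rank in `D` with `O ∩ F = A`. -/
def IsProperOrder (A : Subalgebra ℤ F) (O : Subalgebra ℤ ℍ[F, c₁, c₂]) : Prop :=
  IsZOrder O ∧ ∀ x : F, algebraMap F ℍ[F, c₁, c₂] x ∈ O ↔ x ∈ A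

/-- `Ã = Nr_A(O)`: the suborder of `O_F` spanned over `A` by the reduced norms of the
elements of `O` (equivalently, the subring generated by `A` and these reduced norms). -/
def normOrder (A : Subalgebra ℤ F) (O : Subalgebra ℤ ℍ[F, c₁, c₂]) : Subalgebra ℤ F :=
  Algebra.adjoin ℤ ((A : Set F) ∪ (quatNrd '' (O : Set ℍ[F, c₁, c₂])))

/-- The localization at a prime `p` of a subset of a `ℤ`-module. -/
def locAt {V : Type*} [AddCommGroup V] (p : ℕ) (S : Set V) : Set V :=
  {x | ∃ n : ℤ, ¬ (p : ℤ) ∣ n ∧ n • x ∈ S}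

/-- `I` is a locally principal right fractional `O`-ideal in `D = ℍ[F,c₁,c₂]`:
a full `ℤ`-lattice in `D`, stable under right multiplication by `O`, which at every
rational prime `p` is principal, generated by a unit `λ` of `D`. -/
def IsLocPrincRightIdeal (O : Subalgebra ℤ ℍ[F, c₁, c₂]) (I : Submodule ℤ ℍ[F, c₁, c₂]) :
    Prop :=
  I.FG ∧ Submodule.span ℚ (I : Set ℍ[F, c₁, c₂]) = ⊤ ∧
    (∀ x ∈ I, ∀ r ∈ O, x * r ∈ I) ∧
    ∀ p : ℕ, p.Prime → ∃ lam : ℍ[F, c₁, c₂]ˣ,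
      locAt p (I : Set ℍ[F, c₁, c₂]) = locAt p ((fun y => (lam : ℍ[F, c₁, c₂]) * y) '' O)

/-- Left multiplication `I ↦ λI` on right `O`-ideals. -/
def lmul (lam : ℍ[F, c₁, c₂]ˣ) (I : Submodule ℤ ℍ[F, c₁, c₂]) : Submodule ℤ ℍ[F, c₁, c₂] :=
  I.map (LinearMap.mulLeft ℤ (lam : ℍ[F, c₁, c₂]))

/-- The product ideal `a·I` of a fractional `A`-ideal `a ⊆ F` and a right ideal `I ⊆ D`. -/
def idMul (A : Subalgebra ℤ F) (a : Submodule ↥A F) (I : Submodule ℤ ℍ[F, c₁, c₂]) :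
    Submodule ℤ ℍ[F, c₁, c₂] :=
  Submodule.span ℤ {z | ∃ f ∈ a, ∃ y ∈ I, z = algebraMap F ℍ[F, c₁, c₂] f * y}

/-- The type of locally principal right `O`-ideals. -/
def LPIdeals (O : Subalgebra ℤ ℍ[F, c₁, c₂]) : Type _ :=
  {I : Submodule ℤ ℍ[F, c₁, c₂] // IsLocPrincRightIdeal O I}

/-- The right ideal class set `Cl(O)`:  locally principal right `O`-ideals modulo the
equivalence `I ∼ J ↔ I = λJ` for some `λ ∈ Dˣ`. -/
def ClO (O : Subalgebra ℤ ℍ[F, c₁, c₂]) : Type _ :=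
  Quot (fun I J : LPIdeals O => ∃ lam : ℍ[F, c₁, c₂]ˣ, I.1 = lmul lam J.1)

/-- The class number `h(O) = |Cl(O)|`. -/
noncomputable def hCl (O : Subalgebra ℤ ℍ[F, c₁, c₂]) : ℕ := Nat.card (ClO O)

/-- `D = ℍ[F,c₁,c₂]` is totally definite (`F` totally real):
`D ⊗_{F,σ} ℝ` is the Hamilton quaternion algebra for every real embedding `σ`,
i.e. `σ(c₁) < 0` and `σ(c₂) < 0` for every embedding `σ : F → ℝ`. -/
def TotallyDefinite (c₁ c₂ : F) : Prop := ∀ σ : F →+* ℝ, σ c₁ < 0 ∧ σ c₂ < 0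

/-- The class of a locally principal right `O`-ideal in `Cl(O)`. -/
def clsO (O : Subalgebra ℤ ℍ[F, c₁, c₂]) (I : LPIdeals O) : ClO O := Quot.mk _ I
section MaximalOrders

open scoped Quaternion TensorProduct

variable {F : Type*} [Field F] [NumberField F] {c₁ c₂ : F}

instance adicSMulComm (v : IsDedekindDomain.HeightOneSpectrum (NumberField.RingOfIntegers F)) :
    SMulCommClass F (v.adicCompletion F) (v.adicCompletion F) :=
  Algebra.to_smulCommClass

/-- `D = ℍ[F,c₁,c₂]` is unramified at all finite places of `F`: for every finite place
`v` of `F`, the completion `F_v ⊗_F D` is isomorphic to a `2 × 2` matrix algebra. -/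
def UnramifiedAtAllFinitePlaces (c₁ c₂ : F) : Prop :=
  ∀ v : IsDedekindDomain.HeightOneSpectrum (NumberField.RingOfIntegers F),
    Nonempty (((v.adicCompletion F) ⊗[F] ℍ[F, c₁, c₂]) ≃ₐ[v.adicCompletion F]
      Matrix (Fin 2) (Fin 2) (v.adicCompletion F))

/-- A maximal `O_F`-order in `D = ℍ[F,c₁,c₂]`. -/
def IsMaximalOrder (O : Subalgebra ℤ ℍ[F, c₁, c₂]) : Prop :=
  IsProperOrder (integralClosure ℤ F) O ∧
    ∀ O' : Subalgebra ℤ ℍ[F, c₁, c₂],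
      IsProperOrder (integralClosure ℤ F) O' → O ≤ O' → O' = O

/-- Two orders are conjugate (of the same type) if `O' = u O u⁻¹` for some `u ∈ Dˣ`. -/
def ConjOrders (O O' : Subalgebra ℤ ℍ[F, c₁, c₂]) : Prop :=
  ∃ u : ℍ[F, c₁, c₂]ˣ,
    (O' : Set ℍ[F, c₁, c₂])
      = (fun x => (u : ℍ[F, c₁, c₂]) * x * ((u⁻¹ : ℍ[F, c₁, c₂]ˣ) : ℍ[F, c₁, c₂])) '' O

/-- The set `𝒯(D)` of `Dˣ`-conjugacy classes of maximal `O_F`-orders in `D`. -/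
def TypeSet (c₁ c₂ : F) : Type _ :=
  Quot (fun O O' : {O : Subalgebra ℤ ℍ[F, c₁, c₂] // IsMaximalOrder O} =>
    ConjOrders O.1 O'.1)

/-- The type number `t(D)` of `D = ℍ[F,c₁,c₂]`. -/
noncomputable def typeNumber (c₁ c₂ : F) : ℕ := Nat.card (TypeSet c₁ c₂)

end MaximalOrders

section Euler

open Filter Topology IsDedekindDomain

variable {R : Type*} [CommRing R] [IsDedekindDomain R]

theorem tsum_coprime_eq_mul_prod (f : Ideal R →*₀ ℝ) (hf : Summable f)
    (P : Finset (HeightOneSpectrum R)) :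
    ∑' I, {I : Ideal R | ∀ v ∈ P, ¬ v.asIdeal ∣ I}.indicator f I
      = (∑' I, f I) * ∏ v ∈ P, (1 - f v.asIdeal) := by
  classical
  induction P using Finset.induction_on with
  | empty => simp
  | insert v P hv ih =>
    rw [Finset.prod_insert hv, mul_left_comm, ← ih, sub_mul, one_mul]
    set A : Set (Ideal R) := {I | ∀ w ∈ P, ¬ w.asIdeal ∣ I}
    have hA : Summable (A.indicator f) := hf.indicator A
    have hinj : Function.Injective (fun I : Ideal R => v.asIdeal * I) :=
      fun I J h => mul_left_cancel₀ v.ne_bot h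
    have h1 : f v.asIdeal * ∑' I, A.indicator f I
        = ∑' I, {I : Ideal R | v.asIdeal ∣ I}.indicator (A.indicator f) I := by
      rw [← tsum_mul_left]
      have hsupp : Function.support ({I : Ideal R | v.asIdeal ∣ I}.indicator (A.indicator f))
          ⊆ Set.range (fun I : Ideal R => v.asIdeal * I) := by
        intro I hI
        have : v.asIdeal ∣ I := by
          by_contra h
          exact hI (Set.indicator_of_notMem (s := {I : Ideal R | v.asIdeal ∣ I}) h _)
        obtain ⟨J, hJ⟩ := this
        exact ⟨J, hJ.symm⟩
      rw [← hinj.tsum_eq hsupp]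
      refine tsum_congr fun I => ?_
      have hmem : v.asIdeal * I ∈ A ↔ I ∈ A := by
        refine forall₂_congr fun w hw => not_congr ?_
        constructor
        · intro h
          rcases w.prime.dvd_or_dvd h with h | h
          · exfalso
            have : v = w := by
              have hle : v.asIdeal ≤ w.asIdeal := Ideal.le_of_dvd h
              exact HeightOneSpectrum.ext (v.isMaximal.eq_of_le w.isPrime.ne_top hle)
            exact hv (this ▸ hw)
          · exact h
        · exact fun h => h.mul_left _
      rw [Set.indicator_of_mem (show v.asIdeal * I ∈ {I : Ideal R | v.asIdeal ∣ I} from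
        dvd_mul_right _ _)]
      by_cases hI : I ∈ A
      · rw [Set.indicator_of_mem hI, Set.indicator_of_mem (hmem.2 hI), map_mul]
      · rw [Set.indicator_of_notMem hI, Set.indicator_of_notMem (mt hmem.1 hI), mul_zero]
    rw [h1, ← hA.tsum_sub (hA.indicator _)]
    refine tsum_congr fun I => ?_
    simp only [Set.indicator, Finset.mem_insert, forall_eq_or_imp, Set.mem_ofPred_eq, A]
    by_cases h1 : v.asIdeal ∣ I <;> simp [h1]

theorem tendsto_tsum_mul_prod_one_sub (f : Ideal R →*₀ ℝ) (hf : Summable f) :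
    Tendsto (fun P : Finset (HeightOneSpectrum R) =>
      (∑' I, f I) * ∏ v ∈ P, (1 - f v.asIdeal)) atTop (𝓝 1) := by
  classical
  simp_rw [← tsum_coprime_eq_mul_prod f hf]
  have h1 : (1 : ℝ) = ∑' I, ({1} : Set (Ideal R)).indicator f I := by
    rw [tsum_eq_single 1]
    · rw [Set.indicator_of_mem (Set.mem_singleton _), map_one]
    · intro I hI
      rw [Set.indicator_of_notMem (by simpa using hI)]
  rw [h1]
  refine tendsto_tsum_of_dominated_convergence (bound := fun I => ‖f I‖) hf.norm ?_ ?_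
  · intro I
    refine tendsto_const_nhds.congr' ?_
    by_cases hI : I = 1
    · subst hI
      filter_upwards with P
      rw [Set.indicator_of_mem, Set.indicator_of_mem]
      · intro v _ h
        exact v.prime.not_isUnit (isUnit_of_dvd_one h)
      · rfl
    · by_cases hI0 : I = 0
      · subst hI0
        filter_upwards with P
        rw [Set.indicator_apply_eq_zero.2 fun _ => map_zero f,
          Set.indicator_apply_eq_zero.2 fun _ => map_zero f]
      · obtain ⟨M, hM, hle⟩ := Ideal.exists_le_maximal I (by rwa [Ideal.one_eq_top] at hI)
        have hM0 : M ≠ ⊥ := by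
          rintro rfl
          exact hI0 (le_bot_iff.mp hle)
        filter_upwards [eventually_ge_atTop {(⟨M, hM.isPrime, hM0⟩ : HeightOneSpectrum R)}]
          with P hP
        rw [Set.indicator_of_notMem (by simpa using hI), Set.indicator_of_notMem]
        intro h
        exact h ⟨M, hM.isPrime, hM0⟩ (hP (Finset.mem_singleton_self _)) (Ideal.dvd_iff_le.2 hle)
  · filter_upwards with P I
    exact norm_indicator_le_norm_self _ _

theorem exp_sub_sq_le {x : ℝ} (h : |x| ≤ 1 / 2) : Real.exp (-x - 2 * x ^ 2) ≤ 1 - x := by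
  obtain ⟨h1, h2⟩ := abs_le.mp h
  rw [← Real.le_log_iff_exp_le (by linarith)]
  have key := Real.abs_log_sub_add_sum_range_le (x := x) (by linarith) 1
  simp only [Finset.range_one, Finset.sum_singleton, zero_add, pow_one, Nat.cast_zero, div_one,
    one_add_one_eq_two] at key
  have h3 : |x| ^ 2 / (1 - |x|) ≤ 2 * x ^ 2 := by
    rw [div_le_iff₀ (by linarith), sq_abs]
    nlinarith [sq_nonneg x]
  linarith [(abs_le.mp key).1]

theorem exp_tsum_le_tsum (f : Ideal R →*₀ ℝ) (hf : Summable f)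
    (hf' : Summable fun v : HeightOneSpectrum R => f v.asIdeal)
    (h2 : ∀ v : HeightOneSpectrum R, |f v.asIdeal| ≤ 1 / 2) :
    Real.exp (∑' v : HeightOneSpectrum R, f v.asIdeal) ≤ ∑' I, f I := by
  have hlim := tendsto_tsum_mul_prod_one_sub f hf
  set L := ∑' I, f I
  have hprod : ∀ P : Finset (HeightOneSpectrum R), 0 < ∏ v ∈ P, (1 - f v.asIdeal) := fun P =>
    Finset.prod_pos fun v _ => by linarith [(abs_le.mp (h2 v)).2]
  have hL : 0 < L := by
    obtain ⟨P, hP⟩ := (hlim.eventually (lt_mem_nhds zero_lt_one)).exists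
    exact pos_of_mul_pos_left hP (hprod P).le
  have hle : ∀ P : Finset (HeightOneSpectrum R),
      L * ∏ v ∈ P, (1 - f v.asIdeal) ≤ L * Real.exp (-∑ v ∈ P, f v.asIdeal) := by
    intro P
    refine mul_le_mul_of_nonneg_left ?_ hL.le
    rw [← Finset.sum_neg_distrib, Real.exp_sum]
    refine Finset.prod_le_prod (fun v _ => by linarith [(abs_le.mp (h2 v)).2]) fun v _ => ?_
    linarith [Real.add_one_le_exp (-f v.asIdeal)]
  have := le_of_tendsto_of_tendsto' hlim
    (((Real.continuous_exp.tendsto _).comp hf'.hasSum.neg).const_mul L)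
    fun P => by simpa using hle P
  rw [Real.exp_neg, ← div_eq_mul_inv, le_div_iff₀ (Real.exp_pos _), one_mul] at this
  exact this

theorem tsum_le_exp_tsum (f : Ideal R →*₀ ℝ) (hf : Summable f)
    (hf' : Summable fun v : HeightOneSpectrum R => f v.asIdeal)
    (hf2 : Summable fun v : HeightOneSpectrum R => f v.asIdeal ^ 2)
    (h2 : ∀ v : HeightOneSpectrum R, |f v.asIdeal| ≤ 1 / 2) :
    ∑' I, f I ≤ Real.exp (∑' v : HeightOneSpectrum R, f v.asIdeal
      + 2 * ∑' v : HeightOneSpectrum R, f v.asIdeal ^ 2) := by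
  have hlim := tendsto_tsum_mul_prod_one_sub f hf
  set L := ∑' I, f I
  have hprod : ∀ P : Finset (HeightOneSpectrum R), 0 < ∏ v ∈ P, (1 - f v.asIdeal) := fun P =>
    Finset.prod_pos fun v _ => by linarith [(abs_le.mp (h2 v)).2]
  have hL : 0 < L := by
    obtain ⟨P, hP⟩ := (hlim.eventually (lt_mem_nhds zero_lt_one)).exists
    exact pos_of_mul_pos_left hP (hprod P).le
  have hle : ∀ P : Finset (HeightOneSpectrum R),
      L * Real.exp (-(∑ v ∈ P, (f v.asIdeal + 2 * f v.asIdeal ^ 2)))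
        ≤ L * ∏ v ∈ P, (1 - f v.asIdeal) := by
    intro P
    refine mul_le_mul_of_nonneg_left ?_ hL.le
    rw [← Finset.sum_neg_distrib, Real.exp_sum]
    refine Finset.prod_le_prod (fun v _ => (Real.exp_pos _).le) fun v _ => ?_
    rw [neg_add']
    exact exp_sub_sq_le (h2 v)
  have := le_of_tendsto_of_tendsto'
    (((Real.continuous_exp.tendsto _).comp (hf'.hasSum.add (hf2.hasSum.mul_left 2)).neg).const_mul L)
    hlim fun P => by simpa [-neg_add_rev] using hle P
  rwa [Real.exp_neg, ← div_eq_mul_inv, div_le_iff₀ (Real.exp_pos _), one_mul] at this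

end Euler

section Zeta

open Filter Topology IsDedekindDomain NumberField

variable (K : Type*) [Field K] [NumberField K]

theorem rpow_absNorm_zero {s : ℝ} (hs : s ≠ 0) :
    ((Ideal.absNorm (0 : Ideal (𝓞 K)) : ℕ) : ℝ) ^ (-s) = 0 := by
  rw [Ideal.zero_eq_bot, Ideal.absNorm_bot, Nat.cast_zero, Real.zero_rpow (neg_ne_zero.2 hs)]

theorem LSeries_term_card {s : ℝ} (hs : 1 < s) (n : ℕ) :
    LSeries.term (fun n ↦ (Nat.card {I : Ideal (𝓞 K) // Ideal.absNorm I = n} : ℂ)) s n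
      = ((∑' I : {I : Ideal (𝓞 K) // Ideal.absNorm I = n},
          (Ideal.absNorm I.1 : ℝ) ^ (-s) : ℝ) : ℂ) := by
  have h : ∀ I : {I : Ideal (𝓞 K) // Ideal.absNorm I = n},
      (Ideal.absNorm I.1 : ℝ) ^ (-s) = (n : ℝ) ^ (-s) := fun I => by rw [I.2]
  have : Finite {I : Ideal (𝓞 K) // Ideal.absNorm I = n} :=
    Ideal.finite_setOfPred_absNorm_eq n
  rw [tsum_congr h, tsum_const, nsmul_eq_mul]
  rcases eq_or_ne n 0 with rfl | hn
  · rw [Nat.cast_zero, Real.zero_rpow (by linarith)]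
    simp
  · rw [LSeries.term_of_ne_zero hn, Real.rpow_neg (Nat.cast_nonneg _)]
    push_cast [Complex.ofReal_cpow (Nat.cast_nonneg n)]
    rw [div_eq_mul_inv]

theorem summable_rpow_absNorm_of_LSeriesSummable {s : ℝ} (hs : 1 < s)
    (h : LSeriesSummable (fun n ↦ (Nat.card {I : Ideal (𝓞 K) // Ideal.absNorm I = n} : ℂ)) s) :
    Summable fun I : Ideal (𝓞 K) => (Ideal.absNorm I : ℝ) ^ (-s) := by
  rw [← (Equiv.sigmaFiberEquiv (fun I : Ideal (𝓞 K) => Ideal.absNorm I)).summable_iff,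
    summable_sigma_of_nonneg]
  · refine ⟨fun n => ?_, ?_⟩
    · have : Finite {I : Ideal (𝓞 K) // Ideal.absNorm I = n} :=
        Ideal.finite_setOfPred_absNorm_eq n
      exact Summable.of_finite
    · rw [← Complex.summable_ofReal]
      exact h.congr fun n => LSeries_term_card K hs n
  · intro x
    exact Real.rpow_nonneg (Nat.cast_nonneg _) _

theorem summable_rpow_absNorm {s : ℝ} (hs : 1 < s) :
    Summable fun I : Ideal (𝓞 K) => (Ideal.absNorm I : ℝ) ^ (-s) := by
  have h := (tendsto_sub_one_mul_dedekindZeta_nhdsGT K).eventually_ne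
    (Complex.ofReal_ne_zero.2 (dedekindZeta_residue_ne_zero K))
  obtain ⟨t, ht, ht1, hts⟩ := (h.and (Ioo_mem_nhdsGT hs)).exists
  have hsum : LSeriesSummable
      (fun n ↦ (Nat.card {I : Ideal (𝓞 K) // Ideal.absNorm I = n} : ℂ)) t := by
    by_contra hcon
    exact ht (by rw [dedekindZeta, LSeries, tsum_eq_zero_of_not_summable hcon, mul_zero])
  refine (summable_rpow_absNorm_of_LSeriesSummable K ht1 hsum).of_nonneg_of_le
    (fun I => Real.rpow_nonneg (Nat.cast_nonneg _) _) fun I => ?_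
  rcases Nat.eq_zero_or_pos (Ideal.absNorm I) with h0 | h0
  · rw [h0, Nat.cast_zero, Real.zero_rpow (by linarith), Real.zero_rpow (by linarith)]
  · exact Real.rpow_le_rpow_of_exponent_le (by exact_mod_cast h0) (by linarith)

theorem dedekindZeta_eq_tsum {s : ℝ} (hs : 1 < s) :
    dedekindZeta K s = ((∑' I : Ideal (𝓞 K), (Ideal.absNorm I : ℝ) ^ (-s) : ℝ) : ℂ) := by
  rw [dedekindZeta, LSeries, tsum_congr (LSeries_term_card K hs), ← Complex.ofReal_tsum,
    ← (Equiv.sigmaFiberEquiv (fun I : Ideal (𝓞 K) => Ideal.absNorm I)).tsum_eq]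
  have h := (Equiv.sigmaFiberEquiv (fun I : Ideal (𝓞 K) => Ideal.absNorm I)).summable_iff.2
    (summable_rpow_absNorm K hs)
  exact congrArg _ (Summable.tsum_sigma h).symm

theorem one_le_tsum_rpow_absNorm {s : ℝ} (hs : 1 < s) :
    1 ≤ ∑' I : Ideal (𝓞 K), (Ideal.absNorm I : ℝ) ^ (-s) := by
  have := (summable_rpow_absNorm K hs).le_tsum ⊤
    fun I _ => Real.rpow_nonneg (Nat.cast_nonneg _) _
  simpa using this

theorem exists_tsum_rpow_absNorm_bounds :
    ∃ c C : ℝ, 0 < c ∧ 0 < C ∧ ∀ s : ℝ, 1 < s → s ≤ 2 →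
      c / (s - 1) ≤ ∑' I : Ideal (𝓞 K), (Ideal.absNorm I : ℝ) ^ (-s) ∧
      ∑' I : Ideal (𝓞 K), (Ideal.absNorm I : ℝ) ^ (-s) ≤ C / (s - 1) := by
  set Z : ℝ → ℝ := fun s => ∑' I : Ideal (𝓞 K), (Ideal.absNorm I : ℝ) ^ (-s) with hZ
  set κ := dedekindZeta_residue K
  have hκ : 0 < κ := dedekindZeta_residue_pos K
  have hlim : Tendsto (fun s : ℝ => (s - 1) * Z s) (𝓝[>] 1) (𝓝 κ) := by
    have h := (Complex.continuous_re.tendsto _).comp (tendsto_sub_one_mul_dedekindZeta_nhdsGT K)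
    rw [Complex.ofReal_re] at h
    refine h.congr' ?_
    filter_upwards [self_mem_nhdsWithin] with s hs
    rw [Function.comp_apply, dedekindZeta_eq_tsum K hs]
    norm_cast
  obtain ⟨δ, hδ, hsub⟩ := mem_nhdsGT_iff_exists_Ioo_subset.1
    (hlim.eventually (Ioo_mem_nhds (show κ / 2 < κ by linarith) (show κ < 2 * κ by linarith)))
  have hδ' : (1 : ℝ) < δ := hδ
  have hanti : ∀ s t : ℝ, 1 < s → s ≤ t → Z t ≤ Z s := fun s t hs hst => by
    refine (summable_rpow_absNorm K (hs.trans_le hst)).tsum_le_tsum (fun I => ?_)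
      (summable_rpow_absNorm K hs)
    rcases Nat.eq_zero_or_pos (Ideal.absNorm I) with h0 | h0
    · rw [h0, Nat.cast_zero, Real.zero_rpow (by linarith), Real.zero_rpow (by linarith)]
    · exact Real.rpow_le_rpow_of_exponent_le (by exact_mod_cast h0) (by linarith)
  set m := (1 + δ) / 2 with hm
  have hm1 : 1 < m := by linarith
  have hZm : 1 ≤ Z m := one_le_tsum_rpow_absNorm K hm1
  refine ⟨min (κ / 2) (δ - 1), max (2 * κ) (Z m), lt_min (by linarith) (by linarith),
    lt_max_of_lt_left (by linarith), fun s hs hs2 => ?_⟩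
  have hs0 : 0 < s - 1 := by linarith
  have hZs : 1 ≤ Z s := one_le_tsum_rpow_absNorm K hs
  rw [div_le_iff₀ hs0, le_div_iff₀ hs0]
  constructor
  · rcases lt_or_ge s δ with h | h
    · have := (hsub ⟨hs, h⟩).1
      refine (min_le_left _ _).trans ?_
      rw [mul_comm]; exact this.le
    · refine (min_le_right _ _).trans ?_
      nlinarith
  · rcases lt_or_ge s δ with h | h
    · have := (hsub ⟨hs, h⟩).2
      refine le_trans ?_ (le_max_left _ _)
      rw [mul_comm]; exact this.le
    · refine le_trans ?_ (le_max_right _ _)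
      have := hanti m s hm1 (by linarith)
      nlinarith

variable {K}

/-- The completely multiplicative function `I ↦ χ(I) N(I)⁻ˢ`. -/
def twist (χ : Ideal (𝓞 K) →*₀ ℝ) (s : ℝ) : Ideal (𝓞 K) →*₀ ℝ where
  toFun I := χ I * (Ideal.absNorm I : ℝ) ^ (-s)
  map_zero' := by rw [map_zero, zero_mul]
  map_one' := by rw [map_one, map_one, Nat.cast_one, Real.one_rpow, one_mul]
  map_mul' I J := by
    rw [map_mul, map_mul, Nat.cast_mul, Real.mul_rpow (Nat.cast_nonneg _) (Nat.cast_nonneg _)]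
    ring

theorem two_le_absNorm (v : HeightOneSpectrum (𝓞 K)) : 2 ≤ Ideal.absNorm v.asIdeal := by
  have h0 : Ideal.absNorm v.asIdeal ≠ 0 := Ideal.absNorm_eq_zero_iff.not.2 v.ne_bot
  have h1 : Ideal.absNorm v.asIdeal ≠ 1 := Ideal.absNorm_eq_one_iff.not.2 v.isPrime.ne_top
  omega

theorem summable_prime {s : ℝ} (hs : 1 < s) :
    Summable fun v : HeightOneSpectrum (𝓞 K) => (Ideal.absNorm v.asIdeal : ℝ) ^ (-s) :=
  (summable_rpow_absNorm K hs).comp_injective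
    (i := fun v : HeightOneSpectrum (𝓞 K) => v.asIdeal) fun _ _ h => HeightOneSpectrum.ext h

theorem abs_mul_rpow_le {a : ℝ} (ha : |a| ≤ 1) (n : ℕ) (s : ℝ) :
    |a * (n : ℝ) ^ (-s)| ≤ (n : ℝ) ^ (-s) := by
  rw [abs_mul, abs_of_nonneg (Real.rpow_nonneg (Nat.cast_nonneg _) _)]
  exact mul_le_of_le_one_left (Real.rpow_nonneg (Nat.cast_nonneg _) _) ha

theorem summable_mul_rpow {χ : Ideal (𝓞 K) → ℝ} (hχ : ∀ I, |χ I| ≤ 1) {s : ℝ} (hs : 1 < s) :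
    Summable fun I : Ideal (𝓞 K) => χ I * (Ideal.absNorm I : ℝ) ^ (-s) :=
  (summable_rpow_absNorm K hs).of_norm_bounded fun I => abs_mul_rpow_le (hχ I) _ _

theorem summable_prime_mul {χ : HeightOneSpectrum (𝓞 K) → ℝ} (hχ : ∀ v, |χ v| ≤ 1) {s : ℝ}
    (hs : 1 < s) :
    Summable fun v : HeightOneSpectrum (𝓞 K) => χ v * (Ideal.absNorm v.asIdeal : ℝ) ^ (-s) :=
  (summable_prime hs).of_norm_bounded fun v => abs_mul_rpow_le (hχ v) _ _

theorem rpow_absNorm_prime_le (v : HeightOneSpectrum (𝓞 K)) {s : ℝ} (hs : 1 < s) :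
    (Ideal.absNorm v.asIdeal : ℝ) ^ (-s) ≤ 1 / 2 := by
  have h2 : (2 : ℝ) ≤ Ideal.absNorm v.asIdeal := by exact_mod_cast two_le_absNorm v
  calc (Ideal.absNorm v.asIdeal : ℝ) ^ (-s) ≤ (Ideal.absNorm v.asIdeal : ℝ) ^ (-1 : ℝ) :=
        Real.rpow_le_rpow_of_exponent_le (by linarith) (by linarith)
    _ ≤ 1 / 2 := by
        rw [Real.rpow_neg_one, one_div]
        exact inv_anti₀ two_pos h2

/-- An upper bound for an `L`-series bounds the corresponding sum over primes. -/
theorem exists_prime_sum_le (χ : Ideal (𝓞 K) →*₀ ℝ) (hχ : ∀ I, |χ I| ≤ 1) {C : ℝ}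
    (hC : ∀ s : ℝ, 1 < s → s ≤ 2 →
      ∑' I : Ideal (𝓞 K), χ I * (Ideal.absNorm I : ℝ) ^ (-s) ≤ C) {s : ℝ} (hs : 1 < s)
    (hs2 : s ≤ 2) :
    ∑' v : HeightOneSpectrum (𝓞 K), χ v.asIdeal * (Ideal.absNorm v.asIdeal : ℝ) ^ (-s)
      ≤ Real.log C := by
  have h := exp_tsum_le_tsum (twist χ s) (summable_mul_rpow hχ hs)
    (summable_prime_mul (fun v => hχ v.asIdeal) hs) fun v =>
      (abs_mul_rpow_le (hχ _) _ _).trans (rpow_absNorm_prime_le v hs)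
  have h' := h.trans (hC s hs hs2)
  rwa [← Real.le_log_iff_exp_le ((Real.exp_pos _).trans_le h')] at h'

open scoped Classical in
variable (K) in
/-- The indicator function of the nonzero ideals. -/
def oneChar : Ideal (𝓞 K) →*₀ ℝ where
  toFun I := if I = 0 then 0 else 1
  map_zero' := if_pos rfl
  map_one' := if_neg one_ne_zero
  map_mul' I J := by
    rcases eq_or_ne I 0 with rfl | hI
    · rw [zero_mul, if_pos rfl, zero_mul]
    · rcases eq_or_ne J 0 with rfl | hJ
      · rw [mul_zero, if_pos rfl, mul_zero]
      · rw [if_neg (mul_ne_zero hI hJ), if_neg hI, if_neg hJ, one_mul]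

omit [NumberField K] in
theorem abs_oneChar_le (I : Ideal (𝓞 K)) : |oneChar K I| ≤ 1 := by
  change |if I = 0 then (0 : ℝ) else 1| ≤ 1
  split_ifs <;> simp

theorem oneChar_mul_rpow {s : ℝ} (hs : s ≠ 0) (I : Ideal (𝓞 K)) :
    oneChar K I * (Ideal.absNorm I : ℝ) ^ (-s) = (Ideal.absNorm I : ℝ) ^ (-s) := by
  change (if I = 0 then (0 : ℝ) else 1) * _ = _
  split_ifs with h0
  · rw [h0, rpow_absNorm_zero K hs, mul_zero]
  · rw [one_mul]

variable (K) in
theorem exists_prime_sum_upper :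
    ∃ C : ℝ, ∀ s : ℝ, 1 < s → s ≤ 2 →
      ∑' v : HeightOneSpectrum (𝓞 K), (Ideal.absNorm v.asIdeal : ℝ) ^ (-s)
        ≤ Real.log (1 / (s - 1)) + C := by
  classical
  obtain ⟨c, C, hc, hC, h⟩ := exists_tsum_rpow_absNorm_bounds K
  refine ⟨Real.log C, fun s hs hs2 => ?_⟩
  set χ := oneChar K
  have hχ : ∀ I, |χ I| ≤ 1 := abs_oneChar_le
  have hχ1 : ∀ I, χ I * (Ideal.absNorm I : ℝ) ^ (-s) = (Ideal.absNorm I : ℝ) ^ (-s) :=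
    oneChar_mul_rpow (by linarith)
  have h1 := exp_tsum_le_tsum (twist χ s) (summable_mul_rpow hχ hs)
    (summable_prime_mul (fun v => hχ v.asIdeal) hs) fun v =>
      (abs_mul_rpow_le (hχ _) _ _).trans (rpow_absNorm_prime_le v hs)
  have hs0 : 0 < s - 1 := by linarith
  rw [← Real.log_mul (by positivity) hC.ne', Real.le_log_iff_exp_le (by positivity)]
  calc _ = Real.exp (∑' v : HeightOneSpectrum (𝓞 K), twist χ s v.asIdeal) := by
        congr 1
        exact tsum_congr fun v => (hχ1 _).symm
    _ ≤ _ := h1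
    _ = _ := tsum_congr fun I => hχ1 I
    _ ≤ _ := (h s hs hs2).2
    _ = _ := by ring

variable (K) in
theorem exists_prime_sum_lower :
    ∃ C : ℝ, ∀ s : ℝ, 1 < s → s ≤ 2 →
      Real.log (1 / (s - 1)) - C
        ≤ ∑' v : HeightOneSpectrum (𝓞 K), (Ideal.absNorm v.asIdeal : ℝ) ^ (-s) := by
  classical
  obtain ⟨c, C, hc, hC, h⟩ := exists_tsum_rpow_absNorm_bounds K
  refine ⟨2 * ∑' v : HeightOneSpectrum (𝓞 K), (Ideal.absNorm v.asIdeal : ℝ) ^ (-2 : ℝ)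
    - Real.log c, fun s hs hs2 => ?_⟩
  set χ := oneChar K
  have hχ : ∀ I, |χ I| ≤ 1 := abs_oneChar_le
  have hχ1 : ∀ I, χ I * (Ideal.absNorm I : ℝ) ^ (-s) = (Ideal.absNorm I : ℝ) ^ (-s) :=
    oneChar_mul_rpow (by linarith)
  have hsq : ∀ v : HeightOneSpectrum (𝓞 K), (twist χ s v.asIdeal) ^ 2
      ≤ (Ideal.absNorm v.asIdeal : ℝ) ^ (-2 : ℝ) := fun v => by
    have h2 : (2 : ℝ) ≤ Ideal.absNorm v.asIdeal := by exact_mod_cast two_le_absNorm v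
    have : twist χ s v.asIdeal = (Ideal.absNorm v.asIdeal : ℝ) ^ (-s) := hχ1 _
    rw [this, ← Real.rpow_natCast, ← Real.rpow_mul (Nat.cast_nonneg _)]
    refine Real.rpow_le_rpow_of_exponent_le (by linarith) ?_
    push_cast
    linarith
  have hsum2 : Summable fun v : HeightOneSpectrum (𝓞 K) => (twist χ s v.asIdeal) ^ 2 :=
    (summable_prime one_lt_two).of_nonneg_of_le (fun _ => sq_nonneg _) hsq
  have h1 := tsum_le_exp_tsum (twist χ s) (summable_mul_rpow hχ hs)
    (summable_prime_mul (fun v => hχ v.asIdeal) hs) hsum2 fun v =>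
      (abs_mul_rpow_le (hχ _) _ _).trans (rpow_absNorm_prime_le v hs)
  have hs0 : 0 < s - 1 := by linarith
  have h2 : c / (s - 1) ≤ _ := ((h s hs hs2).1.trans
    (tsum_congr fun I => (hχ1 I).symm).le).trans h1
  rw [← Real.log_le_iff_le_exp (by positivity), div_eq_mul_one_div,
    Real.log_mul hc.ne' (by positivity)] at h2
  have h3 := hsum2.tsum_le_tsum hsq (summable_prime one_lt_two)
  have h4 : ∑' v : HeightOneSpectrum (𝓞 K), twist χ s v.asIdeal
      = ∑' v : HeightOneSpectrum (𝓞 K), (Ideal.absNorm v.asIdeal : ℝ) ^ (-s) :=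
    tsum_congr fun v => hχ1 _
  linarith

end Zeta

section Riemann

open MeasureTheory Module Filter

variable {E : Type*} [NormedAddCommGroup E] [NormedSpace ℝ E] [FiniteDimensional ℝ E]
  [MeasurableSpace E] [BorelSpace E] (μ : Measure E) [μ.IsAddHaarMeasure]
  (L : Submodule ℤ E) [DiscreteTopology L] [IsZLattice ℝ L]

omit [MeasurableSpace E] [BorelSpace E] in
theorem summable_one_add_norm_pow_inv (t : E) :
    Summable fun α : L => ((1 + ‖t + α‖) ^ (finrank ℝ E + 1))⁻¹ := by
  have h := ZLattice.summable_norm_sub_inv_pow L (finrank ℝ E + 1)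
    (by rw [ZLattice.rank ℝ L]; exact Nat.lt_succ_self _) (-t)
  refine Summable.of_norm_bounded_eventually h ?_
  have hfin : Set.Finite {α : L | t + α = 0} := by
    refine Set.Subsingleton.finite fun α hα β hβ => ?_
    have h1 : t + (α : E) = t + β := Eq.trans hα (Eq.symm hβ)
    exact Subtype.ext (add_left_cancel h1)
  refine hfin.subset fun α hα => ?_
  by_contra h0
  refine hα ?_
  change t + (α : E) ≠ 0 at h0
  have hpos : 0 < ‖t + (α : E)‖ := norm_pos_iff.2 h0
  change ‖((1 + ‖t + (α:E)‖) ^ (finrank ℝ E + 1))⁻¹‖ ≤ ‖(α:E) - -t‖⁻¹ ^ (finrank ℝ E + 1)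
  rw [norm_inv, norm_pow, Real.norm_of_nonneg (by positivity), inv_pow, sub_neg_eq_add,
    add_comm (α : E)]
  gcongr
  linarith

/-- Lattice sums of slowly varying functions are approximated by integrals. -/
theorem exists_lattice_sum_approx (t : E) :
    ∃ R D : ℝ, 0 ≤ D ∧ ∀ (h : E → ℝ) (C : ℝ), Integrable h μ →
      (∀ x y, ‖x - y‖ ≤ R → |h x - h y| ≤ C * ((1 + ‖x‖) ^ (finrank ℝ E + 1))⁻¹) →
      Summable (fun α : L => h (t + α)) ∧
      |(∑' α : L, h (t + α)) * ZLattice.covolume L μ - ∫ x, h x ∂μ| ≤ C * D := by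
  have : Free ℤ L := ZLattice.module_free ℝ L
  have : Module.Finite ℤ L := ZLattice.module_finite ℝ L
  let b := Free.chooseBasis ℤ L
  set S := ZSpan.fundamentalDomain (b.ofZLatticeBasis ℝ) with hS
  have hfd : IsAddFundamentalDomain L S μ := ZLattice.isAddFundamentalDomain b μ
  have hvol : ZLattice.covolume L μ = μ.real S :=
    ZLattice.covolume_eq_measure_fundamentalDomain L μ hfd
  have hbdd : Bornology.IsBounded S := ZSpan.fundamentalDomain_isBounded _
  have hmeas : MeasurableSet S := ZSpan.fundamentalDomain_measurableSet _
  have hfin : μ S < ⊤ := hbdd.measure_lt_top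
  obtain ⟨R₀, hR₀⟩ := isBounded_iff_forall_norm_le.1 hbdd
  have hpos : 0 < μ.real S := hvol ▸ ZLattice.covolume_pos L μ
  have hsum := summable_one_add_norm_pow_inv L t
  refine ⟨‖t‖ + R₀, μ.real S * ∑' α : L, ((1 + ‖t + α‖) ^ (finrank ℝ E + 1))⁻¹,
    by positivity, fun h C hintg hlip => ?_⟩
  have hvinv : VAddInvariantMeasure L E μ :=
    inferInstanceAs (VAddInvariantMeasure L.toAddSubgroup E μ)
  have hmv : MeasurableVAdd L E := inferInstanceAs (MeasurableVAdd L.toAddSubgroup E)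
  have hintα : ∀ α : L, IntegrableOn (fun x => h (α +ᵥ x)) S μ := fun α =>
    (Integrable.comp_add_left hintg (α : E)).integrableOn
  have hclose : ∀ α : L, |h (t + α) * μ.real S - ∫ x in S, h (α +ᵥ x) ∂μ|
      ≤ C * μ.real S * ((1 + ‖t + α‖) ^ (finrank ℝ E + 1))⁻¹ := by
    intro α
    have h1 : h (t + α) * μ.real S = ∫ x in S, h (t + α) ∂μ := by
      rw [setIntegral_const, smul_eq_mul, mul_comm]
    rw [h1, ← integral_sub (show Integrable (fun _ => h (t + α)) (μ.restrict S) from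
      integrableOn_const hfin.ne) (hintα α)]
    have := norm_setIntegral_le_of_norm_le_const (μ := μ) (s := S)
      (f := fun x => h (t + α) - h (α +ᵥ x))
      (C := C * ((1 + ‖t + α‖) ^ (finrank ℝ E + 1))⁻¹) hfin fun x hx => by
        refine hlip _ _ ?_
        have : t + (α : E) - (α +ᵥ x) = t - x := by
          change t + (α : E) - ((α : E) + x) = t - x
          abel
        rw [this]
        exact (norm_sub_le _ _).trans (by gcongr; exact hR₀ x hx)
    rw [Real.norm_eq_abs] at this
    refine this.trans (le_of_eq ?_)
    ring
  have hI : HasSum (fun α : L => ∫ x in S, h (α +ᵥ x) ∂μ) (∫ x, h x ∂μ) := by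
    have hsm : Summable (fun α : L => ∫ x in S, h (α +ᵥ x) ∂μ) := by
      have h2 : ∀ α : L, ∫ x in S, h (α +ᵥ x) ∂μ = ∫ x in α +ᵥ S, h x ∂μ := fun α =>
        ((measurePreserving_vadd α μ).setIntegral_image_emb
          (measurableEmbedding_const_vadd α) h S).symm
      have h3 : HasSum (fun α : L => ∫ x in α +ᵥ S, h x ∂μ) (∫ x in ⋃ α : L, α +ᵥ S, h x ∂μ) :=
        hasSum_integral_iUnion_ae (fun α => (hfd.nullMeasurableSet_vadd α)) hfd.aedisjoint
          hintg.integrableOn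
      exact h3.summable.congr fun α => (h2 α).symm
    rw [hfd.integral_eq_tsum'' h hintg]
    exact hsm.hasSum
  have hs1 : Summable fun α : L => h (t + α) * μ.real S - ∫ x in S, h (α +ᵥ x) ∂μ :=
    (hsum.mul_left (C * μ.real S)).of_norm_bounded hclose
  have hs2 : Summable fun α : L => h (t + α) * μ.real S :=
    (hs1.add hI.summable).congr fun α => by ring
  have hs3 : Summable fun α : L => h (t + α) := (summable_mul_right_iff hpos.ne').1 hs2
  refine ⟨hs3, ?_⟩
  rw [hvol, ← hI.tsum_eq, ← tsum_mul_right, ← hs2.tsum_sub hI.summable, ← mul_assoc,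
    ← tsum_mul_left]
  rw [← Real.norm_eq_abs]
  exact tsum_of_norm_bounded (hsum.mul_left (C * μ.real S)).hasSum hclose

end Riemann

section Partition

open MeasureTheory Module Filter

variable {E : Type*} [NormedAddCommGroup E] [NormedSpace ℝ E] [FiniteDimensional ℝ E]
  [MeasurableSpace E] [BorelSpace E]
  (L : Submodule ℤ E) [DiscreteTopology L] [IsZLattice ℝ L]

/-- A Lipschitz, compactly supported partition of unity for a lattice. -/
theorem exists_lattice_partition :
    ∃ (W : E → ℝ) (K ρ : ℝ), 0 ≤ K ∧ 0 ≤ ρ ∧ (∀ x, 0 ≤ W x ∧ W x ≤ K) ∧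
      (∀ x y, |W x - W y| ≤ K * ‖x - y‖) ∧ (∀ x, ρ < ‖x‖ → W x = 0) ∧
      ∀ x, HasSum (fun α : L => W (α + x)) 1 := by
  have : Free ℤ L := ZLattice.module_free ℝ L
  have : Module.Finite ℤ L := ZLattice.module_finite ℝ L
  let b := Free.chooseBasis ℤ L
  let μ : Measure E := Measure.addHaar
  set S := ZSpan.fundamentalDomain (b.ofZLatticeBasis ℝ) with hS
  have hfd : IsAddFundamentalDomain L S μ := ZLattice.isAddFundamentalDomain b μ
  have hbdd : Bornology.IsBounded S := ZSpan.fundamentalDomain_isBounded _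
  have hmeas : MeasurableSet S := ZSpan.fundamentalDomain_measurableSet _
  have hfin : μ S < ⊤ := hbdd.measure_lt_top
  obtain ⟨R₀, hR₀⟩ := isBounded_iff_forall_norm_le.1 hbdd
  have hvinv : VAddInvariantMeasure L E μ :=
    inferInstanceAs (VAddInvariantMeasure L.toAddSubgroup E μ)
  have hmv : MeasurableVAdd L E := inferInstanceAs (MeasurableVAdd L.toAddSubgroup E)
  let φ : E → ℝ := fun x => max 0 (1 - ‖x‖)
  have hφc : Continuous φ := by fun_prop
  have hφ0 : ∀ x, 0 ≤ φ x := fun x => le_max_left _ _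
  have hφ1 : ∀ x, φ x ≤ 1 := fun x => max_le zero_le_one (by linarith [norm_nonneg x])
  have hφs : ∀ x, 1 ≤ ‖x‖ → φ x = 0 := fun x hx => max_eq_left (by linarith)
  have hφl : ∀ x y, |φ x - φ y| ≤ ‖x - y‖ := fun x y => by
    have h1 := abs_max_sub_max_le_abs (1 - ‖x‖) (1 - ‖y‖) 0
    rw [sub_sub_sub_cancel_left, max_comm, max_comm (1 - ‖y‖)] at h1
    refine h1.trans ?_
    rw [abs_sub_comm]
    exact abs_norm_sub_norm_le x y
  have hcs : HasCompactSupport φ :=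
    HasCompactSupport.intro (isCompact_closedBall (0 : E) 1) fun x hx => hφs x (by
      rw [Metric.mem_closedBall, dist_zero_right] at hx; linarith)
  have hφi : Integrable φ μ := hφc.integrable_of_hasCompactSupport hcs
  set c := ∫ x, φ x ∂μ with hc
  have hcpos : 0 < c := hφc.integral_pos_of_hasCompactSupport_nonneg_nonzero hcs hφ0
    (x := 0) (by simp [φ])
  have hintg : ∀ x, IntegrableOn (fun t => φ (t + x)) S μ := fun x =>
    (hφi.comp_add_right x).integrableOn
  have hnn : 0 ≤ μ.real S := measureReal_nonneg
  refine ⟨fun x => c⁻¹ * ∫ t in S, φ (t + x) ∂μ, c⁻¹ * μ.real S, 1 + |R₀|, by positivity,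
    by positivity, fun x => ⟨?_, ?_⟩, fun x y => ?_, fun x hx => ?_, fun x => ?_⟩
  · exact mul_nonneg (by positivity) (integral_nonneg fun t => hφ0 _)
  · refine mul_le_mul_of_nonneg_left ?_ (inv_nonneg.2 hcpos.le)
    have := norm_setIntegral_le_of_norm_le_const (μ := μ) (s := S) (f := fun t => φ (t + x))
      (C := 1) hfin fun t _ => by rw [Real.norm_of_nonneg (hφ0 _)]; exact hφ1 _
    rw [one_mul] at this
    exact (le_abs_self _).trans this
  · rw [← mul_sub, ← integral_sub (hintg x) (hintg y), abs_mul, abs_of_pos (inv_pos.2 hcpos),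
      mul_assoc]
    gcongr
    have := norm_setIntegral_le_of_norm_le_const (μ := μ) (s := S)
      (f := fun t => φ (t + x) - φ (t + y)) (C := ‖x - y‖) hfin fun t _ => by
        have := hφl (t + x) (t + y)
        rwa [add_sub_add_left_eq_sub] at this
    rw [mul_comm]
    exact this
  · have h0 : Set.EqOn (fun t => φ (t + x)) (fun _ => (0 : ℝ)) S := fun t ht => by
      refine hφs _ ?_
      have h1 := hR₀ t ht
      have h2 : ‖x‖ ≤ ‖t + x‖ + ‖t‖ := by
        calc ‖x‖ = ‖(t + x) - t‖ := by rw [add_sub_cancel_left]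
          _ ≤ _ := norm_sub_le _ _
      linarith [le_abs_self R₀]
    change c⁻¹ * ∫ t in S, φ (t + x) ∂μ = 0
    rw [setIntegral_congr_fun hmeas h0]
    simp
  · have hix : Integrable (fun t => φ (t + x)) μ := hφi.comp_add_right x
    have h2 : ∀ α : L, ∫ t in S, φ (t + (α + x)) ∂μ = ∫ t in α +ᵥ S, φ (t + x) ∂μ := fun α => by
      rw [← Set.image_vadd, (measurePreserving_vadd α μ).setIntegral_image_emb
          (measurableEmbedding_const_vadd α)]
      refine integral_congr_ae (Filter.Eventually.of_forall fun t => ?_)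
      change φ (t + (α + x)) = φ ((α : E) + t + x)
      congr 1; abel
    have h3 : HasSum (fun α : L => ∫ t in α +ᵥ S, φ (t + x) ∂μ)
        (∫ t in ⋃ α : L, α +ᵥ S, φ (t + x) ∂μ) :=
      hasSum_integral_iUnion_ae (fun α => (hfd.nullMeasurableSet_vadd α)) hfd.aedisjoint
        hix.integrableOn
    have h4 : Summable fun α : L => ∫ t in S, φ (t + (α + x)) ∂μ :=
      h3.summable.congr fun α => (h2 α).symm
    have h5 : ∑' α : L, ∫ t in S, φ (t + (α + x)) ∂μ = c := by
      have h6 := hfd.integral_eq_tsum'' (fun t => φ (t + x)) hix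
      rw [integral_add_right_eq_self (μ := μ) φ x] at h6
      rw [hc, h6]
      refine tsum_congr fun α => integral_congr_ae (Filter.Eventually.of_forall fun t => ?_)
      change φ (t + (α + x)) = φ ((α : E) + t + x)
      congr 1; abel
    have h7 := (h5 ▸ h4.hasSum).mul_left c⁻¹
    rwa [inv_mul_cancel₀ hcpos.ne'] at h7

/-- Twisted lattice sums of a slowly varying function with vanishing integral are bounded. -/
theorem exists_periodic_lattice_sum_bound (μ : Measure E) [μ.IsAddHaarMeasure]
    (q : ℕ) (hq : q ≠ 0) (f : L → ℝ) (hf : ∀ α β, f (α + q • β) = f α) :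
    ∃ R D : ℝ, 0 ≤ D ∧ ∀ (h : E → ℝ) (C : ℝ), 0 ≤ C → Integrable h μ → ∫ x, h x ∂μ = 0 →
      (∀ x y, ‖x - y‖ ≤ R → |h x - h y| ≤ C * ((1 + ‖x‖) ^ (finrank ℝ E + 1))⁻¹) →
      Summable (fun α : L => f α * h α) ∧ |∑' α : L, f α * h α| ≤ C * D := by
  have : Free ℤ L := ZLattice.module_free ℝ L
  have : Module.Finite ℤ L := ZLattice.module_finite ℝ L
  let N : Submodule ℤ L := Ideal.span {(q : ℤ)} • (⊤ : Submodule ℤ L)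
  have hN : ∀ α β : L, (Submodule.Quotient.mk α : L ⧸ N) = Submodule.Quotient.mk β ↔
      ∃ γ, α = β + q • γ := by
    intro α β
    rw [Submodule.Quotient.eq, show N = (q : ℤ) • (⊤ : Submodule ℤ L) from
      Submodule.ideal_span_singleton_smul _ _,
      Submodule.mem_smul_pointwise_iff_exists]
    constructor
    · rintro ⟨γ, -, hγ⟩
      exact ⟨γ, by rw [← sub_eq_iff_eq_add', ← hγ, natCast_zsmul]⟩
    · rintro ⟨γ, rfl⟩
      exact ⟨γ, trivial, by rw [add_sub_cancel_left, natCast_zsmul]⟩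
  have hfin : Finite (L ⧸ N) := by
    have : Finite (ℤ ⧸ Ideal.span {(q : ℤ)}) := by
      have : NeZero q := ⟨hq⟩
      exact Finite.of_equiv _ (Int.quotientSpanNatEquivZMod q).symm.toEquiv
    exact Submodule.finite_quotient_smul _ Module.Finite.fg_top
  have := Fintype.ofFinite (L ⧸ N)
  let β : L ⧸ N → L := Quotient.out
  have hβ : ∀ r, (Submodule.Quotient.mk (β r) : L ⧸ N) = r := fun r => Quotient.out_eq r
  have hex : ∀ r : L ⧸ N, ∃ R D : ℝ, 0 ≤ D ∧ ∀ (h : E → ℝ) (C : ℝ), 0 ≤ C → Integrable h μ →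
      ∫ x, h x ∂μ = 0 →
      (∀ x y, ‖x - y‖ ≤ R → |h x - h y| ≤ C * ((1 + ‖x‖) ^ (finrank ℝ E + 1))⁻¹) →
      Summable (fun α : L => h (β r + (q : ℝ) • (α : E))) ∧
      |∑' α : L, h (β r + (q : ℝ) • (α : E))| ≤ C * D := by
    intro r
    obtain ⟨R, D, hD, H⟩ := exists_lattice_sum_approx μ L (0 : E)
    have hq0 : (0 : ℝ) < q := by positivity
    have hcov := ZLattice.covolume_pos L μ
    set B : ℝ := 1 + ‖(β r : E)‖ with hB
    refine ⟨q * R, B ^ (finrank ℝ E + 1) * D * (ZLattice.covolume L μ)⁻¹, by positivity,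
      fun h C hC hintg h0 hlip => ?_⟩
    obtain ⟨h1, h2⟩ := H (fun x => h (β r + (q : ℝ) • x)) (C * B ^ (finrank ℝ E + 1))
      ((Integrable.comp_smul (hintg.comp_add_left (β r : E)) hq0.ne')) fun x y hxy => by
        refine (hlip _ _ ?_).trans ?_
        · rw [add_sub_add_left_eq_sub, ← smul_sub, norm_smul, Real.norm_of_nonneg hq0.le]
          gcongr
        · rw [mul_assoc]
          gcongr
          rw [← inv_inv (B ^ _), ← mul_inv]
          gcongr
          rw [inv_mul_le_iff₀ (by positivity), ← mul_pow]
          gcongr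
          have h3 : ‖(q : ℝ) • x‖ ≤ ‖(β r : E) + (q : ℝ) • x‖ + ‖(β r : E)‖ := by
            calc ‖(q : ℝ) • x‖ = ‖((β r : E) + (q : ℝ) • x) - β r‖ := by rw [add_sub_cancel_left]
              _ ≤ _ := norm_sub_le _ _
          rw [norm_smul, Real.norm_of_nonneg hq0.le] at h3
          have h4 : (1 : ℝ) ≤ q := by exact_mod_cast Nat.one_le_iff_ne_zero.2 hq
          have h5 := norm_nonneg x
          have h6 := norm_nonneg (β r : E)
          have h7 := norm_nonneg ((β r : E) + (q : ℝ) • x)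
          nlinarith
    have h8 : ∫ x, h (β r + (q : ℝ) • x) ∂μ = 0 := by
      rw [Measure.integral_comp_smul μ (fun x => h (β r + x)), integral_add_left_eq_self, h0,
        smul_zero]
    simp only [zero_add] at h1 h2
    refine ⟨h1, ?_⟩
    rw [h8, sub_zero, abs_mul, abs_of_pos hcov, ← le_div_iff₀ hcov] at h2
    refine h2.trans (le_of_eq ?_)
    rw [div_eq_mul_inv]; ring
  choose R D hD H using hex
  refine ⟨∑ r, |R r|, ∑ r, |f (β r)| * D r,
    Finset.sum_nonneg fun r _ => mul_nonneg (abs_nonneg _) (hD r), fun h C hC hintg h0 hlip => ?_⟩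
  have hr : ∀ r, HasSum (fun α : L => {α | (Submodule.Quotient.mk α : L ⧸ N) = r}.indicator
      (fun α : L => f α * h α) α) (f (β r) * ∑' α : L, h (β r + (q : ℝ) • (α : E))) := by
    intro r
    obtain ⟨h1, -⟩ := H r h C hC hintg h0 fun x y hxy => hlip x y (hxy.trans
      ((le_abs_self _).trans
        (Finset.single_le_sum (f := fun r => |R r|) (fun _ _ => abs_nonneg _) (Finset.mem_univ r))))
    have hinj : Function.Injective fun α : L => β r + q • α := by
      intro a b hab
      have h3 : ((q : ℤ) • a : L) = (q : ℤ) • b := by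
        simpa only [natCast_zsmul] using add_left_cancel hab
      exact smul_right_injective L (Int.natCast_ne_zero.2 hq) h3
    rw [← hinj.hasSum_iff]
    · refine HasSum.congr_fun (h1.hasSum.mul_left (f (β r))) fun α => ?_
      have hmem : β r + q • α ∈ {α | (Submodule.Quotient.mk α : L ⧸ N) = r} := by
        change (Submodule.Quotient.mk (β r + q • α) : L ⧸ N) = r
        conv_rhs => rw [← hβ r]
        exact (hN _ _).2 ⟨α, rfl⟩
      rw [Function.comp_apply, Set.indicator_of_mem hmem, hf]
      congr 2
      push_cast
      rw [Nat.cast_smul_eq_nsmul]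
    · intro α hα
      refine Set.indicator_of_notMem (fun hm => hα ?_) _
      change (Submodule.Quotient.mk α : L ⧸ N) = r at hm
      obtain ⟨γ, hγ⟩ := (hN α (β r)).1 (hm.trans (hβ r).symm)
      exact ⟨γ, hγ.symm⟩
  have hall := hasSum_sum (s := Finset.univ) fun r _ => hr r
  have hfun : (fun α : L => ∑ r, {α | (Submodule.Quotient.mk α : L ⧸ N) = r}.indicator
      (fun α : L => f α * h α) α) = fun α : L => f α * h α := by
    funext α
    rw [Finset.sum_eq_single (Submodule.Quotient.mk α : L ⧸ N)]
    · exact Set.indicator_of_mem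
        (s := {γ | (Submodule.Quotient.mk γ : L ⧸ N) = Submodule.Quotient.mk α}) rfl _
    · intro r _ hne
      exact Set.indicator_of_notMem (s := {α | (Submodule.Quotient.mk α : L ⧸ N) = r})
        (fun hm => hne (Eq.symm hm)) _
    · simp
  rw [hfun] at hall
  refine ⟨hall.summable, ?_⟩
  rw [hall.tsum_eq, Finset.mul_sum]
  refine (Finset.abs_sum_le_sum_abs _ _).trans (Finset.sum_le_sum fun r _ => ?_)
  obtain ⟨-, h2⟩ := H r h C hC hintg h0 fun x y hxy => hlip x y (hxy.trans
      ((le_abs_self _).trans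
        (Finset.single_le_sum (f := fun r => |R r|) (fun _ _ => abs_nonneg _) (Finset.mem_univ r))))
  rw [abs_mul, mul_left_comm]
  gcongr

end Partition

section Cone

open scoped Classical

open MeasureTheory Module NumberField NumberField.mixedEmbedding NumberField.InfinitePlace
  NumberField.Units NumberField.Units.dirichletUnitTheorem

variable {K : Type*} [Field K] [NumberField K]

theorem log_norm_eq_sum {x : mixedSpace K} (hx : mixedEmbedding.norm x ≠ 0) :
    Real.log (mixedEmbedding.norm x) = ∑ w, mult w * Real.log (normAtPlace w x) := by
  rw [mixedEmbedding.norm_apply, Real.log_prod fun w _ => pow_ne_zero _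
    (mixedEmbedding.norm_ne_zero_iff.1 hx w)]
  simp [Real.log_pow]

theorem normAtPlace_pos {x : mixedSpace K} (hx : mixedEmbedding.norm x ≠ 0)
    (w : InfinitePlace K) : 0 < normAtPlace w x :=
  (normAtPlace_nonneg w x).lt_of_ne' (mixedEmbedding.norm_ne_zero_iff.1 hx w)

theorem normAtPlace_le_norm (w : InfinitePlace K) (x : mixedSpace K) : normAtPlace w x ≤ ‖x‖ := by
  classical
  rw [norm_eq_sup'_normAtPlace]
  exact Finset.le_sup' (fun w => normAtPlace w x) (Finset.mem_univ w)

theorem abs_normAtPlace_sub_le (w : InfinitePlace K) (x y : mixedSpace K) :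
    |normAtPlace w x - normAtPlace w y| ≤ ‖x - y‖ := by
  have h : ∀ x y : mixedSpace K, normAtPlace w x - normAtPlace w y ≤ ‖x - y‖ := fun x y => by
    have h1 := normAtPlace_add_le w (x - y) y
    rw [sub_add_cancel] at h1
    linarith [normAtPlace_le_norm w (x - y)]
  exact abs_le.2 ⟨by linarith [h y x, norm_sub_rev x y], h x y⟩

theorem sum_mult_cast : ∑ w : InfinitePlace K, (mult w : ℝ) = finrank ℚ K := by
  rw [← sum_mult_eq (K := K)]; push_cast; rfl

/-- On the support of a bounded function of `logMap`, all places have comparable size. -/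
theorem exists_norm_le_normAtPlace (K : Type*) [Field K] [NumberField K] (ρ : ℝ) :
    ∃ κ : ℝ, 1 ≤ κ ∧ ∀ x : mixedSpace K, mixedEmbedding.norm x ≠ 0 → ‖logMap x‖ ≤ ρ →
      ∀ w, ‖x‖ ≤ κ * normAtPlace w x := by
  classical
  set c : ℝ := (Fintype.card (InfinitePlace K) : ℝ) with hc
  have hc1 : 1 ≤ c := by
    rw [hc]; exact_mod_cast Fintype.card_pos
  refine ⟨Real.exp (2 * (c * |ρ|)), Real.one_le_exp (by positivity), fun x hx hρ w => ?_⟩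
  have hρ0 : 0 ≤ ρ := (norm_nonneg _).trans hρ
  rw [abs_of_nonneg hρ0]
  set A := Real.log (mixedEmbedding.norm x) * (finrank ℚ K : ℝ)⁻¹ with hA
  have hn : (finrank ℚ K : ℝ) ≠ 0 := Nat.cast_ne_zero.2 finrank_pos.ne'
  have hsum : ∑ w, (mult w : ℝ) * (Real.log (normAtPlace w x) - A) = 0 := by
    simp_rw [mul_sub]
    rw [Finset.sum_sub_distrib, ← log_norm_eq_sum hx, ← Finset.sum_mul, sum_mult_cast, hA]
    field_simp
    ring
  have h1 : ∀ w : InfinitePlace K, w ≠ w₀ →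
      |(mult w : ℝ) * (Real.log (normAtPlace w x) - A)| ≤ ρ := fun w hw =>
    (norm_le_pi_norm (logMap x) ⟨w, hw⟩).trans hρ
  have h2 : ∀ w : InfinitePlace K,
      |(mult w : ℝ) * (Real.log (normAtPlace w x) - A)| ≤ c * ρ := by
    intro w
    by_cases hw : w = w₀
    · rw [← Finset.add_sum_erase _ _ (Finset.mem_univ w)] at hsum
      rw [eq_neg_of_add_eq_zero_left hsum, abs_neg]
      refine (Finset.abs_sum_le_sum_abs _ _).trans ((Finset.sum_le_card_nsmul _ _ ρ
        fun v hv => h1 v ?_).trans ?_)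
      · rw [← hw]; exact Finset.ne_of_mem_erase hv
      · rw [nsmul_eq_mul]
        gcongr
        rw [hc]
        exact_mod_cast Finset.card_le_univ _
    · exact (h1 w hw).trans (le_mul_of_one_le_left hρ0 hc1)
  have h3 : ∀ w : InfinitePlace K, |Real.log (normAtPlace w x) - A| ≤ c * ρ := fun w => by
    refine le_trans ?_ (h2 w)
    rw [abs_mul, abs_of_pos (lt_of_lt_of_le one_pos (one_le_mult (w := w)))]
    exact le_mul_of_one_le_left (abs_nonneg _) one_le_mult
  rw [norm_eq_sup'_normAtPlace]
  refine Finset.sup'_le _ _ fun v _ => ?_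
  rw [← Real.exp_log (normAtPlace_pos hx w), ← Real.exp_log (normAtPlace_pos hx v),
    ← Real.exp_add]
  refine Real.exp_le_exp.2 ?_
  linarith [abs_le.1 (h3 v), abs_le.1 (h3 w)]

theorem mul_log_le_log_norm {x : mixedSpace K} {M : ℝ} (hM : 0 < M)
    (h : ∀ w, M ≤ normAtPlace w x) :
    finrank ℚ K * Real.log M ≤ Real.log (mixedEmbedding.norm x) := by
  have hx : mixedEmbedding.norm x ≠ 0 :=
    mixedEmbedding.norm_ne_zero_iff.2 fun w => (hM.trans_le (h w)).ne'
  rw [log_norm_eq_sum hx, ← sum_mult_cast, Finset.sum_mul]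
  exact Finset.sum_le_sum fun w _ => mul_le_mul_of_nonneg_left
    (Real.log_le_log hM (h w)) (by positivity)

theorem log_one_add_norm_le {κ : ℝ} (hκ : 1 ≤ κ) {x : mixedSpace K}
    (hx : mixedEmbedding.norm x ≠ 0) (h : ∀ w, ‖x‖ ≤ κ * normAtPlace w x) :
    finrank ℚ K * Real.log (1 + ‖x‖) ≤
      finrank ℚ K * Real.log (1 + κ) + max 0 (Real.log (mixedEmbedding.norm x)) := by
  have hx0 : 0 < ‖x‖ := norm_pos_iff.2 fun h0 => hx (by rw [h0, map_zero])
  by_cases h1 : ‖x‖ ≤ κ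
  · have : Real.log (1 + ‖x‖) ≤ Real.log (1 + κ) := Real.log_le_log (by linarith) (by linarith)
    have := mul_le_mul_of_nonneg_left this (Nat.cast_nonneg (α := ℝ) (finrank ℚ K))
    linarith [le_max_left 0 (Real.log (mixedEmbedding.norm x))]
  · push Not at h1
    have h2 := mul_log_le_log_norm (x := x) (M := ‖x‖ / κ) (by positivity) fun w => by
      rw [div_le_iff₀' (by linarith)]; exact h w
    have h3 : Real.log (1 + ‖x‖) ≤ Real.log (1 + κ) + Real.log (‖x‖ / κ) := by
      rw [← Real.log_mul (by linarith) (by positivity)]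
      refine Real.log_le_log (by positivity) ?_
      have : 1 ≤ ‖x‖ / κ := by rw [one_le_div (by linarith)]; exact h1.le
      have h4 : κ * (‖x‖ / κ) = ‖x‖ := by field_simp
      rw [add_mul, h4]
      linarith
    have := mul_le_mul_of_nonneg_left h3 (Nat.cast_nonneg (α := ℝ) (finrank ℚ K))
    linarith [le_max_right 0 (Real.log (mixedEmbedding.norm x))]

/-- The function on the mixed space whose lattice sums give partial zeta functions. -/
def coneFun (W : logSpace K → ℝ) (sg : mixedSpace K → ℝ) (s : ℝ) (x : mixedSpace K) : ℝ :=
  if mixedEmbedding.norm x = 0 then 0 else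
    sg x * (W (logMap x) * Real.exp (-(s * max 0 (Real.log (mixedEmbedding.norm x)))))

theorem abs_exp_neg_sub_le {a b c : ℝ} (ha : c ≤ a) (hb : c ≤ b) :
    |Real.exp (-a) - Real.exp (-b)| ≤ |a - b| * Real.exp (-c) := by
  have key : ∀ a b : ℝ, c ≤ a → Real.exp (-a) - Real.exp (-b) ≤ |a - b| * Real.exp (-c) := by
    intro a b ha
    have h1 : Real.exp (-a) - Real.exp (-b) ≤ (b - a) * Real.exp (-a) := by
      have := Real.add_one_le_exp (a - b)
      have h2 : Real.exp (-b) = Real.exp (-a) * Real.exp (a - b) := by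
        rw [← Real.exp_add]; ring_nf
      rw [h2]
      nlinarith [Real.exp_pos (-a)]
    refine h1.trans ?_
    have h3 : Real.exp (-a) ≤ Real.exp (-c) := Real.exp_le_exp.2 (by linarith)
    calc (b - a) * Real.exp (-a) ≤ |a - b| * Real.exp (-a) := by
          gcongr; rw [abs_sub_comm]; exact le_abs_self _
      _ ≤ _ := by gcongr
  refine abs_le.2 ⟨?_, key a b ha⟩
  have := key b a hb
  rw [abs_sub_comm] at this
  linarith

variable {W : logSpace K → ℝ} {sg : mixedSpace K → ℝ} {B ρ : ℝ}

theorem exists_abs_coneFun_le (hB : 0 ≤ B) (hW : ∀ v, |W v| ≤ B) (hsg : ∀ x, |sg x| ≤ 1)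
    (hsupp : ∀ v, ρ < ‖v‖ → W v = 0) :
    ∃ C : ℝ, 0 ≤ C ∧ ∀ s, 1 ≤ s → s ≤ 2 → ∀ x,
      |coneFun W sg s x| ≤ C * (1 + ‖x‖) ^ (-(s * finrank ℚ K)) := by
  obtain ⟨κ, hκ, H⟩ := exists_norm_le_normAtPlace K ρ
  have hlogκ : 0 ≤ Real.log (1 + κ) := Real.log_nonneg (by linarith)
  refine ⟨B * Real.exp (2 * (finrank ℚ K * Real.log (1 + κ))), by positivity,
    fun s hs1 hs2 x => ?_⟩
  rw [coneFun]
  split_ifs with hx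
  · rw [abs_zero]; positivity
  by_cases hv : ‖logMap x‖ ≤ ρ
  · have h1 := log_one_add_norm_le hκ hx (H x hx hv)
    rw [Real.rpow_def_of_pos (by positivity), mul_assoc B, ← Real.exp_add, abs_mul, abs_mul,
      Real.abs_exp]
    calc _ ≤ 1 * (B * Real.exp (-(s * max 0 (Real.log (mixedEmbedding.norm x))))) := by
          gcongr
          · exact hsg x
          · exact hW _
      _ ≤ _ := by
          rw [one_mul]
          gcongr
          have h2 : s * (finrank ℚ K * Real.log (1 + ‖x‖)) ≤ s * (finrank ℚ K * Real.log (1 + κ) +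
            max 0 (Real.log (mixedEmbedding.norm x))) := by gcongr
          have h3 : s * (finrank ℚ K * Real.log (1 + κ)) ≤ 2 * (finrank ℚ K * Real.log (1 + κ)) := by
            gcongr
          nlinarith
  · rw [hsupp _ (not_le.1 hv)]
    simp only [zero_mul, mul_zero, abs_zero]
    positivity

theorem measurable_logMap : Measurable (logMap (K := K)) := by
  refine measurable_pi_iff.2 fun w => measurable_const.mul ?_
  exact (continuous_normAtPlace _).measurable.log.sub <|
      (mixedEmbedding.continuous_norm K).measurable.log.mul measurable_const

theorem integrable_coneFun (hWm : Measurable W) (hsgm : Measurable sg) (hB : 0 ≤ B)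
    (hW : ∀ v, |W v| ≤ B)
    (hsg : ∀ x, |sg x| ≤ 1) (hsupp : ∀ v, ρ < ‖v‖ → W v = 0) {s : ℝ} (hs : 1 < s) (hs2 : s ≤ 2) :
    Integrable (coneFun W sg s) := by
  obtain ⟨C, hC, H⟩ := exists_abs_coneFun_le hB hW hsg hsupp
  have hn : (0 : ℝ) < finrank ℚ K := Nat.cast_pos.2 finrank_pos
  refine Integrable.mono' ((integrable_one_add_norm (E := mixedSpace K) (μ := volume)
    (r := s * finrank ℚ K) ?_).const_mul C) ?_ (Filter.Eventually.of_forall fun x => H s hs.le hs2 x)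
  · rw [mixedEmbedding.finrank]; nlinarith
  · refine Measurable.aestronglyMeasurable ?_
    refine Measurable.ite (measurableSet_eq_fun (mixedEmbedding.continuous_norm K).measurable
      measurable_const) measurable_const ?_
    refine hsgm.mul ((hWm.comp measurable_logMap).mul ?_)
    exact (((measurable_const.max (mixedEmbedding.continuous_norm K).measurable.log).const_mul
      s).neg).exp

theorem abs_log_sub_log_le {a b δ r : ℝ} (hr : 0 < r) (ha : r ≤ a) (hb : r ≤ b)
    (h : |a - b| ≤ δ) : |Real.log a - Real.log b| ≤ δ / r := by
  have key : ∀ a b : ℝ, r ≤ a → r ≤ b → |a - b| ≤ δ → Real.log a - Real.log b ≤ δ / r := by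
    intro a b ha hb h
    have ha0 : 0 < a := hr.trans_le ha
    have hb0 : 0 < b := hr.trans_le hb
    rw [← Real.log_div ha0.ne' hb0.ne']
    have h1 := Real.log_le_sub_one_of_pos (div_pos ha0 hb0)
    refine h1.trans ?_
    have h2 : a / b - 1 = (a - b) / b := by field_simp
    rw [h2]
    have h3 : 0 ≤ δ := (abs_nonneg _).trans h
    calc (a - b) / b ≤ δ / b := by gcongr; exact (le_abs_self _).trans h
      _ ≤ δ / r := by gcongr
  exact abs_le.2 ⟨by linarith [key b a hb ha (by rwa [abs_sub_comm])], key a b ha hb h⟩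

theorem abs_log_norm_sub_le {x y : mixedSpace K} {δ : ℝ}
    (hx : mixedEmbedding.norm x ≠ 0) (hy : mixedEmbedding.norm y ≠ 0)
    (h : ∀ w, |Real.log (normAtPlace w x) - Real.log (normAtPlace w y)| ≤ δ) :
    |Real.log (mixedEmbedding.norm x) - Real.log (mixedEmbedding.norm y)| ≤ finrank ℚ K * δ := by
  rw [log_norm_eq_sum hx, log_norm_eq_sum hy, ← Finset.sum_sub_distrib, ← sum_mult_cast,
    Finset.sum_mul]
  refine (Finset.abs_sum_le_sum_abs _ _).trans (Finset.sum_le_sum fun w _ => ?_)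
  rw [← mul_sub, abs_mul, abs_of_nonneg (by positivity)]
  gcongr
  exact h w

theorem norm_logMap_sub_le {x y : mixedSpace K} {δ : ℝ} (hδ : 0 ≤ δ)
    (hx : mixedEmbedding.norm x ≠ 0) (hy : mixedEmbedding.norm y ≠ 0)
    (h : ∀ w, |Real.log (normAtPlace w x) - Real.log (normAtPlace w y)| ≤ δ) :
    ‖logMap x - logMap y‖ ≤ 4 * δ := by
  refine (pi_norm_le_iff_of_nonneg (by positivity)).2 fun w => ?_
  have hn : (0 : ℝ) < finrank ℚ K := Nat.cast_pos.2 finrank_pos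
  have h1 := abs_log_norm_sub_le hx hy h
  have h2 : (mult w.1 : ℝ) ≤ 2 := by
    have : mult w.1 ≤ 2 := by rw [mult]; split_ifs <;> norm_num
    exact_mod_cast this
  rw [Pi.sub_apply, logMap_apply, logMap_apply, Real.norm_eq_abs, ← mul_sub, abs_mul,
    abs_of_nonneg (by positivity : (0 : ℝ) ≤ mult w.1)]
  have h3 : |Real.log (normAtPlace w.1 x) - Real.log (mixedEmbedding.norm x) * (finrank ℚ K : ℝ)⁻¹ -
      (Real.log (normAtPlace w.1 y) - Real.log (mixedEmbedding.norm y) * (finrank ℚ K : ℝ)⁻¹)| ≤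
      δ + δ := by
    rw [sub_sub_sub_comm, ← sub_mul]
    refine (abs_sub _ _).trans (add_le_add (h w.1) ?_)
    rw [abs_mul, abs_of_pos (inv_pos.2 hn), ← div_eq_mul_inv, div_le_iff₀ hn, mul_comm δ]
    exact h1
  calc _ ≤ 2 * (δ + δ) := by gcongr
    _ = _ := by ring

theorem coneFun_eq_zero (hsupp : ∀ v, ρ < ‖v‖ → W v = 0) {s : ℝ} {x : mixedSpace K}
    (h : ¬ (mixedEmbedding.norm x ≠ 0 ∧ ‖logMap x‖ ≤ ρ)) : coneFun W sg s x = 0 := by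
  rw [coneFun]
  split_ifs with hx
  · rfl
  · rw [hsupp _ (not_le.1 fun h' => h ⟨hx, h'⟩)]
    simp

/-- The estimate for `coneFun` in the region where all places are large. -/
theorem abs_coneFun_sub_le_of_large (hB : 0 ≤ B) (hW : ∀ v, |W v| ≤ B)
    (hWl : ∀ v v', |W v - W v'| ≤ B * ‖v - v'‖) (hsg : ∀ x, |sg x| ≤ 1)
    (hsgl : ∀ x y, (∀ w, ‖x - y‖ < normAtPlace w x) → sg x = sg y)
    {s r R : ℝ} (hs1 : 1 ≤ s) (hs2 : s ≤ 2) (hr1 : 1 ≤ r) {x y : mixedSpace K}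
    (hR : ‖x - y‖ ≤ R) (hrR : R < r) (hx : ∀ w, r ≤ normAtPlace w x)
    (hy : ∀ w, r ≤ normAtPlace w y) :
    |coneFun W sg s x - coneFun W sg s y| ≤
      (B * (4 + 2 * finrank ℚ K) * R) * (r ^ (finrank ℚ K + 1))⁻¹ := by
  have hr0 : 0 < r := by linarith
  have hR0 : 0 ≤ R := (norm_nonneg _).trans hR
  have hnx : mixedEmbedding.norm x ≠ 0 :=
    mixedEmbedding.norm_ne_zero_iff.2 fun w => (hr0.trans_le (hx w)).ne'
  have hny : mixedEmbedding.norm y ≠ 0 :=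
    mixedEmbedding.norm_ne_zero_iff.2 fun w => (hr0.trans_le (hy w)).ne'
  have hl : ∀ w, |Real.log (normAtPlace w x) - Real.log (normAtPlace w y)| ≤ R / r := fun w =>
    abs_log_sub_log_le hr0 (hx w) (hy w) ((abs_normAtPlace_sub_le w x y).trans hR)
  have hlr : 0 ≤ Real.log r := Real.log_nonneg hr1
  have hδ : 0 ≤ R / r := by positivity
  set ax := s * max 0 (Real.log (mixedEmbedding.norm x)) with hax
  set ay := s * max 0 (Real.log (mixedEmbedding.norm y)) with hay
  have hge : ∀ z : mixedSpace K, (∀ w, r ≤ normAtPlace w z) →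
      finrank ℚ K * Real.log r ≤ s * max 0 (Real.log (mixedEmbedding.norm z)) := fun z hz => by
    have h1 := (mul_log_le_log_norm hr0 hz).trans (le_max_right 0 _)
    exact h1.trans (le_mul_of_one_le_left (le_max_left _ _) hs1)
  have hexp : Real.exp (-(finrank ℚ K * Real.log r)) = (r ^ finrank ℚ K)⁻¹ := by
    rw [Real.exp_neg, Real.exp_nat_mul, Real.exp_log hr0]
  have h1 : |Real.exp (-ax) - Real.exp (-ay)| ≤ (2 * (finrank ℚ K * (R / r))) * (r ^ finrank ℚ K)⁻¹ := by
    rw [← hexp]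
    refine (abs_exp_neg_sub_le (hge x hx) (hge y hy)).trans ?_
    gcongr
    rw [← mul_sub, abs_mul, abs_of_pos (by linarith : 0 < s)]
    gcongr
    refine le_trans ?_ (abs_log_norm_sub_le hnx hny hl)
    rw [max_comm, max_comm 0 (Real.log (mixedEmbedding.norm y))]
    exact abs_max_sub_max_le_abs _ _ _
  have h2 : Real.exp (-ax) ≤ (r ^ finrank ℚ K)⁻¹ := by
    rw [← hexp]
    exact Real.exp_le_exp.2 (neg_le_neg (hge x hx))
  have h3 : |W (logMap x) - W (logMap y)| ≤ B * (4 * (R / r)) :=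
    (hWl _ _).trans (by gcongr; exact norm_logMap_sub_le hδ hnx hny hl)
  have hsgxy : sg x = sg y := hsgl x y fun w => (hR.trans_lt hrR).trans_le (hx w)
  rw [coneFun, coneFun, if_neg hnx, if_neg hny, hsgxy, ← mul_sub, abs_mul]
  have h4 : W (logMap x) * Real.exp (-ax) - W (logMap y) * Real.exp (-ay) =
    (W (logMap x) - W (logMap y)) * Real.exp (-ax) +
      W (logMap y) * (Real.exp (-ax) - Real.exp (-ay)) := by ring
  rw [h4]
  calc _ ≤ 1 * (B * (4 * (R / r)) * (r ^ finrank ℚ K)⁻¹ +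
        B * ((2 * (finrank ℚ K * (R / r))) * (r ^ finrank ℚ K)⁻¹)) := by
        refine mul_le_mul (hsg y) ((abs_add_le _ _).trans (add_le_add ?_ ?_)) (abs_nonneg _)
          zero_le_one
        · rw [abs_mul, Real.abs_exp]
          gcongr
        · rw [abs_mul]
          gcongr
          exact hW _
    _ = _ := by
        rw [pow_succ]
        field_simp

theorem exists_abs_coneFun_sub_le (hB : 0 ≤ B) (hW : ∀ v, |W v| ≤ B)
    (hWl : ∀ v v', |W v - W v'| ≤ B * ‖v - v'‖)
    (hsupp : ∀ v, ρ < ‖v‖ → W v = 0) (hsg : ∀ x, |sg x| ≤ 1)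
    (hsgl : ∀ x y, (∀ w, ‖x - y‖ < normAtPlace w x) → sg x = sg y) (R : ℝ) :
    ∃ C : ℝ, 0 ≤ C ∧ ∀ s, 1 ≤ s → s ≤ 2 → ∀ x y, ‖x - y‖ ≤ R →
      |coneFun W sg s x - coneFun W sg s y| ≤
        C * ((1 + ‖x‖) ^ (finrank ℝ (mixedSpace K) + 1))⁻¹ := by
  rw [mixedEmbedding.finrank]
  obtain ⟨κ, hκ, H⟩ := exists_norm_le_normAtPlace K ρ
  set R' := |R| with hR'
  have hR0 : 0 ≤ R' := abs_nonneg R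
  set M₀ : ℝ := 2 + 2 * R' + 4 * κ * (R' + 1) with hM₀
  have hM₀0 : 0 < M₀ := by positivity
  set C₁ := 2 * B * M₀ ^ (finrank ℚ K + 1) with hC₁
  set C₂ := (B * (4 + 2 * finrank ℚ K) * R') * (4 * κ) ^ (finrank ℚ K + 1) with hC₂
  have hC₁0 : 0 ≤ C₁ := by positivity
  have hC₂0 : 0 ≤ C₂ := by positivity
  refine ⟨C₁ + C₂, by positivity, fun s hs1 hs2 x y hxy => ?_⟩
  have hxy' : ‖x - y‖ ≤ R' := hxy.trans (le_abs_self R)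
  by_cases hM : 1 + ‖x‖ ≤ M₀
  · have hb : ∀ z, |coneFun W sg s z| ≤ B := fun z => by
      rw [coneFun]
      split_ifs
      · simpa using hB
      · rw [abs_mul, abs_mul, Real.abs_exp]
        have h1 : Real.exp (-(s * max 0 (Real.log (mixedEmbedding.norm z)))) ≤ 1 := by
          rw [Real.exp_le_one_iff, neg_nonpos]
          exact mul_nonneg (by linarith) (le_max_left _ _)
        calc _ ≤ 1 * (B * 1) := by
              gcongr
              · exact hsg z
              · exact hW _
          _ = B := by ring
    have h1 : |coneFun W sg s x - coneFun W sg s y| ≤ 2 * B := by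
      refine (abs_sub _ _).trans ?_
      linarith [hb x, hb y]
    refine h1.trans ?_
    rw [← div_eq_mul_inv, le_div_iff₀ (by positivity)]
    calc 2 * B * (1 + ‖x‖) ^ (finrank ℚ K + 1) ≤ C₁ := by rw [hC₁]; gcongr
      _ ≤ C₁ + C₂ := by linarith
  push Not at hM
  by_cases hz : ∃ z, ‖x - z‖ ≤ R' ∧ ‖y - z‖ ≤ R' ∧ mixedEmbedding.norm z ≠ 0 ∧ ‖logMap z‖ ≤ ρ
  · obtain ⟨z, hxz, hyz, hz0, hzρ⟩ := hz
    have hκ0 : 0 < κ := by linarith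
    set r := (1 + ‖x‖) / (4 * κ) with hr
    have hrbig : R' + 1 < r := by
      rw [hr, lt_div_iff₀ (by positivity)]
      have : 0 ≤ κ * (R' + 1) := by positivity
      linarith
    have hzw : ∀ w, 2 * r ≤ normAtPlace w z := fun w => by
      have h1 := H z hz0 hzρ w
      have h2 : ‖x‖ ≤ ‖x - z‖ + ‖z‖ := by
        calc ‖x‖ = ‖(x - z) + z‖ := by rw [sub_add_cancel]
          _ ≤ _ := norm_add_le _ _
      have h3 : 2 * r = ((1 + ‖x‖) / 2) / κ := by rw [hr]; field_simp; ring
      rw [h3, div_le_iff₀' hκ0]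
      have : 0 ≤ κ * (R' + 1) := by positivity
      linarith
    have hge : ∀ t, ‖t - z‖ ≤ R' → ∀ w, r ≤ normAtPlace w t := fun t ht w => by
      have h1 := abs_le.1 ((abs_normAtPlace_sub_le w t z).trans ht)
      linarith [hzw w]
    have h1 := abs_coneFun_sub_le_of_large hB hW hWl hsg hsgl hs1 hs2 (by linarith : 1 ≤ r) hxy'
      (by linarith) (hge x hxz) (hge y hyz)
    refine h1.trans ?_
    have h2 : (r ^ (finrank ℚ K + 1))⁻¹ =
        (4 * κ) ^ (finrank ℚ K + 1) * ((1 + ‖x‖) ^ (finrank ℚ K + 1))⁻¹ := by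
      rw [hr, div_pow, inv_div, div_eq_mul_inv]
    rw [h2, ← mul_assoc]
    gcongr
    linarith
  · push Not at hz
    rw [coneFun_eq_zero hsupp fun h => absurd h.2 (not_le.2 (hz x (by simpa using hR0)
        (by rwa [norm_sub_rev]) h.1)),
      coneFun_eq_zero hsupp fun h => absurd h.2 (not_le.2 (hz y hxy' (by simpa using hR0) h.1)),
      sub_zero, abs_zero]
    positivity

end Cone

section ClassSum

open scoped Classical nonZeroDivisors
open MeasureTheory Module NumberField NumberField.mixedEmbedding NumberField.InfinitePlace
  NumberField.Units NumberField.Units.dirichletUnitTheorem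

variable {K : Type*} [Field K] [NumberField K] {W : logSpace K → ℝ}

theorem hasSum_units (hW0 : ∀ v, 0 ≤ W v)
    (hW : ∀ v, HasSum (fun α : unitLattice K => W (α + v)) 1) {x : mixedSpace K}
    (hx : mixedEmbedding.norm x ≠ 0) :
    HasSum (fun u : (𝓞 K)ˣ => W (logMap (u • x))) (torsionOrder K) := by
  let e := Subgroup.groupEquivQuotientProdSubgroup (s := torsion K)
  let E : (𝓞 K)ˣ ⧸ torsion K ≃ unitLattice K :=
    Additive.ofMul.trans (logEmbeddingEquiv K).toEquiv
  have hE : ∀ u : (𝓞 K)ˣ, (E (QuotientGroup.mk u) : logSpace K) =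
      logEmbedding K (Additive.ofMul u) := fun u => rfl
  have he : ∀ u : (𝓞 K)ˣ, (e u).1 = QuotientGroup.mk u := fun u => rfl
  have h1 : (fun u : (𝓞 K)ˣ => W (logMap (u • x))) =
      (fun p : ((𝓞 K)ˣ ⧸ torsion K) × torsion K => W ((E p.1 : logSpace K) + logMap x)) ∘ e := by
    funext u
    rw [Function.comp_apply, he, hE, logMap_unit_smul u hx]
  rw [h1, e.hasSum_iff]
  have h2 : HasSum (fun q : (𝓞 K)ˣ ⧸ torsion K => W ((E q : logSpace K) + logMap x)) 1 :=
    (E.hasSum_iff (f := fun α : unitLattice K => W (α + logMap x))).2 (hW (logMap x))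
  have h3 : ∀ q : (𝓞 K)ˣ ⧸ torsion K,
      ∑' _ : torsion K, W ((E q : logSpace K) + logMap x) =
        torsionOrder K * W ((E q : logSpace K) + logMap x) := fun q => by
    have := Fintype.ofFinite (torsion K)
    rw [tsum_fintype, Finset.sum_const, nsmul_eq_mul, torsionOrder, Finset.card_univ,
      Nat.card_eq_fintype_card]
  have hs : Summable (fun p : ((𝓞 K)ˣ ⧸ torsion K) × torsion K =>
      W ((E p.1 : logSpace K) + logMap x)) := by
    refine (summable_prod_of_nonneg fun p => hW0 _).2 ⟨fun q => Summable.of_finite, ?_⟩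
    simp_rw [h3]
    exact h2.summable.mul_left _
  have h4 := hs.tsum_prod
  simp_rw [h3] at h4
  rw [tsum_mul_left, h2.tsum_eq, mul_one] at h4
  rw [← h4]
  exact hs.hasSum

theorem hasSum_generators (hW0 : ∀ v, 0 ≤ W v)
    (hW : ∀ v, HasSum (fun α : unitLattice K => W (α + v)) 1) {I : Ideal (𝓞 K)} {α₀ : 𝓞 K}
    (hα₀ : α₀ ≠ 0) (hI : I = Ideal.span {α₀}) :
    HasSum (fun α : {α : 𝓞 K // I = Ideal.span {α}} =>
      W (logMap (mixedEmbedding K (α.1 : K)))) (torsionOrder K) := by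
  subst hI
  let e : (𝓞 K)ˣ ≃ {α : 𝓞 K // Ideal.span {α₀} = Ideal.span {α}} := Equiv.ofBijective
    (fun u => ⟨u * α₀, by
      rw [Ideal.span_singleton_eq_span_singleton]
      exact associated_unit_mul_right _ _ u.isUnit⟩) (by
      constructor
      · intro u v huv
        exact Units.ext (mul_right_cancel₀ hα₀ (congrArg Subtype.val huv))
      · rintro ⟨α, hα⟩
        obtain ⟨u, hu⟩ := Ideal.span_singleton_eq_span_singleton.1 hα
        exact ⟨u, Subtype.ext ((mul_comm _ _).trans hu)⟩)
  have hnorm : mixedEmbedding.norm (mixedEmbedding K (α₀ : K)) ≠ 0 := by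
    rw [mixedEmbedding.norm_eq_norm, Rat.cast_ne_zero, abs_ne_zero, Algebra.norm_ne_zero_iff]
    exact RingOfIntegers.coe_ne_zero_iff.2 hα₀
  rw [← e.hasSum_iff]
  refine HasSum.congr_fun (hasSum_units hW0 hW hnorm) fun u => ?_
  rw [unitSMul_smul, ← map_mul]
  rfl

theorem hasSum_ideals_of_class (hW0 : ∀ v, 0 ≤ W v)
    (hW : ∀ v, HasSum (fun α : unitLattice K => W (α + v)) 1) (J : (Ideal (𝓞 K))⁰)
    (G : (Ideal (𝓞 K))⁰ → ℝ) (Φ : 𝓞 K → ℝ) (hΦ0 : Φ 0 = 0)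
    (hΦ : ∀ (I : (Ideal (𝓞 K))⁰) (α : 𝓞 K), (I : Ideal (𝓞 K)) * (J : Ideal (𝓞 K)) = Ideal.span {α} →
      Φ α = G I * W (logMap (mixedEmbedding K (α : K))))
    (hs : Summable fun α : (J : Ideal (𝓞 K)) => Φ α) :
    HasSum (fun I : {I : (Ideal (𝓞 K))⁰ // ClassGroup.mk0 I = (ClassGroup.mk0 J)⁻¹} =>
      torsionOrder K * G I) (∑' α : (J : Ideal (𝓞 K)), Φ α) := by
  let i (p : Σ I : {I : (Ideal (𝓞 K))⁰ // ClassGroup.mk0 I = (ClassGroup.mk0 J)⁻¹},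
      {α : 𝓞 K // (I.1 : Ideal (𝓞 K)) * (J : Ideal (𝓞 K)) = Ideal.span {α}}) : (J : Ideal (𝓞 K)) :=
    ⟨p.2.1, by
      have h1 : p.2.1 ∈ Ideal.span {p.2.1} := Ideal.mem_span_singleton_self _
      rw [← p.2.2] at h1
      have h2 : (p.1.1 : Ideal (𝓞 K)) * (J : Ideal (𝓞 K)) ≤ (J : Ideal (𝓞 K)) := Ideal.mul_le_right
      exact h2 h1⟩
  have hi : Function.Injective i := by
    rintro ⟨I, α⟩ ⟨I', α'⟩ h
    have h0 : α.1 = α'.1 := congrArg Subtype.val h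
    have h1 : (I.1 : Ideal (𝓞 K)) * (J : Ideal (𝓞 K)) = (I'.1 : Ideal (𝓞 K)) * (J : Ideal (𝓞 K)) := by rw [α.2, α'.2, h0]
    obtain rfl : I = I' := Subtype.ext
      (Subtype.ext (mul_right_cancel₀ (nonZeroDivisors.ne_zero J.2) h1))
    obtain rfl : α = α' := Subtype.ext h0
    rfl
  have hsum : HasSum ((fun α : (J : Ideal (𝓞 K)) => Φ α) ∘ i) (∑' α : (J : Ideal (𝓞 K)), Φ α) := by
    rw [hi.hasSum_iff]
    · exact hs.hasSum
    · intro α hα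
      by_contra h0
      refine hα ?_
      have hα0 : (α : 𝓞 K) ≠ 0 := fun h => h0 (by rw [h, hΦ0])
      obtain ⟨I, hI⟩ := Ideal.dvd_iff_le.2 ((Ideal.span_singleton_le_iff_mem _).2 α.2)
      have hI0 : I ∈ (Ideal (𝓞 K))⁰ := mem_nonZeroDivisors_of_ne_zero fun h => hα0 (by
        rw [h, Submodule.zero_eq_bot, Ideal.mul_bot, Ideal.span_singleton_eq_bot] at hI
        exact hI)
      have hI' : ((⟨I, hI0⟩ : (Ideal (𝓞 K))⁰) * J : Ideal (𝓞 K)) = Ideal.span {(α : 𝓞 K)} := by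
        rw [hI, mul_comm]
      exact ⟨⟨⟨⟨I, hI0⟩, ClassGroup.mk0_eq_mk0_inv_iff.2 ⟨α, hα0, hI'⟩⟩, ⟨α, hI'⟩⟩, rfl⟩
  refine hsum.sigma fun I => ?_
  obtain ⟨α₀, hα₀, hIα⟩ := ClassGroup.mk0_eq_mk0_inv_iff.1 I.2
  rw [mul_comm (torsionOrder K : ℝ)]
  exact ((hasSum_generators hW0 hW hα₀ hIα).mul_left (G I)).congr_fun fun α => hΦ I.1 α.1 α.2

end ClassSum

section Bounded

open scoped Classical nonZeroDivisors
open MeasureTheory Module NumberField NumberField.mixedEmbedding NumberField.InfinitePlace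
  NumberField.Units NumberField.Units.dirichletUnitTheorem

variable {K : Type*} [Field K] [NumberField K] {W : logSpace K → ℝ} {sg : mixedSpace K → ℝ}

theorem coneFun_mixedEmbedding (s : ℝ) {α : 𝓞 K} (hα : α ≠ 0) :
    coneFun W sg s (mixedEmbedding K (α : K)) = sg (mixedEmbedding K (α : K)) *
      (W (logMap (mixedEmbedding K (α : K))) *
        (Ideal.absNorm (Ideal.span {α}) : ℝ) ^ (-s)) := by
  have h0 : Ideal.absNorm (Ideal.span {α}) ≠ 0 := by
    rwa [Ne, Ideal.absNorm_eq_zero_iff, Ideal.span_singleton_eq_bot]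
  have hn : mixedEmbedding.norm (mixedEmbedding K (α : K)) =
      (Ideal.absNorm (Ideal.span {α}) : ℝ) := by
    rw [mixedEmbedding.norm_eq_norm, Ideal.absNorm_span_singleton, ← Algebra.coe_norm_int,
      ← Int.cast_abs, Rat.cast_intCast, Int.abs_eq_natAbs, Int.cast_natCast]
  have h1 : (1 : ℝ) ≤ Ideal.absNorm (Ideal.span {α}) := by
    exact_mod_cast Nat.one_le_iff_ne_zero.2 h0
  rw [coneFun, hn, if_neg (by positivity), max_eq_right (Real.log_nonneg h1),
    Real.rpow_def_of_pos (by positivity)]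
  congr 4
  ring

theorem coneFun_zero (s : ℝ) : coneFun W sg s 0 = 0 := by
  rw [coneFun, if_pos (map_zero _)]

theorem hasSum_class_of_summable (hW0 : ∀ v, 0 ≤ W v)
    (hW : ∀ v, HasSum (fun α : unitLattice K => W (α + v)) 1) (χ : Ideal (𝓞 K) →*₀ ℝ)
    (f : 𝓞 K → ℝ)
    (hχ : ∀ α : 𝓞 K, α ≠ 0 → χ (Ideal.span {α}) = f α * sg (mixedEmbedding K (α : K)))
    (J : (Ideal (𝓞 K))⁰) (hJ : χ J ≠ 0) (s : ℝ)
    (hs : Summable fun α : (J : Ideal (𝓞 K)) =>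
      f α * coneFun W sg s (mixedEmbedding K ((α : 𝓞 K) : K))) :
    HasSum (fun I : {I : (Ideal (𝓞 K))⁰ // ClassGroup.mk0 I = (ClassGroup.mk0 J)⁻¹} =>
      torsionOrder K * (χ I.1 * (Ideal.absNorm (I.1 : Ideal (𝓞 K)) : ℝ) ^ (-s)))
      ((Ideal.absNorm (J : Ideal (𝓞 K)) : ℝ) ^ s * (χ J)⁻¹ *
        ∑' α : (J : Ideal (𝓞 K)),
          f α * coneFun W sg s (mixedEmbedding K ((α : 𝓞 K) : K))) := by
  rw [← tsum_mul_left]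
  refine hasSum_ideals_of_class hW0 hW J
    (fun I => χ I * (Ideal.absNorm (I : Ideal (𝓞 K)) : ℝ) ^ (-s))
    (fun α => (Ideal.absNorm (J : Ideal (𝓞 K)) : ℝ) ^ s * (χ J)⁻¹ *
      (f α * coneFun W sg s (mixedEmbedding K (α : K)))) ?_ ?_ (hs.mul_left _)
  · simp [coneFun_zero]
  · intro I α hI
    have hα : α ≠ 0 := by
      rintro rfl
      rw [Ideal.span_singleton_eq_bot.2 rfl] at hI
      exact mul_ne_zero (nonZeroDivisors.ne_zero I.2) (nonZeroDivisors.ne_zero J.2) hI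
    have hN : (0 : ℝ) < Ideal.absNorm (J : Ideal (𝓞 K)) := by
      exact_mod_cast Nat.pos_of_ne_zero (mt Ideal.absNorm_eq_zero_iff.1 (nonZeroDivisors.ne_zero J.2))
    have h1 := hχ α hα
    rw [← hI, map_mul] at h1
    rw [coneFun_mixedEmbedding s hα, ← hI, map_mul, Nat.cast_mul,
      Real.mul_rpow (Nat.cast_nonneg _) hN.le, Real.rpow_neg hN.le]
    have h2 : (Ideal.absNorm (J : Ideal (𝓞 K)) : ℝ) ^ s ≠ 0 := (Real.rpow_pos_of_pos hN s).ne'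
    have h3 : χ I = f α * sg (mixedEmbedding K (α : K)) * (χ J)⁻¹ := by
      rw [← h1, mul_inv_cancel_right₀ hJ]
    rw [h3]
    field_simp

variable (K) in
def idealLatticeEquiv (J : (Ideal (𝓞 K))⁰) :
    (J : Ideal (𝓞 K)) ≃ idealLattice K (FractionalIdeal.mk0 K J) :=
  Equiv.ofBijective (fun α => ⟨mixedEmbedding K ((α : 𝓞 K) : K),
    (mem_idealLattice K _).2 ⟨_, by
      rw [FractionalIdeal.coe_mk0]
      exact ⟨α, α.2, rfl⟩, rfl⟩⟩) (by
    constructor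
    · intro a b h
      exact Subtype.ext (RingOfIntegers.ext (mixedEmbedding_injective K (congrArg Subtype.val h)))
    · rintro ⟨x, hx⟩
      obtain ⟨y, hy, rfl⟩ := (mem_idealLattice K _).1 hx
      rw [FractionalIdeal.coe_mk0] at hy
      obtain ⟨α, hα, rfl⟩ := hy
      exact ⟨⟨α, hα⟩, rfl⟩)

theorem coe_idealLatticeEquiv (J : (Ideal (𝓞 K))⁰) (α : (J : Ideal (𝓞 K))) :
    (idealLatticeEquiv K J α : mixedSpace K) = mixedEmbedding K ((α : 𝓞 K) : K) := rfl

theorem tsum_eq_sum_class {g : Ideal (𝓞 K) → ℝ} (hg : Summable g) (h0 : g 0 = 0) :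
    ∑' I, g I = ∑ c : ClassGroup (𝓞 K),
      ∑' I : {I : (Ideal (𝓞 K))⁰ // ClassGroup.mk0 I = c}, g I.1 := by
  have hinj : Function.Injective (fun I : (Ideal (𝓞 K))⁰ => (I : Ideal (𝓞 K))) :=
    Subtype.val_injective
  have h1 : ∑' I, g I = ∑' I : (Ideal (𝓞 K))⁰, g I := by
    refine (hinj.tsum_eq fun I hI => ?_).symm
    refine ⟨⟨I, mem_nonZeroDivisors_of_ne_zero ?_⟩, rfl⟩
    rintro rfl
    exact hI h0
  have hs : Summable fun I : (Ideal (𝓞 K))⁰ => g I := hg.comp_injective hinj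
  let e := Equiv.sigmaFiberEquiv (fun I : (Ideal (𝓞 K))⁰ => ClassGroup.mk0 I)
  have h2 := ((e.summable_iff (f := fun I : (Ideal (𝓞 K))⁰ => g I)).2 hs).tsum_sigma
  rw [tsum_fintype (L := .unconditional (ClassGroup (𝓞 K)))] at h2
  rw [h1, ← e.tsum_eq]
  exact h2

variable (K) in
theorem exists_class_sum_approx :
    ∃ A : ℝ → ℝ, ∀ J : (Ideal (𝓞 K))⁰, ∃ C : ℝ, ∀ s : ℝ, 1 < s → s ≤ 2 →
      |(∑' I : {I : (Ideal (𝓞 K))⁰ // ClassGroup.mk0 I = (ClassGroup.mk0 J)⁻¹},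
        (Ideal.absNorm (I.1 : Ideal (𝓞 K)) : ℝ) ^ (-s)) -
        (Ideal.absNorm (J : Ideal (𝓞 K)) : ℝ) ^ (s - 1) * A s| ≤ C := by
  obtain ⟨W, B, ρ, hB, -, hWB, hWl, hsupp, hW⟩ := exists_lattice_partition (unitLattice K)
  have hWabs : ∀ v, |W v| ≤ B := fun v => by
    rw [abs_of_nonneg (hWB v).1]; exact (hWB v).2
  have hWm : Measurable W := by
    refine (LipschitzWith.of_dist_le_mul (K := B.toNNReal) fun x y => ?_).continuous.measurable
    rw [Real.dist_eq, dist_eq_norm, Real.coe_toNNReal _ hB]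
    exact hWl x y
  have hsg : ∀ x : mixedSpace K, |(fun _ => (1 : ℝ)) x| ≤ 1 := fun x => by simp
  set ω : ℝ := (torsionOrder K : ℝ) with hω
  have hω0 : 0 < ω := by
    rw [hω]; exact_mod_cast Nat.pos_of_ne_zero (torsionOrder_ne_zero K)
  set c₀ : ℝ := (2 : ℝ)⁻¹ ^ nrComplexPlaces K * √|discr K| with hc₀
  have hc₀0 : 0 < c₀ := by
    have : (discr K : ℝ) ≠ 0 := by exact_mod_cast discr_ne_zero K
    positivity
  refine ⟨fun s => (ω * c₀)⁻¹ * ∫ x, coneFun W (fun _ => 1) s x, fun J => ?_⟩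
  have hN : (0 : ℝ) < Ideal.absNorm (J : Ideal (𝓞 K)) := by
    exact_mod_cast Nat.pos_of_ne_zero (mt Ideal.absNorm_eq_zero_iff.1 (nonZeroDivisors.ne_zero J.2))
  set N : ℝ := (Ideal.absNorm (J : Ideal (𝓞 K)) : ℝ) with hNdef
  have hN1 : 1 ≤ N := by
    rw [hNdef] at hN ⊢
    exact_mod_cast (Nat.cast_pos.1 hN : 0 < Ideal.absNorm (J : Ideal (𝓞 K)))
  obtain ⟨R, D, hD, happ⟩ := exists_lattice_sum_approx (volume : Measure (mixedSpace K))
    (idealLattice K (FractionalIdeal.mk0 K J)) 0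
  obtain ⟨C, hC, hlip⟩ := exists_abs_coneFun_sub_le (sg := fun _ => 1) hB hWabs hWl hsupp hsg
    (fun _ _ _ => rfl) R
  refine ⟨N * (ω * c₀)⁻¹ * (C * D), fun s hs hs2 => ?_⟩
  obtain ⟨hsum, hbd⟩ := happ (coneFun W (fun _ => 1) s) C
    (integrable_coneFun hWm measurable_const hB hWabs hsg hsupp hs hs2) (hlip s hs.le hs2)
  simp only [zero_add] at hsum hbd
  rw [covolume_idealLattice, FractionalIdeal.coe_mk0, FractionalIdeal.coeIdeal_absNorm,
    Rat.cast_natCast, ← hNdef, mul_assoc N, ← hc₀] at hbd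
  rw [← (idealLatticeEquiv K J).summable_iff] at hsum
  rw [← (idealLatticeEquiv K J).tsum_eq] at hbd
  have h2 : oneChar K (J : Ideal (𝓞 K)) = 1 := if_neg (nonZeroDivisors.ne_zero J.2)
  have h1 := (hasSum_class_of_summable (sg := fun _ => 1) (fun v => (hWB v).1) hW (oneChar K)
    (fun _ => 1)
    (fun α hα => by
      simp [oneChar, hα]) J (by rw [h2]; exact one_ne_zero) s
    (by simpa only [one_mul] using! hsum)).tsum_eq
  simp only [oneChar_mul_rpow (by linarith : s ≠ 0), one_mul] at h1
  rw [tsum_mul_left, ← hω, ← hNdef] at h1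
  rw [h2, inv_one, mul_one] at h1
  simp only [coe_idealLatticeEquiv] at hbd
  set Z := ∑' I : {I : (Ideal (𝓞 K))⁰ // ClassGroup.mk0 I = (ClassGroup.mk0 J)⁻¹},
        (Ideal.absNorm (I.1 : Ideal (𝓞 K)) : ℝ) ^ (-s)
  set S := ∑' α : (J : Ideal (𝓞 K)), coneFun W (fun _ => 1) s (mixedEmbedding K ((α : 𝓞 K) : K))
  have h3 : Z - N ^ (s - 1) * ((ω * c₀)⁻¹ * ∫ x, coneFun W (fun _ => 1) s x) =
      N ^ (s - 1) * (ω * c₀)⁻¹ * (S * (N * c₀) - ∫ x, coneFun W (fun _ => 1) s x) := by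
    have h4 : Z = ω⁻¹ * (N ^ s * S) := by rw [← h1]; field_simp
    have h5 : N ^ s = N ^ (s - 1) * N := by
      rw [← Real.rpow_add_one hN.ne', sub_add_cancel]
    rw [h4, h5]
    field_simp
  rw [h3, abs_mul, abs_of_nonneg (by positivity : 0 ≤ N ^ (s - 1) * (ω * c₀)⁻¹)]
  gcongr
  calc N ^ (s - 1) ≤ N ^ (1 : ℝ) := Real.rpow_le_rpow_of_exponent_le hN1 (by linarith)
    _ = N := Real.rpow_one N

theorem rpow_sub_one_le {N t : ℝ} (hN : 1 ≤ N) (ht : 0 ≤ t) (ht1 : t ≤ 1) :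
    |N ^ t - 1| ≤ t * N := by
  have h1 : 1 ≤ N ^ t := Real.one_le_rpow hN ht
  have h2 := rpow_one_add_le_one_add_mul_self (s := N - 1) (by linarith) ht ht1
  rw [add_sub_cancel] at h2
  rw [abs_of_nonneg (by linarith)]
  nlinarith

theorem exists_tsum_le_of_class_char (χ : Ideal (𝓞 K) →*₀ ℝ) (hχ1 : ∀ I, |χ I| ≤ 1)
    (hχ : ∀ α : 𝓞 K, α ≠ 0 → χ (Ideal.span {α}) = 1)
    {I₁ : Ideal (𝓞 K)} (hI₁ : I₁ ≠ 0) (hχI₁ : χ I₁ ≠ 1) :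
    ∃ C : ℝ, ∀ s : ℝ, 1 < s → s ≤ 2 → ∑' I, χ I * (Ideal.absNorm I : ℝ) ^ (-s) ≤ C := by
  have hinv : ∀ I J : (Ideal (𝓞 K))⁰, ClassGroup.mk0 I = (ClassGroup.mk0 J)⁻¹ → χ I * χ J = 1 := by
    intro I J h
    obtain ⟨α, hα, h⟩ := ClassGroup.mk0_eq_mk0_inv_iff.1 h
    rw [← map_mul, h, hχ α hα]
  choose J hJ using fun c : ClassGroup (𝓞 K) => ClassGroup.mk0_surjective (R := 𝓞 K) c⁻¹
  let a : ClassGroup (𝓞 K) → ℝ := fun c => (χ (J c))⁻¹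
  have ha : ∀ I : (Ideal (𝓞 K))⁰, χ I = a (ClassGroup.mk0 I) := fun I =>
    eq_inv_of_mul_eq_one_left (hinv I _ (by rw [hJ, inv_inv]))
  have hamul : ∀ c c', a (c * c') = a c * a c' := by
    intro c c'
    obtain ⟨I, rfl⟩ := ClassGroup.mk0_surjective c
    obtain ⟨I', rfl⟩ := ClassGroup.mk0_surjective c'
    rw [← map_mul, ← ha, ← ha, ← ha]
    exact map_mul χ _ _
  have hsum : ∑ c, a c = 0 := by
    let c₁ := ClassGroup.mk0 ⟨I₁, mem_nonZeroDivisors_of_ne_zero hI₁⟩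
    have h1 : ∑ c, a c = a c₁ * ∑ c, a c := by
      rw [Finset.mul_sum, ← Equiv.sum_comp (Equiv.mulLeft c₁) a]
      exact Finset.sum_congr rfl fun c _ => hamul c₁ c
    have h2 : a c₁ ≠ 1 := by rw [← ha]; exact hχI₁
    have h3 : (a c₁ - 1) * ∑ c, a c = 0 := by linarith
    exact (mul_eq_zero.1 h3).resolve_left (sub_ne_zero.2 h2)
  have ha1 : ∀ c, |a c| ≤ 1 := by
    intro c
    obtain ⟨I, rfl⟩ := ClassGroup.mk0_surjective c
    rw [← ha]
    exact hχ1 _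
  obtain ⟨A, hA⟩ := exists_class_sum_approx K
  choose C hC using hA
  obtain ⟨_, C₁, -, -, hζ⟩ := exists_tsum_rpow_absNorm_bounds K
  have hN1 : ∀ J : (Ideal (𝓞 K))⁰, (1 : ℝ) ≤ Ideal.absNorm (J : Ideal (𝓞 K)) := fun J => by
    exact_mod_cast Nat.one_le_iff_ne_zero.2
      (mt Ideal.absNorm_eq_zero_iff.1 (nonZeroDivisors.ne_zero J.2))
  have hAbd : ∀ s, 1 < s → s ≤ 2 → |A s| ≤ C₁ / (s - 1) + C 1 := by
    intro s hs hs2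
    have h1 := abs_le.1 (hC 1 s hs hs2)
    have h2 := (hζ s hs hs2).2
    have hle : ∑' I : {I : (Ideal (𝓞 K))⁰ // ClassGroup.mk0 I = (ClassGroup.mk0 1)⁻¹},
        (Ideal.absNorm (I.1 : Ideal (𝓞 K)) : ℝ) ^ (-s) ≤
          ∑' I : Ideal (𝓞 K), (Ideal.absNorm I : ℝ) ^ (-s) := by
      refine tsum_comp_le_tsum_of_inj (summable_rpow_absNorm K hs)
        (fun I => Real.rpow_nonneg (Nat.cast_nonneg _) _)
        (i := fun I : {I : (Ideal (𝓞 K))⁰ // ClassGroup.mk0 I = (ClassGroup.mk0 1)⁻¹} =>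
          (I.1 : Ideal (𝓞 K))) (Subtype.val_injective.comp Subtype.val_injective)
    have h0 : 0 ≤ ∑' I : {I : (Ideal (𝓞 K))⁰ // ClassGroup.mk0 I = (ClassGroup.mk0 1)⁻¹},
        (Ideal.absNorm (I.1 : Ideal (𝓞 K)) : ℝ) ^ (-s) :=
      tsum_nonneg fun I => Real.rpow_nonneg (Nat.cast_nonneg _) _
    have h3 : (Ideal.absNorm ((1 : (Ideal (𝓞 K))⁰) : Ideal (𝓞 K)) : ℝ) ^ (s - 1) = 1 := by
      simp
    rw [h3, one_mul] at h1
    have h4 : 0 ≤ C₁ / (s - 1) := (h0.trans hle).trans h2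
    rw [abs_le]
    constructor <;> linarith [h1.1, h1.2]
  refine ⟨∑ c, (|C (J c)| + (Ideal.absNorm (J c : Ideal (𝓞 K)) : ℝ) * (C₁ + |C 1|)),
    fun s hs hs2 => ?_⟩
  have hcls : ∀ c, ∑' I : {I : (Ideal (𝓞 K))⁰ // ClassGroup.mk0 I = c},
      χ I.1 * (Ideal.absNorm (I.1 : Ideal (𝓞 K)) : ℝ) ^ (-s) =
      a c * ∑' I : {I : (Ideal (𝓞 K))⁰ // ClassGroup.mk0 I = c},
      (Ideal.absNorm (I.1 : Ideal (𝓞 K)) : ℝ) ^ (-s) := fun c => by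
    rw [← tsum_mul_left]
    refine tsum_congr fun I => ?_
    rw [ha, I.2]
  rw [tsum_eq_sum_class (summable_mul_rpow hχ1 hs) (by rw [map_zero, zero_mul])]
  simp only [hcls]
  have hd : ∀ c, |(∑' I : {I : (Ideal (𝓞 K))⁰ // ClassGroup.mk0 I = c},
      (Ideal.absNorm (I.1 : Ideal (𝓞 K)) : ℝ) ^ (-s)) - A s| ≤
      |C (J c)| + (Ideal.absNorm (J c : Ideal (𝓞 K)) : ℝ) * (C₁ + |C 1|) := by
    intro c
    have h1 := hC (J c) s hs hs2
    rw [hJ c, inv_inv] at h1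
    have h2 := rpow_sub_one_le (hN1 (J c)) (by linarith : 0 ≤ s - 1) (by linarith)
    have h3 := hAbd s hs hs2
    set N : ℝ := (Ideal.absNorm (J c : Ideal (𝓞 K)) : ℝ)
    have h4 : |(N ^ (s - 1) - 1) * A s| ≤ N * (C₁ + |C 1|) := by
      rw [abs_mul]
      calc |N ^ (s - 1) - 1| * |A s| ≤ ((s - 1) * N) * (C₁ / (s - 1) + |C 1|) := by
            gcongr
            exact h3.trans (by gcongr; exact le_abs_self _)
        _ = N * C₁ + (s - 1) * (N * |C 1|) := by
            field_simp [(by linarith : s - 1 ≠ 0)]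
        _ ≤ N * C₁ + 1 * (N * |C 1|) := by
            gcongr
            linarith
        _ = _ := by ring
    calc _ = |((∑' I : {I : (Ideal (𝓞 K))⁰ // ClassGroup.mk0 I = c},
      (Ideal.absNorm (I.1 : Ideal (𝓞 K)) : ℝ) ^ (-s)) - N ^ (s - 1) * A s) +
          (N ^ (s - 1) - 1) * A s| := by congr 1; ring
      _ ≤ _ := (abs_add_le _ _).trans (add_le_add (h1.trans (le_abs_self _)) h4)
  have heq : ∑ c, a c * (∑' I : {I : (Ideal (𝓞 K))⁰ // ClassGroup.mk0 I = c},
      (Ideal.absNorm (I.1 : Ideal (𝓞 K)) : ℝ) ^ (-s)) =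
      ∑ c, a c * ((∑' I : {I : (Ideal (𝓞 K))⁰ // ClassGroup.mk0 I = c},
      (Ideal.absNorm (I.1 : Ideal (𝓞 K)) : ℝ) ^ (-s)) - A s) := by
    simp only [mul_sub, Finset.sum_sub_distrib, ← Finset.sum_mul, hsum, zero_mul, sub_zero]
  rw [heq]
  refine Finset.sum_le_sum fun c _ => (le_abs_self _).trans ?_
  rw [abs_mul]
  exact (mul_le_mul (ha1 c) (hd c) (abs_nonneg _) zero_le_one).trans_eq (one_mul _)

def signProd (x : mixedSpace K) : ℝ := ∏ w : {w : InfinitePlace K // IsReal w}, Real.sign (x.1 w)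

theorem abs_sign_le_one (r : ℝ) : |Real.sign r| ≤ 1 := by
  rcases Real.sign_apply_eq r with h | h | h <;> simp [h]

theorem measurable_sign : Measurable Real.sign := by
  unfold Real.sign
  exact Measurable.ite measurableSet_Iio measurable_const
    (Measurable.ite measurableSet_Ioi measurable_const measurable_const)

theorem abs_signProd_le_one (x : mixedSpace K) : |signProd x| ≤ 1 := by
  rw [signProd, Finset.abs_prod]
  exact Finset.prod_le_one (fun _ _ => abs_nonneg _) fun _ _ => abs_sign_le_one _

theorem measurable_signProd : Measurable (signProd (K := K)) :=
  Finset.measurable_prod _ fun w _ =>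
    measurable_sign.comp ((measurable_pi_apply w).comp measurable_fst)

theorem sign_eq_sign_of_abs_sub_lt {a b : ℝ} (h : |a - b| < |a|) : Real.sign a = Real.sign b := by
  rcases lt_trichotomy a 0 with ha | rfl | ha
  · rw [abs_of_neg ha, abs_lt] at h
    rw [Real.sign_of_neg ha, Real.sign_of_neg (by linarith [h.1])]
  · rw [abs_zero] at h
    exact absurd h (abs_nonneg _).not_gt
  · rw [abs_of_pos ha, abs_lt] at h
    rw [Real.sign_of_pos ha, Real.sign_of_pos (by linarith [h.2])]

theorem signProd_eq_of_norm_sub_lt (x y : mixedSpace K)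
    (h : ∀ w, ‖x - y‖ < normAtPlace w x) : signProd x = signProd y := by
  refine Finset.prod_congr rfl fun w _ => sign_eq_sign_of_abs_sub_lt ?_
  have h1 := h w.1
  rw [normAtPlace_apply_of_isReal w.2, Real.norm_eq_abs] at h1
  refine lt_of_le_of_lt ?_ h1
  rw [← Real.norm_eq_abs]
  exact (norm_le_pi_norm (x - y).1 w).trans (norm_fst_le (x - y))

theorem signProd_negAt (w₀ : {w : InfinitePlace K // IsReal w}) (x : mixedSpace K) :
    signProd (negAt {w₀} x) = -signProd x := by
  rw [signProd, signProd, ← Finset.mul_prod_erase _ _ (Finset.mem_univ w₀),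
    ← Finset.mul_prod_erase Finset.univ (fun w => Real.sign (x.1 w)) (Finset.mem_univ w₀),
    negAt_apply_isReal_and_mem _ (Set.mem_singleton w₀), Real.sign_neg, neg_mul]
  congr 2
  refine Finset.prod_congr rfl fun w hw => ?_
  rw [negAt_apply_isReal_and_notMem]
  exact Finset.ne_of_mem_erase hw

theorem logMap_negAt (s : Set {w : InfinitePlace K // IsReal w}) (x : mixedSpace K) :
    logMap (negAt s x) = logMap x := by
  funext w
  simp [logMap_apply]

theorem integral_coneFun_signProd (w₀ : {w : InfinitePlace K // IsReal w}) (s : ℝ) :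
    ∫ x, coneFun W signProd s x = 0 := by
  have h1 : ∫ x, coneFun W signProd s (negAt {w₀} x) = ∫ x, coneFun W signProd s x :=
    volume_preserving_negAt.integral_comp
      (negAt {w₀}).toHomeomorph.toMeasurableEquiv.measurableEmbedding _
  have h2 : ∀ x : mixedSpace K, coneFun W signProd s (negAt {w₀} x) = -coneFun W signProd s x := by
    intro x
    unfold coneFun
    rw [norm_negAt, signProd_negAt, logMap_negAt]
    split_ifs <;> ring
  simp_rw [h2] at h1
  rw [integral_neg] at h1
  linarith

theorem exists_class_sum_le_of_sign_char (χ : Ideal (𝓞 K) →*₀ ℝ) {q : ℕ} (hq : q ≠ 0)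
    (f : 𝓞 K → ℝ) (hf : ∀ α β, f (α + q • β) = f α)
    (hχ : ∀ α : 𝓞 K, α ≠ 0 →
      χ (Ideal.span {α}) = f α * signProd (mixedEmbedding K (α : K)))
    (w₀ : {w : InfinitePlace K // IsReal w}) (J : (Ideal (𝓞 K))⁰) (hJ : χ J ≠ 0) :
    ∃ C : ℝ, ∀ s : ℝ, 1 < s → s ≤ 2 →
      ∑' I : {I : (Ideal (𝓞 K))⁰ // ClassGroup.mk0 I = (ClassGroup.mk0 J)⁻¹},
        χ I.1 * (Ideal.absNorm (I.1 : Ideal (𝓞 K)) : ℝ) ^ (-s) ≤ C := by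
  obtain ⟨W, B, ρ, hB, -, hWB, hWl, hsupp, hW⟩ := exists_lattice_partition (unitLattice K)
  have hWabs : ∀ v, |W v| ≤ B := fun v => by
    rw [abs_of_nonneg (hWB v).1]; exact (hWB v).2
  have hWm : Measurable W := by
    refine (LipschitzWith.of_dist_le_mul (K := B.toNNReal) fun x y => ?_).continuous.measurable
    rw [Real.dist_eq, dist_eq_norm, Real.coe_toNNReal _ hB]
    exact hWl x y
  set ω : ℝ := (torsionOrder K : ℝ) with hω
  have hω0 : 0 < ω := by
    rw [hω]; exact_mod_cast Nat.pos_of_ne_zero (torsionOrder_ne_zero K)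
  have hN1 : (1 : ℝ) ≤ Ideal.absNorm (J : Ideal (𝓞 K)) := by
    exact_mod_cast Nat.one_le_iff_ne_zero.2
      (mt Ideal.absNorm_eq_zero_iff.1 (nonZeroDivisors.ne_zero J.2))
  set e := idealLatticeEquiv K J
  obtain ⟨R, D, hD, happ⟩ := exists_periodic_lattice_sum_bound
    (L := idealLattice K (FractionalIdeal.mk0 K J)) (volume : Measure (mixedSpace K)) q hq
    (fun x => f (e.symm x)) (fun x y => by
      obtain ⟨a, rfl⟩ := e.surjective x
      obtain ⟨b, rfl⟩ := e.surjective y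
      have : e a + q • e b = e (a + q • b) := by
        refine Subtype.ext ?_
        change mixedEmbedding K ((a : 𝓞 K) : K) + q • mixedEmbedding K ((b : 𝓞 K) : K) =
          mixedEmbedding K (((a : 𝓞 K) + q • (b : 𝓞 K) : 𝓞 K) : K)
        rw [← map_nsmul, ← map_add]
        congr 1
      rw [this]
      simp only [Equiv.symm_apply_apply]
      exact hf a b)
  obtain ⟨C, hC, hlip⟩ := exists_abs_coneFun_sub_le (sg := signProd) hB hWabs hWl hsupp
    abs_signProd_le_one signProd_eq_of_norm_sub_lt R
  refine ⟨ω⁻¹ * ((Ideal.absNorm (J : Ideal (𝓞 K)) : ℝ) ^ (2 : ℝ) * |(χ J)⁻¹| * (C * D)),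
    fun s hs hs2 => ?_⟩
  obtain ⟨hsum, hbd⟩ := happ (coneFun W signProd s) C hC
    (integrable_coneFun hWm measurable_signProd hB hWabs abs_signProd_le_one hsupp hs hs2)
    (integral_coneFun_signProd w₀ s) (hlip s hs.le hs2)
  rw [← e.summable_iff] at hsum
  rw [← e.tsum_eq] at hbd
  simp only [Equiv.symm_apply_apply, e, coe_idealLatticeEquiv] at hbd
  have h1 := (hasSum_class_of_summable (sg := signProd) (fun v => (hWB v).1) hW χ f hχ J hJ s
    (by simpa only [Function.comp_def, e, Equiv.symm_apply_apply, coe_idealLatticeEquiv]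
      using hsum)).tsum_eq
  rw [tsum_mul_left, ← hω] at h1
  have h2 := congrArg (fun x => ω⁻¹ * x) h1
  simp only [inv_mul_cancel_left₀ hω0.ne'] at h2
  rw [h2]
  refine (le_abs_self _).trans ?_
  rw [abs_mul, abs_mul, abs_mul, abs_of_pos (inv_pos.2 hω0),
    abs_of_nonneg (Real.rpow_nonneg (by linarith : (0 : ℝ) ≤ _) s)]
  gcongr

theorem exists_tsum_le_of_sign_char (χ : Ideal (𝓞 K) →*₀ ℝ) (hχ1 : ∀ I, |χ I| ≤ 1)
    {q : ℕ} (hq : q ≠ 0)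
    (f : 𝓞 K → ℝ) (hf : ∀ α β, f (α + q • β) = f α)
    (hχ : ∀ α : 𝓞 K, α ≠ 0 →
      χ (Ideal.span {α}) = f α * signProd (mixedEmbedding K (α : K)))
    (w₀ : {w : InfinitePlace K // IsReal w}) :
    ∃ C : ℝ, ∀ s : ℝ, 1 < s → s ≤ 2 → ∑' I, χ I * (Ideal.absNorm I : ℝ) ^ (-s) ≤ C := by
  have h1 : ∀ c : ClassGroup (𝓞 K), ∃ C : ℝ, ∀ s : ℝ, 1 < s → s ≤ 2 →
      ∑' I : {I : (Ideal (𝓞 K))⁰ // ClassGroup.mk0 I = c},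
        χ I.1 * (Ideal.absNorm (I.1 : Ideal (𝓞 K)) : ℝ) ^ (-s) ≤ C := by
    intro c
    by_cases h : ∃ I : (Ideal (𝓞 K))⁰, ClassGroup.mk0 I = c ∧ χ I ≠ 0
    · obtain ⟨I, hI, hχI⟩ := h
      have hc : (ClassGroup.mk0 (I ^ (Fintype.card (ClassGroup (𝓞 K)) - 1)))⁻¹ = c := by
        rw [map_pow, hI, inv_eq_iff_eq_inv, ← mul_eq_one_iff_eq_inv, ← pow_succ,
          Nat.sub_add_cancel Fintype.card_pos, pow_card_eq_one]
      have h2 := exists_class_sum_le_of_sign_char χ hq f hf hχ w₀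
        (I ^ (Fintype.card (ClassGroup (𝓞 K)) - 1)) (by
          rw [SubmonoidClass.coe_pow, map_pow]; exact pow_ne_zero _ hχI)
      rwa [hc] at h2
    · push Not at h
      refine ⟨0, fun s _ _ => le_of_eq ?_⟩
      rw [← tsum_zero (L := .unconditional _)]
      exact tsum_congr fun I => by rw [h I.1 I.2, zero_mul]
  choose C hC using h1
  refine ⟨∑ c, C c, fun s hs hs2 => ?_⟩
  rw [tsum_eq_sum_class (summable_mul_rpow hχ1 hs) (by rw [map_zero, zero_mul])]
  exact Finset.sum_le_sum fun c _ => hC c s hs hs2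

end Bounded

section Relative

open scoped Classical
open Module NumberField IsDedekindDomain

variable {F K : Type*} [Field F] [NumberField F] [Field K] [NumberField K] [Algebra F K]

theorem summable_comp_and_tsum_le {α β : Type*} (π : α → β) {n : ℕ}
    (hπ : ∀ b, ∀ t : Finset α, (∀ a ∈ t, π a = b) → t.card ≤ n) {φ : β → ℝ} (hφ : ∀ b, 0 ≤ φ b)
    (hs : Summable φ) : Summable (fun a => φ (π a)) ∧ ∑' a, φ (π a) ≤ n * ∑' b, φ b := by
  have hbd : ∀ t : Finset α, ∑ a ∈ t, φ (π a) ≤ n * ∑' b, φ b := by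
    intro t
    rw [← Finset.sum_fiberwise_of_maps_to (t := t.image π) (g := π)
      (fun a ha => Finset.mem_image_of_mem π ha)]
    calc ∑ b ∈ t.image π, ∑ a ∈ t with π a = b, φ (π a)
        ≤ ∑ b ∈ t.image π, n * φ b := by
          refine Finset.sum_le_sum fun b _ => ?_
          rw [Finset.sum_congr rfl (g := fun _ => φ b) fun a ha => by
            rw [(Finset.mem_filter.1 ha).2], Finset.sum_const, nsmul_eq_mul]
          exact mul_le_mul_of_nonneg_right
            (by exact_mod_cast hπ b _ fun a ha => (Finset.mem_filter.1 ha).2) (hφ b)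
      _ = n * ∑ b ∈ t.image π, φ b := by rw [Finset.mul_sum]
      _ ≤ _ := by
          gcongr
          exact hs.sum_le_tsum _ fun b _ => hφ b
  have h1 := summable_of_sum_le (fun a => hφ (π a)) hbd
  exact ⟨h1, h1.tsum_le_of_sum_le hbd⟩

variable (F) in
def primeBelow (P : HeightOneSpectrum (𝓞 K)) : HeightOneSpectrum (𝓞 F) where
  asIdeal := P.asIdeal.under (𝓞 F)
  isPrime := P.isPrime.under (𝓞 F)
  ne_bot := Ideal.under_ne_bot (𝓞 F) P.ne_bot

instance liesOver_primeBelow (P : HeightOneSpectrum (𝓞 K)) :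
    P.asIdeal.LiesOver (primeBelow F P).asIdeal := ⟨rfl⟩

omit [NumberField F] [NumberField K] in
theorem mem_primeBelow {P : HeightOneSpectrum (𝓞 K)} {a : 𝓞 F} :
    a ∈ (primeBelow F P).asIdeal ↔ algebraMap (𝓞 F) (𝓞 K) a ∈ P.asIdeal := Iff.rfl

variable (F) in
theorem relNorm_prime (P : HeightOneSpectrum (𝓞 K)) :
    Ideal.relNorm (𝓞 F) P.asIdeal = (primeBelow F P).asIdeal ^ P.asIdeal.inertiaDeg (𝓞 F) := by
  have := P.isMaximal
  have := (primeBelow F P).isMaximal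
  exact Ideal.relNorm_eq_pow_of_isMaximal _ _

variable (F) in
theorem absNorm_prime (P : HeightOneSpectrum (𝓞 K)) :
    Ideal.absNorm P.asIdeal =
      Ideal.absNorm (primeBelow F P).asIdeal ^ P.asIdeal.inertiaDeg (𝓞 F) := by
  rw [← Ideal.absNorm_relNorm (𝓞 F) (𝓞 K), relNorm_prime, map_pow]

variable (F) in
theorem inertiaDeg_prime_pos (P : HeightOneSpectrum (𝓞 K)) : 0 < P.asIdeal.inertiaDeg (𝓞 F) :=
  have := P.isPrime
  Ideal.inertiaDeg_pos _ _

theorem card_le_of_primeBelow_eq (v : HeightOneSpectrum (𝓞 F))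
    (t : Finset (HeightOneSpectrum (𝓞 K))) (ht : ∀ P ∈ t, primeBelow F P = v) :
    ∑ P ∈ t, P.asIdeal.inertiaDeg (𝓞 F) ≤ finrank F K := by
  have h1 : ∏ P ∈ t, P.asIdeal ∣ v.asIdeal.map (algebraMap (𝓞 F) (𝓞 K)) := by
    refine Finset.prod_dvd_of_coprime ?_ ?_
    · intro P _ Q _ hPQ
      have := P.isMaximal
      have := Q.isMaximal
      exact Ideal.isCoprime_of_isMaximal fun h => hPQ (HeightOneSpectrum.ext h)
    · intro P hP
      rw [Ideal.dvd_iff_le, Ideal.map_le_iff_le_comap, ← ht P hP]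
      exact le_rfl
  have h2 := map_dvd (Ideal.relNorm (𝓞 F)) h1
  rw [Ideal.relNorm_algebraMap, map_prod] at h2
  have h3 : ∏ P ∈ t, Ideal.relNorm (𝓞 F) P.asIdeal =
      v.asIdeal ^ ∑ P ∈ t, P.asIdeal.inertiaDeg (𝓞 F) := by
    rw [← Finset.prod_pow_eq_pow_sum]
    exact Finset.prod_congr rfl fun P hP => by rw [relNorm_prime, ht P hP]
  rw [h3] at h2
  have h4 := (pow_dvd_pow_iff v.ne_bot (fun h => v.isPrime.ne_top (Ideal.isUnit_iff.1 h))).1 h2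
  exact h4.trans_eq (IsFractionRing.finrank_eq (𝓞 F) F (𝓞 K) K).symm

theorem inertiaDeg_prime_le (P : HeightOneSpectrum (𝓞 K)) :
    P.asIdeal.inertiaDeg (𝓞 F) ≤ finrank F K := by
  simpa using card_le_of_primeBelow_eq (primeBelow F P) {P} (by simp)

theorem card_primes_above_le (v : HeightOneSpectrum (𝓞 F))
    (t : Finset (HeightOneSpectrum (𝓞 K))) (ht : ∀ P ∈ t, primeBelow F P = v) :
    t.card ≤ finrank F K := by
  refine le_trans ?_ (card_le_of_primeBelow_eq v t ht)
  rw [Finset.card_eq_sum_ones]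
  exact Finset.sum_le_sum fun P _ => inertiaDeg_prime_pos F P

theorem exists_sub_mem_of_inertiaDeg_eq_one (P : HeightOneSpectrum (𝓞 K))
    (h : P.asIdeal.inertiaDeg (𝓞 F) = 1) (x : 𝓞 K) :
    ∃ a : 𝓞 F, x - algebraMap (𝓞 F) (𝓞 K) a ∈ P.asIdeal := by
  have hN := absNorm_prime F P
  rw [h, pow_one] at hN
  have hinj : Function.Injective (algebraMap (𝓞 F ⧸ (primeBelow F P).asIdeal) (𝓞 K ⧸ P.asIdeal)) :=
    have := (primeBelow F P).isMaximal
    have := P.isPrime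
    FaithfulSMul.algebraMap_injective _ _
  have : Finite (𝓞 K ⧸ P.asIdeal) := Ideal.finiteQuotientOfFreeOfNeBot _ P.ne_bot
  have hbij := hinj.bijective_of_nat_card_le (le_of_eq hN)
  obtain ⟨y, hy⟩ := hbij.2 (Ideal.Quotient.mk _ x)
  obtain ⟨a, rfl⟩ := Ideal.Quotient.mk_surjective y
  exact ⟨a, (Ideal.Quotient.mk_eq_mk_iff_sub_mem _ _).1 hy.symm⟩

end Relative

section SqrtExt

open scoped Classical
open Module NumberField NumberField.InfinitePlace IsDedekindDomain Polynomial

universe u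

theorem exists_sqrt_extension {F : Type u} [Field F] [NumberField F] (e : F) :
    ∃ (K : Type u) (_ : Field K) (_ : NumberField K) (_ : Algebra F K) (θ : K),
      θ ^ 2 = algebraMap F K e ∧ finrank F K ≤ 2 ∧
      ∀ φ ψ : K →+* ℂ, φ.comp (algebraMap F K) = ψ.comp (algebraMap F K) → φ θ = ψ θ → φ = ψ := by
  set p : F[X] := X ^ 2 - C e with hp
  have hdeg : p.natDegree = 2 := natDegree_X_pow_sub_C
  have hp0 : p ≠ 0 := fun h => by simp [h] at hdeg
  have hunit : ¬ IsUnit p := fun h => by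
    have := natDegree_eq_zero_of_isUnit h
    omega
  have : Fact (Irreducible (factor p)) := ⟨irreducible_factor p⟩
  have hdvd : factor p ∣ p := factor_dvd_of_not_isUnit hunit
  have hf0 : factor p ≠ 0 := (irreducible_factor p).ne_zero
  have : FiniteDimensional F (AdjoinRoot (factor p)) := (AdjoinRoot.powerBasis hf0).finite
  have : CharZero (AdjoinRoot (factor p)) :=
    charZero_of_injective_algebraMap (algebraMap F (AdjoinRoot (factor p))).injective
  have : NumberField (AdjoinRoot (factor p)) :=
    { to_charZero := inferInstance
      to_finiteDimensional := FiniteDimensional.trans ℚ F (AdjoinRoot (factor p)) }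
  refine ⟨AdjoinRoot (factor p), inferInstance, this, inferInstance,
    AdjoinRoot.root (factor p), ?_, ?_, ?_⟩
  · have h1 : aeval (AdjoinRoot.root (factor p)) p = 0 := by
      rw [AdjoinRoot.aeval_eq]
      exact AdjoinRoot.mk_eq_zero.2 hdvd
    have h2 : aeval (AdjoinRoot.root (factor p)) p =
      AdjoinRoot.root (factor p) ^ 2 - algebraMap F (AdjoinRoot (factor p)) e := by
      conv_lhs => arg 2; rw [hp]
      simp
    exact sub_eq_zero.1 (h2.symm.trans h1)
  · rw [(AdjoinRoot.powerBasis hf0).finrank, AdjoinRoot.powerBasis_dim, ← hdeg]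
    exact natDegree_le_of_dvd hdvd hp0
  · intro φ ψ h1 h2
    exact AdjoinRoot.ringHom_ext h1 h2

variable {K : Type*} [Field K] [NumberField K]

theorem Real.sign_mul_eq (x y : ℝ) : Real.sign (x * y) = Real.sign x * Real.sign y := by
  rcases lt_trichotomy x 0 with hx | rfl | hx <;> rcases lt_trichotomy y 0 with hy | rfl | hy <;>
    simp [Real.sign_of_neg, Real.sign_of_pos, mul_pos_of_neg_of_neg, mul_neg_of_neg_of_pos,
      mul_neg_of_pos_of_neg, *]

theorem Real.sign_prod {ι : Type*} (s : Finset ι) (f : ι → ℝ) :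
    Real.sign (∏ i ∈ s, f i) = ∏ i ∈ s, Real.sign (f i) := by
  induction s using Finset.induction_on with
  | empty => simp
  | insert a s ha ih => rw [Finset.prod_insert ha, Finset.prod_insert ha, ← ih, Real.sign_mul_eq]

theorem signProd_mixedEmbedding (hK : ∀ φ : K →+* ℂ, ComplexEmbedding.IsReal φ) (x : K) :
    signProd (mixedEmbedding K x) = Real.sign ((Algebra.norm ℚ x : ℚ) : ℝ) := by
  have hbij : Function.Bijective
      (fun w : {w : InfinitePlace K // IsReal w} => (RingHom.equivRatAlgHom K ℂ w.1.embedding : K →ₐ[ℚ] ℂ)) := by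
    refine ⟨fun w w' h => ?_, fun φ => ?_⟩
    · have h1 := (RingHom.equivRatAlgHom K ℂ).injective h
      ext1
      rw [← mk_embedding w.1, ← mk_embedding w'.1, h1]
    · refine ⟨⟨mk φ.toRingHom, isReal_iff.2 ?_⟩, ?_⟩
      · exact (hK _)
      · apply (RingHom.equivRatAlgHom K ℂ).symm.injective
        simp [embedding_mk_eq_of_isReal (hK _)]
  have h1 := Algebra.norm_eq_prod_embeddings ℚ ℂ x
  have h2 : ((Algebra.norm ℚ x : ℚ) : ℝ) =
      ∏ w : {w : InfinitePlace K // IsReal w}, (mixedEmbedding K x).1 w := by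
    apply Complex.ofReal_injective
    rw [Complex.ofReal_prod, Complex.ofReal_ratCast]
    refine h1.trans ?_
    rw [← (Equiv.ofBijective _ hbij).prod_comp]
    refine Finset.prod_congr rfl fun w _ => ?_
    rw [mixedEmbedding.mixedEmbedding_apply_isReal, embedding_of_isReal_apply]
    rfl
  rw [h2, Real.sign_prod]
  rfl

def chiFour : ℕ →*₀ ℝ where
  toFun n := ((ZMod.χ₄ (n : ZMod 4) : ℤ) : ℝ)
  map_zero' := by simp [ZMod.χ₄]
  map_one' := by simp
  map_mul' a b := by rw [Nat.cast_mul, map_mul, Int.cast_mul]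

theorem chiFour_natAbs (n : ℤ) :
    chiFour n.natAbs = ((ZMod.χ₄ (n : ZMod 4) : ℤ) : ℝ) * Real.sign (n : ℝ) := by
  rcases lt_trichotomy n 0 with h | rfl | h
  · obtain ⟨m, rfl⟩ : ∃ m : ℕ, n = -m := ⟨n.natAbs, by omega⟩
    rw [Real.sign_of_neg (by exact_mod_cast h)]
    change ((ZMod.χ₄ (((-(m : ℤ)).natAbs : ℕ) : ZMod 4) : ℤ) : ℝ) = _
    rw [Int.natAbs_neg, Int.natAbs_natCast]
    push_cast
    rw [neg_eq_neg_one_mul, map_mul, show ZMod.χ₄ (-1) = -1 by decide]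
    push_cast
    ring
  · simp [chiFour]
  · obtain ⟨m, rfl⟩ : ∃ m : ℕ, n = m := ⟨n.natAbs, by omega⟩
    rw [Real.sign_of_pos (by exact_mod_cast h), mul_one, Int.natAbs_natCast]
    simp [chiFour]

theorem abs_chiFour_le (n : ℕ) : |chiFour n| ≤ 1 := by
  have : ∀ a : ZMod 4, |ZMod.χ₄ a| ≤ 1 := by decide
  change |((ZMod.χ₄ (n : ZMod 4) : ℤ) : ℝ)| ≤ 1
  exact_mod_cast this n

theorem norm_cast_zmod_add_smul (n : ℕ) (α β : 𝓞 K) :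
    ((Algebra.norm ℤ (α + n • β) : ℤ) : ZMod n) = ((Algebra.norm ℤ α : ℤ) : ZMod n) := by
  have hcast : ∀ m : ℤ, (m : ZMod n) = Int.castRingHom (ZMod n) m := fun m => rfl
  rw [Algebra.norm_eq_matrix_det (RingOfIntegers.basis K),
    Algebra.norm_eq_matrix_det (RingOfIntegers.basis K), hcast, hcast, RingHom.map_det,
    RingHom.map_det]
  congr 1
  rw [map_add, map_add, map_nsmul, map_nsmul, add_eq_left]
  ext i j
  simp [Matrix.smul_apply]

end SqrtExt

section SplitSum

open scoped Classical
open Module NumberField NumberField.InfinitePlace IsDedekindDomain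

universe u

variable {F : Type u} [Field F] [NumberField F]

/-- `-d` is a square modulo `v`. -/
def NegIsSquareMod (d : 𝓞 F) (v : HeightOneSpectrum (𝓞 F)) : Prop :=
  ∃ a : 𝓞 F, a ^ 2 + d ∈ v.asIdeal

theorem rpow_absNorm_le_one (v : HeightOneSpectrum (𝓞 F)) {s : ℝ} (hs : 0 ≤ s) :
    (Ideal.absNorm v.asIdeal : ℝ) ^ (-s) ≤ 1 :=
  Real.rpow_le_one_of_one_le_of_nonpos
    (by exact_mod_cast (one_le_two.trans (two_le_absNorm v))) (by linarith)

theorem summable_prime_ite (p : HeightOneSpectrum (𝓞 F) → Prop) [DecidablePred p] {s : ℝ} (hs : 1 < s) :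
    Summable fun v : HeightOneSpectrum (𝓞 F) =>
      if p v then (Ideal.absNorm v.asIdeal : ℝ) ^ (-s) else 0 := by
  refine (summable_prime hs).of_nonneg_of_le (fun v => ?_) fun v => ?_ <;> split_ifs
  · positivity
  · exact le_rfl
  · exact le_rfl
  · positivity

omit [NumberField F] in
theorem exists_integer_sqrt {K : Type*} [Field K] [Algebra F K] {θ : K} {e : 𝓞 F}
    (hθ : θ ^ 2 = algebraMap F K (e : F)) : ∃ t : 𝓞 K, t ^ 2 = algebraMap (𝓞 F) (𝓞 K) e := by
  have h1 : IsIntegral ℤ θ := by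
    refine IsIntegral.of_pow two_pos ?_
    rw [hθ]
    exact (RingOfIntegers.isIntegral_coe e).algebraMap (B := K)
  exact ⟨⟨θ, h1⟩, RingOfIntegers.ext hθ⟩

theorem exists_sq_sub_mem {K : Type*} [Field K] [NumberField K] [Algebra F K] {t : 𝓞 K} {e : 𝓞 F}
    (ht : t ^ 2 = algebraMap (𝓞 F) (𝓞 K) e) (P : HeightOneSpectrum (𝓞 K))
    (hP : P.asIdeal.inertiaDeg (𝓞 F) = 1) : ∃ a : 𝓞 F, a ^ 2 - e ∈ (primeBelow F P).asIdeal := by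
  obtain ⟨a, ha⟩ := exists_sub_mem_of_inertiaDeg_eq_one P hP t
  refine ⟨a, ?_⟩
  rw [mem_primeBelow, map_sub, map_pow, ← ht]
  have := P.asIdeal.mul_mem_left (-(t + algebraMap (𝓞 F) (𝓞 K) a)) ha
  convert this using 1
  ring

theorem exists_split_sum_lower (d : 𝓞 F) :
    ∃ C : ℝ, ∀ s : ℝ, 1 < s → s ≤ 2 →
      1 / 2 * Real.log (1 / (s - 1)) - C ≤
        ∑' v : HeightOneSpectrum (𝓞 F),
          if NegIsSquareMod d v then (Ideal.absNorm v.asIdeal : ℝ) ^ (-s) else 0 := by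
  obtain ⟨K, _, _, _, θ, hθ, hfin, -⟩ := exists_sqrt_extension (-(d : F))
  obtain ⟨t, ht⟩ := exists_integer_sqrt (e := -d) (K := K) (θ := θ) (by rw [hθ]; simp)
  obtain ⟨C, hC⟩ := exists_prime_sum_lower K
  refine ⟨C / 2 + ∑' v : HeightOneSpectrum (𝓞 F), (Ideal.absNorm v.asIdeal : ℝ) ^ (-2 : ℝ),
    fun s hs hs2 => ?_⟩
  set φ : HeightOneSpectrum (𝓞 F) → ℝ := fun v =>
    (if NegIsSquareMod d v then (Ideal.absNorm v.asIdeal : ℝ) ^ (-s) else 0) +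
      (Ideal.absNorm v.asIdeal : ℝ) ^ (-2 : ℝ) with hφ
  have hsum1 := summable_prime_ite (fun v => NegIsSquareMod d v) hs
  have hsum2 := summable_prime (K := F) (s := 2) one_lt_two
  have hle : ∀ P : HeightOneSpectrum (𝓞 K),
      (Ideal.absNorm P.asIdeal : ℝ) ^ (-s) ≤ φ (primeBelow F P) := by
    intro P
    have h2 : (1 : ℝ) ≤ (Ideal.absNorm (primeBelow F P).asIdeal : ℝ) := by
      exact_mod_cast (one_le_two.trans (two_le_absNorm _))
    rw [absNorm_prime F P]
    by_cases h : P.asIdeal.inertiaDeg (𝓞 F) = 1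
    · obtain ⟨a, ha⟩ := exists_sq_sub_mem ht P h
      have hS : NegIsSquareMod d (primeBelow F P) := ⟨a, by simpa using ha⟩
      simp only [hφ, h, pow_one, if_pos hS]
      exact le_add_of_nonneg_right (by positivity)
    · have h3 := inertiaDeg_prime_pos F P
      have h4 : (2 : ℝ) ≤ P.asIdeal.inertiaDeg (𝓞 F) := by
        exact_mod_cast (show 2 ≤ P.asIdeal.inertiaDeg (𝓞 F) by omega)
      push_cast
      rw [← Real.rpow_natCast, ← Real.rpow_mul (by linarith)]
      refine (Real.rpow_le_rpow_of_exponent_le h2 (z := -2) (by nlinarith)).trans ?_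
      simp only [hφ]
      refine le_add_of_nonneg_left ?_
      split_ifs <;> positivity
  obtain ⟨hs3, hle3⟩ := summable_comp_and_tsum_le (primeBelow F) (n := 2)
    (fun v t ht => (card_primes_above_le (K := K) v t ht).trans hfin) (φ := φ)
    (fun v => by simp only [hφ]; split_ifs <;> positivity) (hsum1.add hsum2)
  have h5 := (summable_prime hs).tsum_le_tsum hle hs3
  have h6 : ∑' v, φ v = _ := hsum1.tsum_add hsum2
  have h7 := hC s hs hs2
  push_cast at hle3
  linarith

end SplitSum

section AIdeal

open scoped Classical
open Module NumberField NumberField.InfinitePlace IsDedekindDomain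

universe u

variable {F : Type u} [Field F] [NumberField F]

omit [NumberField F] in
theorem abs_le_one_of_sq_eq_one {ψ : Ideal (𝓞 F) →*₀ ℝ} (hψ : ∀ I, I ≠ 0 → ψ I ^ 2 = 1)
    (I : Ideal (𝓞 F)) : |ψ I| ≤ 1 := by
  by_cases h : I = 0
  · rw [h, map_zero, abs_zero]
    exact zero_le_one
  · exact (sq_le_one_iff_abs_le_one _).1 (hψ I h).le

/-- The primes outside the splitting set at which a quadratic character is trivial have bounded
Dirichlet sum. -/
theorem exists_exceptional_sum_le {d : 𝓞 F} {ψ : Ideal (𝓞 F) →*₀ ℝ}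
    (hψ : ∀ I, I ≠ 0 → ψ I ^ 2 = 1) (hψ1 : ∀ α : 𝓞 F, α ≠ 0 → ψ (Ideal.span {α}) = 1)
    {B : Finset (HeightOneSpectrum (𝓞 F))}
    (hB : ∀ v ∉ B, NegIsSquareMod d v → ψ v.asIdeal = 1)
    {I₁ : Ideal (𝓞 F)} (hI₁ : I₁ ≠ 0) (hψI₁ : ψ I₁ ≠ 1) :
    ∃ C : ℝ, ∀ s : ℝ, 1 < s → s ≤ 2 →
      ∑' v : HeightOneSpectrum (𝓞 F),
        (if ψ v.asIdeal = 1 ∧ ¬ NegIsSquareMod d v then (Ideal.absNorm v.asIdeal : ℝ) ^ (-s)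
          else 0) ≤ C := by
  have hψb := abs_le_one_of_sq_eq_one hψ
  obtain ⟨C₀, h₀⟩ := exists_tsum_le_of_class_char ψ hψb hψ1 hI₁ hψI₁
  obtain ⟨C₁, h₁⟩ := exists_prime_sum_upper F
  obtain ⟨C₂, h₂⟩ := exists_split_sum_lower d
  refine ⟨(Real.log C₀ + C₁) / 2 + C₂ + B.card, fun s hs hs2 => ?_⟩
  have e0 := exists_prime_sum_le ψ hψb h₀ hs hs2
  have e1 := h₁ s hs hs2
  have e2 := h₂ s hs hs2
  have s0 := summable_prime_mul (χ := fun v : HeightOneSpectrum (𝓞 F) => ψ v.asIdeal)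
    (fun v => hψb _) hs
  have s1 := summable_prime (K := F) hs
  have s2 := summable_prime_ite (fun v => NegIsSquareMod d v) hs
  have s3 := summable_prime_ite (fun v => ψ v.asIdeal = 1 ∧ ¬ NegIsSquareMod d v) hs
  have s4 : Summable fun v => if v ∈ B then (1 : ℝ) else 0 :=
    summable_of_ne_finset_zero (s := B) fun v hv => if_neg hv
  have e4 : ∑' v, (if v ∈ B then (1 : ℝ) else 0) = B.card := by
    rw [tsum_eq_sum (s := B) fun v hv => if_neg hv]
    simp
  have key : ∀ v : HeightOneSpectrum (𝓞 F),
      (if ψ v.asIdeal = 1 ∧ ¬ NegIsSquareMod d v then (Ideal.absNorm v.asIdeal : ℝ) ^ (-s)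
          else 0) + (if NegIsSquareMod d v then (Ideal.absNorm v.asIdeal : ℝ) ^ (-s) else 0) ≤
      1 / 2 * (ψ v.asIdeal * (Ideal.absNorm v.asIdeal : ℝ) ^ (-s) +
        (Ideal.absNorm v.asIdeal : ℝ) ^ (-s)) + if v ∈ B then (1 : ℝ) else 0 := by
    intro v
    have h1 := rpow_absNorm_le_one v (s := s) (by linarith)
    have h2 : (0 : ℝ) ≤ (Ideal.absNorm v.asIdeal : ℝ) ^ (-s) := by positivity
    have h3 := abs_le.1 (hψb v.asIdeal)
    by_cases hp : ψ v.asIdeal = 1 <;> by_cases hS : NegIsSquareMod d v <;> by_cases hv : v ∈ B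
    all_goals simp only [hp, hS, hv, if_true, if_false, not_true, not_false_eq_true, and_true,
      and_false]
    all_goals first | nlinarith | exact absurd (hB v hv hS) hp
  have e5 := (s3.add s2).tsum_le_tsum key (((s0.add s1).mul_left _).add s4)
  rw [s3.tsum_add s2, ((s0.add s1).mul_left _).tsum_add s4, tsum_mul_left, s0.tsum_add s1, e4] at e5
  linarith

omit [NumberField F] in
theorem isReal_of_sqrt_extension (hF : ∀ φ : F →+* ℂ, ComplexEmbedding.IsReal φ) {d : F}
    (hd : ∀ σ : F →+* ℝ, 0 < σ d) {L : Type*} [Field L] [Algebra F L] {θ : L}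
    (hθ : θ ^ 2 = algebraMap F L d)
    (hext : ∀ φ ψ : L →+* ℂ, φ.comp (algebraMap F L) = ψ.comp (algebraMap F L) →
      φ θ = ψ θ → φ = ψ) (φ : L →+* ℂ) : ComplexEmbedding.IsReal φ := by
  refine hext _ _ (hF (φ.comp (algebraMap F L))) ?_
  have h1 := hd (hF (φ.comp (algebraMap F L))).embedding
  have h2 : φ θ ^ 2 = (((hF (φ.comp (algebraMap F L))).embedding d : ℝ) : ℂ) := by
    rw [ComplexEmbedding.IsReal.coe_embedding_apply, ← map_pow, hθ]
    rfl
  set r := (hF (φ.comp (algebraMap F L))).embedding d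
  have h3 : (φ θ - (Real.sqrt r : ℝ)) * (φ θ + (Real.sqrt r : ℝ)) = 0 := by
    have : ((Real.sqrt r : ℝ) : ℂ) ^ 2 = (r : ℂ) := by
      rw [← Complex.ofReal_pow, Real.sq_sqrt h1.le]
    linear_combination h2 - this
  rw [ComplexEmbedding.conjugate_coe_eq]
  rcases mul_eq_zero.1 h3 with h | h
  · rw [sub_eq_zero.1 h, Complex.conj_ofReal]
  · rw [eq_neg_of_add_eq_zero_left h, map_neg, Complex.conj_ofReal]

/-- The twist of `ψ ∘ N` by the character modulo `4`. -/
def twistedChar (L : Type*) [Field L] [NumberField L] [Algebra F L] (ψ : Ideal (𝓞 F) →*₀ ℝ) :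
    Ideal (𝓞 L) →*₀ ℝ :=
  (ψ.comp (Ideal.relNorm (𝓞 F))) * (chiFour.comp Ideal.absNorm)

theorem twistedChar_apply (L : Type*) [Field L] [NumberField L] [Algebra F L]
    (ψ : Ideal (𝓞 F) →*₀ ℝ) (I : Ideal (𝓞 L)) :
    twistedChar L ψ I = ψ (Ideal.relNorm (𝓞 F) I) * chiFour (Ideal.absNorm I) := rfl

theorem twistedChar_span {L : Type*} [Field L] [NumberField L] [Algebra F L]
    {ψ : Ideal (𝓞 F) →*₀ ℝ} (hψ1 : ∀ α : 𝓞 F, α ≠ 0 → ψ (Ideal.span {α}) = 1)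
    (hL : ∀ φ : L →+* ℂ, ComplexEmbedding.IsReal φ) {α : 𝓞 L} (hα : α ≠ 0) :
    twistedChar L ψ (Ideal.span {α}) =
      ((ZMod.χ₄ ((Algebra.norm ℤ α : ℤ) : ZMod 4) : ℤ) : ℝ) *
        signProd (mixedEmbedding L (α : L)) := by
  rw [twistedChar_apply, Ideal.relNorm_singleton, hψ1 _ (Algebra.intNorm_ne_zero.2 hα), one_mul,
    Ideal.absNorm_span_singleton, chiFour_natAbs, signProd_mixedEmbedding hL]
  congr 2
  rw [← Algebra.coe_norm_int]
  simp

theorem natCard_mod_four_of_negIsSquare (v : HeightOneSpectrum (𝓞 F)) :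
    (∃ c : 𝓞 F, c ^ 2 + 1 ∈ v.asIdeal) ↔ Ideal.absNorm v.asIdeal % 4 ≠ 3 := by
  have := v.isMaximal
  have : Finite (𝓞 F ⧸ v.asIdeal) := Ideal.finiteQuotientOfFreeOfNeBot _ v.ne_bot
  let := Fintype.ofFinite (𝓞 F ⧸ v.asIdeal)
  let := Ideal.Quotient.field v.asIdeal
  have h1 : Ideal.absNorm v.asIdeal = Fintype.card (𝓞 F ⧸ v.asIdeal) := by
    rw [Ideal.absNorm_apply, Submodule.cardQuot_apply, Nat.card_eq_fintype_card]
  rw [h1, ← FiniteField.isSquare_neg_one_iff]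
  constructor
  · rintro ⟨c, hc⟩
    refine ⟨Ideal.Quotient.mk _ c, ?_⟩
    have := Ideal.Quotient.eq_zero_iff_mem.2 hc
    rw [map_add, map_pow, map_one] at this
    linear_combination -this
  · rintro ⟨y, hy⟩
    obtain ⟨c, rfl⟩ := Ideal.Quotient.mk_surjective y
    refine ⟨c, Ideal.Quotient.eq_zero_iff_mem.1 ?_⟩
    rw [map_add, map_pow, map_one]
    linear_combination -hy

theorem odd_absNorm {v : HeightOneSpectrum (𝓞 F)} (h2 : (2 : 𝓞 F) ∉ v.asIdeal) :
    Ideal.absNorm v.asIdeal % 2 = 1 := by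
  have := v.isMaximal
  have : Finite (𝓞 F ⧸ v.asIdeal) := Ideal.finiteQuotientOfFreeOfNeBot _ v.ne_bot
  let := Fintype.ofFinite (𝓞 F ⧸ v.asIdeal)
  let := Ideal.Quotient.field v.asIdeal
  have h1 : Ideal.absNorm v.asIdeal = Fintype.card (𝓞 F ⧸ v.asIdeal) := by
    rw [Ideal.absNorm_apply, Submodule.cardQuot_apply, Nat.card_eq_fintype_card]
  rw [h1]
  refine FiniteField.odd_card_of_char_ne_two fun h => h2 ?_
  have h3 := ringChar.Nat.cast_ringChar (R := 𝓞 F ⧸ v.asIdeal)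
  rw [h] at h3
  exact Ideal.Quotient.eq_zero_iff_mem.1 (by rw [map_ofNat]; simpa using h3)

theorem twistedChar_eq_one {L : Type*} [Field L] [NumberField L] [Algebra F L]
    (hfin : finrank F L ≤ 2) {d : 𝓞 F} {t : 𝓞 L} (ht : t ^ 2 = algebraMap (𝓞 F) (𝓞 L) d)
    {ψ : Ideal (𝓞 F) →*₀ ℝ} (hψ : ∀ I, I ≠ 0 → ψ I ^ 2 = 1) (P : HeightOneSpectrum (𝓞 L))
    (h2 : (2 : 𝓞 F) ∉ (primeBelow F P).asIdeal) (hd : d ∉ (primeBelow F P).asIdeal)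
    (hS : NegIsSquareMod d (primeBelow F P) ↔ ψ (primeBelow F P).asIdeal = 1) :
    twistedChar L ψ P.asIdeal = 1 := by
  rw [twistedChar_apply, relNorm_prime, absNorm_prime F, map_pow, map_pow]
  have hodd := odd_absNorm h2
  have hsq := hψ _ (primeBelow F P).ne_bot
  have hχ : chiFour (Ideal.absNorm (primeBelow F P).asIdeal) =
      if Ideal.absNorm (primeBelow F P).asIdeal % 4 = 3 then -1 else 1 := by
    change ((ZMod.χ₄ _ : ℤ) : ℝ) = _
    split_ifs with h
    · rw [ZMod.χ₄_nat_three_mod_four h]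
      simp
    · rw [ZMod.χ₄_nat_one_mod_four (by omega)]
      simp
  have h0 := inertiaDeg_prime_pos F P
  have h1 := (inertiaDeg_prime_le (F := F) P).trans hfin
  obtain h | h : P.asIdeal.inertiaDeg (𝓞 F) = 2 ∨ P.asIdeal.inertiaDeg (𝓞 F) = 1 := by omega
  · rw [h, hsq, hχ]
    split_ifs <;> norm_num
  rw [h, pow_one, pow_one, hχ]
  obtain ⟨a, ha⟩ := exists_sq_sub_mem ht P h
  have hiff := natCard_mod_four_of_negIsSquare (primeBelow F P)
  set v := primeBelow F P
  have hprime := v.isPrime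
  split_ifs with h3
  · have hne : ψ v.asIdeal ≠ 1 := fun hp => by
      obtain ⟨b, hb⟩ := hS.2 hp
      refine hiff.1 ?_ h3
      have ha0 : a ∉ v.asIdeal := fun h => hd (by
        have := v.asIdeal.sub_mem (v.asIdeal.mul_mem_left a h) ha
        convert this using 1
        ring)
      obtain ⟨y, c, hc, hy⟩ := v.isMaximal.exists_inv ha0
      refine ⟨b * y, ?_⟩
      have e : y * a + c = 1 := hy
      have := v.asIdeal.add_mem (v.asIdeal.mul_mem_left (y ^ 2) (v.asIdeal.add_mem ha hb))
        (v.asIdeal.mul_mem_left (1 + y * a) hc)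
      convert this using 1
      linear_combination (-(1 + y * a)) * e
    have : ψ v.asIdeal = -1 := by
      rcases sq_eq_one_iff.1 hsq with h | h
      · exact absurd h hne
      · exact h
    rw [this]
    norm_num
  · obtain ⟨c, hc⟩ := hiff.2 h3
    rw [hS.1 ⟨c * a, ?_⟩]
    · norm_num
    have := v.asIdeal.sub_mem (v.asIdeal.mul_mem_left (a ^ 2) hc) ha
    convert this using 1
    ring

theorem eq_one_of_negIsSquareMod (hF : ∀ φ : F →+* ℂ, ComplexEmbedding.IsReal φ) {d : 𝓞 F}
    (hd0 : d ≠ 0) (hd : ∀ σ : F →+* ℝ, 0 < σ d) {ψ : Ideal (𝓞 F) →*₀ ℝ}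
    (hψ : ∀ I, I ≠ 0 → ψ I ^ 2 = 1) (hψ1 : ∀ α : 𝓞 F, α ≠ 0 → ψ (Ideal.span {α}) = 1)
    (hS : ∀ v : HeightOneSpectrum (𝓞 F), (2 : 𝓞 F) ∉ v.asIdeal → d ∉ v.asIdeal →
      NegIsSquareMod d v → ψ v.asIdeal = 1) {I : Ideal (𝓞 F)} (hI : I ≠ 0) : ψ I = 1 := by
  by_contra hne
  have hBfin : {v : HeightOneSpectrum (𝓞 F) | v.asIdeal ∣ Ideal.span {2 * d}}.Finite :=
    Ideal.finite_factors (by simp [hd0])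
  set B := hBfin.toFinset with hBdef
  have hB : ∀ v ∉ B, (2 : 𝓞 F) ∉ v.asIdeal ∧ d ∉ v.asIdeal := by
    intro v hv
    rw [hBdef, Set.Finite.mem_toFinset, Set.mem_ofPred_eq, Ideal.dvd_span_singleton] at hv
    exact ⟨fun h => hv (v.asIdeal.mul_mem_right _ h), fun h => hv (v.asIdeal.mul_mem_left _ h)⟩
  obtain ⟨C₁, h₁⟩ := exists_exceptional_sum_le hψ hψ1 (B := B)
    (fun v hv => hS v (hB v hv).1 (hB v hv).2) hI hne
  obtain ⟨L, _, _, _, θ, hθ, hfin, hext⟩ := exists_sqrt_extension (d : F)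
  have hL := isReal_of_sqrt_extension hF hd hθ hext
  obtain ⟨t, ht⟩ := exists_integer_sqrt hθ
  set Λ := twistedChar L ψ with hΛ
  have hΛb : ∀ J, |Λ J| ≤ 1 := fun J => by
    rw [hΛ, twistedChar_apply, abs_mul]
    exact mul_le_one₀ (abs_le_one_of_sq_eq_one hψ _) (abs_nonneg _) (abs_chiFour_le _)
  obtain ⟨w₀⟩ : Nonempty (InfinitePlace L) := inferInstance
  obtain ⟨C₂, h₂⟩ := exists_tsum_le_of_sign_char Λ hΛb (q := 4) (by norm_num)
    (fun α => ((ZMod.χ₄ ((Algebra.norm ℤ α : ℤ) : ZMod 4) : ℤ) : ℝ))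
    (fun α β => by simp only [norm_cast_zmod_add_smul])
    (fun α hα => twistedChar_span hψ1 hL hα)
    ⟨w₀, isReal_iff.2 (hL _)⟩
  obtain ⟨C₃, h₃⟩ := exists_prime_sum_lower L
  have hbound : ∀ s : ℝ, 1 < s → s ≤ 2 →
      Real.log (1 / (s - 1)) ≤ C₃ + Real.log C₂ + 4 * (C₁ + B.card) := by
    intro s hs hs2
    have e1 := h₁ s hs hs2
    have e2 := exists_prime_sum_le Λ hΛb h₂ hs hs2
    have e3 := h₃ s hs hs2
    have s0 := summable_prime_mul (χ := fun v : HeightOneSpectrum (𝓞 L) => Λ v.asIdeal)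
      (fun v => hΛb _) hs
    have s1 := summable_prime (K := L) hs
    have s3 := summable_prime_ite (fun v => ψ v.asIdeal = 1 ∧ ¬ NegIsSquareMod d v) hs
    have s4 : Summable fun v => if v ∈ B then (1 : ℝ) else 0 :=
      summable_of_ne_finset_zero (s := B) fun v hv => if_neg hv
    have e4 : ∑' v, (if v ∈ B then (1 : ℝ) else 0) = B.card := by
      rw [tsum_eq_sum (s := B) fun v hv => if_neg hv]
      simp
    set φ : HeightOneSpectrum (𝓞 F) → ℝ := fun v => 2 *
      ((if ψ v.asIdeal = 1 ∧ ¬ NegIsSquareMod d v then (Ideal.absNorm v.asIdeal : ℝ) ^ (-s)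
          else 0) + if v ∈ B then (1 : ℝ) else 0) with hφ
    have hφ0 : ∀ v, 0 ≤ φ v := fun v => by simp only [hφ]; split_ifs <;> positivity
    obtain ⟨s5, e5⟩ := summable_comp_and_tsum_le (primeBelow F) (n := 2)
      (fun v t ht => (card_primes_above_le (K := L) v t ht).trans hfin) hφ0
      ((s3.add s4).mul_left 2)
    have key : ∀ P : HeightOneSpectrum (𝓞 L),
        (Ideal.absNorm P.asIdeal : ℝ) ^ (-s) ≤
          Λ P.asIdeal * (Ideal.absNorm P.asIdeal : ℝ) ^ (-s) + φ (primeBelow F P) := by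
      intro P
      have hP0 : (0 : ℝ) ≤ (Ideal.absNorm P.asIdeal : ℝ) ^ (-s) := by positivity
      have hP1 := rpow_absNorm_le_one P (s := s) (by linarith)
      have hΛP := abs_le.1 (hΛb P.asIdeal)
      by_cases hPB : primeBelow F P ∈ B
      · have : 2 ≤ φ (primeBelow F P) := by
          simp only [hφ, if_pos hPB]
          have : (0 : ℝ) ≤ if ψ (primeBelow F P).asIdeal = 1 ∧ ¬ NegIsSquareMod d (primeBelow F P)
            then (Ideal.absNorm (primeBelow F P).asIdeal : ℝ) ^ (-s) else 0 := by
            split_ifs <;> positivity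
          linarith
        nlinarith
      obtain ⟨hP2, hPd⟩ := hB _ hPB
      by_cases hPS : NegIsSquareMod d (primeBelow F P) ↔ ψ (primeBelow F P).asIdeal = 1
      · rw [hΛ, twistedChar_eq_one hfin ht hψ P hP2 hPd hPS, one_mul]
        linarith [hφ0 (primeBelow F P)]
      · have hPT : ψ (primeBelow F P).asIdeal = 1 ∧ ¬ NegIsSquareMod d (primeBelow F P) := by
          have := hS _ hP2 hPd
          tauto
        have h6 : (Ideal.absNorm P.asIdeal : ℝ) ^ (-s) ≤
            (Ideal.absNorm (primeBelow F P).asIdeal : ℝ) ^ (-s) := by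
          refine Real.rpow_le_rpow_of_nonpos ?_ ?_ (by linarith)
          · exact_mod_cast two_pos.trans_le (two_le_absNorm _)
          · rw [absNorm_prime F P]
            exact_mod_cast Nat.le_self_pow (inertiaDeg_prime_pos F P).ne' _
        have h7 : φ (primeBelow F P) =
            2 * (Ideal.absNorm (primeBelow F P).asIdeal : ℝ) ^ (-s) := by
          simp only [hφ, if_pos hPT, if_neg hPB, add_zero]
        nlinarith
    have e6 := s1.tsum_le_tsum key (s0.add s5)
    rw [s0.tsum_add s5] at e6
    have e7 : ∑' v, φ v = _ := tsum_mul_left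
    rw [s3.tsum_add s4, e4] at e7
    push_cast at e5
    linarith
  set M := C₃ + Real.log C₂ + 4 * (C₁ + B.card)
  have h8 := hbound (1 + Real.exp (-(|M| + 1))) (by simp [Real.exp_pos]) (by
    have : Real.exp (-(|M| + 1)) ≤ 1 := Real.exp_le_one_iff.2 (by linarith [abs_nonneg M])
    linarith)
  rw [add_sub_cancel_left, one_div, ← Real.exp_neg, neg_neg, Real.log_exp] at h8
  linarith [le_abs_self M]

end AIdeal

section ClassThm

open scoped Classical nonZeroDivisors
open Module NumberField IsDedekindDomain

universe u

variable {F : Type u} [Field F] [NumberField F]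

theorem exists_sub_mem_and_sub_mem {R : Type*} [CommRing R] {I M : Ideal R} (h : IsCoprime I M)
    (x y : R) : ∃ z, z - x ∈ I ∧ z - y ∈ M := by
  obtain ⟨i, hi, j, hj, hij⟩ := Ideal.isCoprime_iff_exists.1 h
  refine ⟨x * j + y * i, ?_, ?_⟩
  · convert I.mul_mem_left (y - x) hi using 1
    linear_combination x * hij
  · convert M.mul_mem_left (x - y) hj using 1
    linear_combination y * hij

theorem exists_prime_nat_mem (v : HeightOneSpectrum (𝓞 F)) :
    ∃ p : ℕ, p.Prime ∧ (p : 𝓞 F) ∈ v.asIdeal := by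
  have := v.isPrime
  have : Finite (𝓞 F ⧸ v.asIdeal) := Ideal.finiteQuotientOfFreeOfNeBot _ v.ne_bot
  refine ⟨ringChar (𝓞 F ⧸ v.asIdeal), CharP.char_is_prime (𝓞 F ⧸ v.asIdeal) _, ?_⟩
  rw [← Ideal.Quotient.eq_zero_iff_mem, map_natCast]
  exact ringChar.Nat.cast_ringChar

theorem isCoprime_of_not_le {v : HeightOneSpectrum (𝓞 F)} {M : Ideal (𝓞 F)}
    (h : ¬ M ≤ v.asIdeal) : IsCoprime v.asIdeal M := by
  rw [Ideal.isCoprime_iff_sup_eq]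
  exact v.isMaximal.1.2 _ (lt_of_le_of_ne le_sup_left fun h1 => h (h1 ▸ le_sup_right))

theorem exists_prime_power_factor (v : HeightOneSpectrum (𝓞 F)) {p : ℕ} (hp : p.Prime) :
    ∃ (M : Ideal (𝓞 F)) (e : ℕ), IsCoprime v.asIdeal M ∧
      Ideal.span {(p : 𝓞 F)} = v.asIdeal ^ e * M := by
  obtain ⟨e, M, hM, h⟩ := WfDvdMonoid.max_power_factor
    (show Ideal.span {(p : 𝓞 F)} ≠ 0 by simp [hp.ne_zero]) v.irreducible
  exact ⟨M, e, isCoprime_of_not_le fun h => hM (Ideal.dvd_iff_le.2 h), h⟩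

theorem exists_coprime_cofactor {v : HeightOneSpectrum (𝓞 F)} {M : Ideal (𝓞 F)} {e : ℕ}
    {n : 𝓞 F} (hn : n ∈ v.asIdeal) (hn2 : n ∉ v.asIdeal ^ 2)
    (hn1 : n - 1 ∈ M) :
    ∃ J : Ideal (𝓞 F), Ideal.span {n} = v.asIdeal * J ∧ IsCoprime J (v.asIdeal ^ e * M) := by
  obtain ⟨J, hJ⟩ := Ideal.dvd_span_singleton.2 hn
  refine ⟨J, hJ, IsCoprime.mul_right (IsCoprime.pow_right ?_) ?_⟩
  · refine (isCoprime_of_not_le fun h => hn2 ?_).symm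
    rw [← Ideal.dvd_span_singleton, hJ, pow_two]
    exact mul_dvd_mul_left _ (Ideal.dvd_iff_le.2 h)
  · refine Ideal.isCoprime_iff_exists.2 ⟨n, ?_, 1 - n, ?_, by ring⟩
    · rw [← Ideal.dvd_span_singleton, hJ]
      exact Dvd.intro_left _ rfl
    · rw [← neg_sub]
      exact M.neg_mem hn1

/-- A quadratic character of the class group, viewed as a character of ideals. -/
def idealChar (φ : ClassGroup (𝓞 F) →* ℝˣ) : Ideal (𝓞 F) →*₀ ℝ where
  toFun I := if h : I = 0 then 0 else φ (ClassGroup.mk0 ⟨I, mem_nonZeroDivisors_of_ne_zero h⟩)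
  map_zero' := dif_pos rfl
  map_one' := by
    rw [dif_neg one_ne_zero]
    have : (⟨1, mem_nonZeroDivisors_of_ne_zero one_ne_zero⟩ : (Ideal (𝓞 F))⁰) = 1 := rfl
    rw [this, map_one, map_one, Units.val_one]
  map_mul' I J := by
    by_cases hI : I = 0
    · simp [hI]
    by_cases hJ : J = 0
    · simp [hJ]
    rw [dif_neg hI, dif_neg hJ, dif_neg (mul_ne_zero hI hJ), ← Units.val_mul, ← map_mul, ← map_mul]
    rfl

theorem idealChar_apply (φ : ClassGroup (𝓞 F) →* ℝˣ) {I : Ideal (𝓞 F)} (h : I ≠ 0) :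
    idealChar φ I = φ (ClassGroup.mk0 ⟨I, mem_nonZeroDivisors_of_ne_zero h⟩) := dif_neg h

theorem exists_quadratic_char {G : Type*} [CommGroup G] [Finite G] {H : Subgroup G} (hH : H ≠ ⊤)
    (hsq : ∀ g : G, g ^ 2 ∈ H) :
    ∃ φ : G →* ℝˣ, (∀ g ∈ H, φ g = 1) ∧ (∀ g, φ g ^ 2 = 1) ∧ ∃ g, φ g ≠ 1 := by
  obtain ⟨g, hg⟩ : ∃ g, g ∉ H := by
    by_contra! h
    exact hH (eq_top_iff.2 fun g _ => h g)
  have hne : (QuotientGroup.mk g : G ⧸ H) ≠ 1 := fun h => hg ((QuotientGroup.eq_one_iff g).1 h)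
  have hexp : ∀ q : G ⧸ H, q ^ 2 = 1 := fun q => by
    obtain ⟨x, rfl⟩ := QuotientGroup.mk_surjective q
    rw [← QuotientGroup.mk_pow]
    exact (QuotientGroup.eq_one_iff _).2 (hsq x)
  have h2 : Monoid.exponent (G ⧸ H) = 2 := by
    rcases (Nat.dvd_prime Nat.prime_two).1 (Monoid.exponent_dvd_of_forall_pow_eq_one hexp)
      with h | h
    · have := Monoid.exp_eq_one_iff.1 h
      exact absurd (Subsingleton.elim _ _) hne
    · exact h
  have hroots : HasEnoughRootsOfUnity ℝ (Monoid.exponent (G ⧸ H)) := by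
    rw [h2]
    exact ⟨⟨-1, IsPrimitiveRoot.neg_one 0 (by norm_num)⟩, inferInstance⟩
  obtain ⟨φ, hφ⟩ := CommGroup.exists_apply_ne_one_of_hasEnoughRootsOfUnity (G ⧸ H) ℝ hne
  refine ⟨φ.comp (QuotientGroup.mk' H), fun x hx => ?_, fun x => ?_, g, hφ⟩
  · rw [MonoidHom.comp_apply, QuotientGroup.mk'_apply, (QuotientGroup.eq_one_iff x).2 hx, map_one]
  · rw [← map_pow, MonoidHom.comp_apply, QuotientGroup.mk'_apply,
      (QuotientGroup.eq_one_iff _).2 (hsq x), map_one]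

/-- The classes of the `p`-parts of values of the form `x² + d y²` generate the class group. -/
theorem classGroup_eq_top_of_norm_form (hF : ∀ φ : F →+* ℂ, ComplexEmbedding.IsReal φ) {d : 𝓞 F}
    (hd0 : d ≠ 0) (hd : ∀ σ : F →+* ℝ, 0 < σ d) (H : Subgroup (ClassGroup (𝓞 F)))
    (hH : ∀ (a b : 𝓞 F) (I J : Ideal (𝓞 F)) (hI : I ∈ (Ideal (𝓞 F))⁰) (p : ℕ), p.Prime →
      a ^ 2 + d * b ^ 2 ≠ 0 → Ideal.span {a ^ 2 + d * b ^ 2} = I * J →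
      IsCoprime J (Ideal.span {(p : 𝓞 F)}) → (∃ k, (p : 𝓞 F) ^ k ∈ I) →
      ClassGroup.mk0 ⟨I, hI⟩ ∈ H) : H = ⊤ := by
  have hsqv : ∀ v : HeightOneSpectrum (𝓞 F),
      ClassGroup.mk0 ⟨v.asIdeal, mem_nonZeroDivisors_of_ne_zero v.ne_bot⟩ ^ 2 ∈ H := by
    intro v
    obtain ⟨p, hp, hpv⟩ := exists_prime_nat_mem v
    obtain ⟨M, e, hM, hpM⟩ := exists_prime_power_factor v hp
    obtain ⟨x, hx, hx2⟩ := Ideal.exists_mem_pow_notMem_pow_succ v.asIdeal v.ne_bot v.isPrime.ne_top 1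
    obtain ⟨z, hz, hz1⟩ := exists_sub_mem_and_sub_mem (IsCoprime.pow_left (m := 2) hM) x 1
    have hzv2 : z ∉ v.asIdeal ^ 2 := fun h => hx2 (by
      have := (v.asIdeal ^ 2).sub_mem h hz
      rwa [sub_sub_cancel] at this)
    have hzv : z ∈ v.asIdeal := by
      rw [pow_one] at hx
      have := v.asIdeal.add_mem (Ideal.pow_le_self two_ne_zero hz) hx
      rwa [sub_add_cancel] at this
    obtain ⟨J, hJ, hJc⟩ := exists_coprime_cofactor (e := e) hzv hzv2 hz1
    have hz0 : z ≠ 0 := fun h => hzv2 (h ▸ zero_mem _)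
    have := hH z 0 (v.asIdeal ^ 2) (J ^ 2)
      (mem_nonZeroDivisors_of_ne_zero (pow_ne_zero 2 v.ne_bot)) p hp (by simp [hz0])
      (by rw [← mul_pow, ← hJ, Ideal.span_singleton_pow]; simp) (by rw [hpM]; exact hJc.pow_left)
      ⟨2, Ideal.pow_mem_pow hpv 2⟩
    rw [← map_pow]
    exact this
  by_contra hne
  have hsq : ∀ g : ClassGroup (𝓞 F), g ^ 2 ∈ H := by
    intro g
    obtain ⟨⟨I, hI⟩, rfl⟩ := ClassGroup.mk0_surjective g
    induction I using UniqueFactorizationMonoid.induction_on_prime with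
    | h₁ => exact absurd rfl (nonZeroDivisors.ne_zero hI)
    | h₂ x hx =>
      have : (⟨x, hI⟩ : (Ideal (𝓞 F))⁰) = 1 := Subtype.ext (by simpa using hx)
      rw [this, map_one, one_pow]
      exact one_mem _
    | h₃ a p ha hp ih =>
      have hpr : p.IsPrime := Ideal.isPrime_of_prime hp
      have h1 := hsqv ⟨p, hpr, hp.ne_zero⟩
      have h2 := ih (mem_nonZeroDivisors_of_ne_zero ha)
      have h3 := H.mul_mem h1 h2
      rw [← mul_pow, ← map_mul] at h3
      exact h3
  obtain ⟨φ, hφH, hφsq, g, hφg⟩ := exists_quadratic_char hne hsq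
  obtain ⟨⟨I₁, hI₁⟩, rfl⟩ := ClassGroup.mk0_surjective g
  refine hφg (Units.ext ?_)
  rw [Units.val_one, ← idealChar_apply φ (nonZeroDivisors.ne_zero hI₁)]
  refine eq_one_of_negIsSquareMod hF hd0 hd (ψ := idealChar φ) (fun I hI => ?_) (fun α hα => ?_)
    (fun v hv2 hvd hS => ?_) (nonZeroDivisors.ne_zero hI₁)
  · rw [idealChar_apply φ hI, ← Units.val_pow_eq_pow_val, hφsq, Units.val_one]
  · rw [idealChar_apply φ (by simpa using hα), (ClassGroup.mk0_eq_one_iff _).2 ⟨α, rfl⟩, map_one,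
      Units.val_one]
  rw [idealChar_apply φ v.ne_bot, hφH _ ?_, Units.val_one]
  obtain ⟨p, hp, hpv⟩ := exists_prime_nat_mem v
  obtain ⟨M, e, hM, hpM⟩ := exists_prime_power_factor v hp
  obtain ⟨a₀, ha₀⟩ := hS
  have hpr := v.isPrime
  have ha₀v : a₀ ∉ v.asIdeal := fun h => hvd (by
    have := v.asIdeal.sub_mem ha₀ (v.asIdeal.mul_mem_left a₀ h)
    convert this using 1
    ring)
  obtain ⟨a₁, ha₁, ha₁2⟩ : ∃ a₁, a₁ ^ 2 + d ∈ v.asIdeal ∧ a₁ ^ 2 + d ∉ v.asIdeal ^ 2 := by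
    by_cases h : a₀ ^ 2 + d ∈ v.asIdeal ^ 2
    · obtain ⟨x, hx, hx2⟩ :=
        Ideal.exists_mem_pow_notMem_pow_succ v.asIdeal v.ne_bot v.isPrime.ne_top 1
      rw [pow_one] at hx
      refine ⟨a₀ + x, ?_, fun h' => ?_⟩
      · have := v.asIdeal.add_mem ha₀ (v.asIdeal.mul_mem_left (2 * a₀ + x) hx)
        convert this using 1
        ring
      · have h3 : 2 * a₀ * x ∈ v.asIdeal ^ 2 := by
          have := (v.asIdeal ^ 2).sub_mem ((v.asIdeal ^ 2).sub_mem h' h) (Ideal.pow_mem_pow hx 2)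
          convert this using 1
          ring
        rcases Ideal.IsPrime.mul_mem_pow v.asIdeal h3 with h4 | h4
        · rcases hpr.mem_or_mem h4 with h5 | h5
          · exact hv2 h5
          · exact ha₀v h5
        · exact hx2 h4
    · exact ⟨a₀, ha₀, h⟩
  obtain ⟨a, haI, haM⟩ := exists_sub_mem_and_sub_mem (IsCoprime.pow_left (m := 2) hM) a₁ 1
  obtain ⟨b, hbI, hbM⟩ := exists_sub_mem_and_sub_mem (IsCoprime.pow_left (m := 2) hM) 1 0
  have hdiff : a ^ 2 + d * b ^ 2 - (a₁ ^ 2 + d) ∈ v.asIdeal ^ 2 := by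
    have := (v.asIdeal ^ 2).add_mem ((v.asIdeal ^ 2).mul_mem_left (a + a₁) haI)
      ((v.asIdeal ^ 2).mul_mem_left (d * (b + 1)) hbI)
    convert this using 1
    ring
  have hn2 : a ^ 2 + d * b ^ 2 ∉ v.asIdeal ^ 2 := fun h => ha₁2 (by
    have := (v.asIdeal ^ 2).sub_mem h hdiff
    rwa [sub_sub_cancel] at this)
  have hn : a ^ 2 + d * b ^ 2 ∈ v.asIdeal := by
    have := v.asIdeal.add_mem (Ideal.pow_le_self two_ne_zero hdiff) ha₁
    rwa [sub_add_cancel] at this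
  have hn1 : a ^ 2 + d * b ^ 2 - 1 ∈ M := by
    have := M.add_mem (M.mul_mem_left (a + 1) haM) (M.mul_mem_left (d * b) hbM)
    convert this using 1
    ring
  obtain ⟨J, hJ, hJc⟩ := exists_coprime_cofactor (e := e) hn hn2 hn1
  exact hH a b v.asIdeal J _ p hp (fun h => hn2 (h ▸ zero_mem _)) hJ (by rw [hpM]; exact hJc)
    ⟨1, by simpa using hpv⟩

end ClassThm

section Mass

open scoped Classical
open MulAction

variable {G L Y : Type*} [Group G] [MulAction G L] [MulAction G Y] (N : Subgroup G)

/-- The mass of the orbit of `y`, relative to `N`. -/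
def orbitMass (y : Y) : ℚ := ((N.relIndex (stabilizer G y) : ℕ) : ℚ)⁻¹

theorem orbitMass_smul [N.Normal] (g : G) (y : Y) : orbitMass N (g • y) = orbitMass N y := by
  have h1 : stabilizer G (g • y) = MulAut.conj g • stabilizer G y :=
    stabilizer_smul_eq_stabilizer_map_conj g y
  have h2 : MulAut.conj g • N = N := Subgroup.Normal.conj_smul_eq_self g N
  rw [orbitMass, orbitMass, h1]
  conv_lhs => rw [← h2]
  rw [Subgroup.relIndex_pointwise_smul]

theorem orbitMass_eq_of_mk_eq [N.Normal] {y z : Y}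
    (h : (Quotient.mk'' y : orbitRel.Quotient G Y) = Quotient.mk'' z) :
    orbitMass N y = orbitMass N z := by
  obtain ⟨g, rfl⟩ := (orbitRel_apply.1 (Quotient.exact h))
  exact orbitMass_smul N g z

theorem card_fiber_mul_orbitMass {π : Y → L} (hπ : ∀ (g : G) y, π (g • y) = g • π y)
    (hNY : ∀ y : Y, N ≤ stabilizer G y) {y₀ : Y} (hL : N.relIndex (stabilizer G (π y₀)) ≠ 0) :
    (Set.ncard {y | π y = π y₀ ∧
      (Quotient.mk'' y : orbitRel.Quotient G Y) = Quotient.mk'' y₀} : ℚ) * orbitMass N (π y₀) =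
    orbitMass N y₀ := by
  have h1 : {y | π y = π y₀ ∧ (Quotient.mk'' y : orbitRel.Quotient G Y) = Quotient.mk'' y₀} =
      orbit (stabilizer G (π y₀)) y₀ := by
    ext y
    constructor
    · rintro ⟨h, h'⟩
      obtain ⟨g, rfl⟩ := (orbitRel_apply.1 (Quotient.exact h'))
      refine ⟨⟨g, ?_⟩, rfl⟩
      rw [mem_stabilizer_iff, ← hπ]
      exact h
    · rintro ⟨⟨g, hg⟩, rfl⟩
      exact ⟨(hπ g y₀).trans hg, Quotient.sound (mem_orbit y₀ g)⟩
  have hle : stabilizer G y₀ ≤ stabilizer G (π y₀) := fun g hg => by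
    rw [mem_stabilizer_iff, ← hπ, mem_stabilizer_iff.1 hg]
  have h2 : Set.ncard (orbit (stabilizer G (π y₀)) y₀) =
      (stabilizer G y₀).relIndex (stabilizer G (π y₀)) := by
    rw [← index_stabilizer]
    rfl
  have h3 := Subgroup.relIndex_mul_relIndex N _ _ (hNY y₀) hle
  rw [h1, h2, orbitMass, orbitMass, ← h3]
  rw [← h3] at hL
  have h4 := left_ne_zero_of_mul hL
  have h5 := right_ne_zero_of_mul hL
  push_cast
  field_simp

theorem sum_orbitMass_fiber [N.Normal] {π : Y → L} (hπ : ∀ (g : G) y, π (g • y) = g • π y)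
    (hNY : ∀ y : Y, N ≤ stabilizer G y) (I : L) (hL : N.relIndex (stabilizer G I) ≠ 0)
    (T : Finset Y) (hT : ∀ y, y ∈ T ↔ π y = I) :
    ∑ o ∈ T.image (fun y => (Quotient.mk'' y : orbitRel.Quotient G Y)), orbitMass N o.out =
      T.card * orbitMass N I := by
  rw [Finset.card_eq_sum_card_image (fun y => (Quotient.mk'' y : orbitRel.Quotient G Y)) T,
    Nat.cast_sum, Finset.sum_mul]
  refine Finset.sum_congr rfl fun o ho => ?_
  obtain ⟨y₀, hy₀, rfl⟩ := Finset.mem_image.1 ho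
  rw [orbitMass_eq_of_mk_eq N (Quotient.out_eq' (Quotient.mk'' y₀ : orbitRel.Quotient G Y))]
  rw [hT] at hy₀
  subst hy₀
  rw [← card_fiber_mul_orbitMass N hπ hNY hL, ← Set.ncard_coe_finset]
  congr 4
  ext y
  simp [hT]

theorem mk_out_eq_iff {π : Y → L} (hπ : ∀ (g : G) y, π (g • y) = g • π y)
    (o : orbitRel.Quotient G Y) (I : L) :
    (Quotient.mk'' (π o.out) : orbitRel.Quotient G L) = Quotient.mk'' I ↔
      ∃ y, π y = I ∧ Quotient.mk'' y = o := by
  constructor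
  · intro h
    obtain ⟨g, hg⟩ := (orbitRel_apply.1 (Quotient.exact h.symm))
    refine ⟨g • o.out, (hπ _ _).trans hg, ?_⟩
    refine Eq.trans ?_ (Quotient.out_eq' o)
    exact Quotient.sound (mem_orbit o.out g)
  · rintro ⟨y, rfl, rfl⟩
    obtain ⟨g, hg⟩ := (orbitRel_apply.1 (Quotient.exact
      (Quotient.out_eq' (Quotient.mk'' y : orbitRel.Quotient G Y))))
    simp only at hg
    refine Quotient.sound ?_
    rw [← hg]
    exact ⟨g, (hπ g y).symm⟩

theorem image_fiber_eq {π : Y → L} (hπ : ∀ (g : G) y, π (g • y) = g • π y) (I : L) :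
    (fun y => (Quotient.mk'' y : orbitRel.Quotient G Y)) '' {y | π y = I} =
      {o | (Quotient.mk'' (π o.out) : orbitRel.Quotient G L) = Quotient.mk'' I} := by
  ext o
  exact (mk_out_eq_iff hπ o I).symm

theorem finite_orbits_of_finite_fibers [Finite (orbitRel.Quotient G L)] {π : Y → L}
    (hπ : ∀ (g : G) y, π (g • y) = g • π y) (hfin : ∀ I, {y | π y = I}.Finite) :
    Finite (orbitRel.Quotient G Y) := by
  rw [← Set.finite_univ_iff, ← Set.preimage_univ
    (f := fun o : orbitRel.Quotient G Y => (Quotient.mk'' (π o.out) : orbitRel.Quotient G L))]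
  refine Set.finite_univ.preimage' fun x _ => ?_
  rw [← Quotient.out_eq' x]
  have := (hfin x.out).image (fun y => (Quotient.mk'' y : orbitRel.Quotient G Y))
  rw [image_fiber_eq hπ] at this
  exact this

theorem sum_orbitMass [Fintype (orbitRel.Quotient G L)] [Fintype (orbitRel.Quotient G Y)]
    [N.Normal] {π : Y → L} (hπ : ∀ (g : G) y, π (g • y) = g • π y)
    (hNY : ∀ y : Y, N ≤ stabilizer G y) (hL : ∀ I : L, N.relIndex (stabilizer G I) ≠ 0)
    (hfin : ∀ I, {y | π y = I}.Finite) {C : Type*} (cl : L → C)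
    (hcl : ∀ (g : G) I, cl (g • I) = cl I) (c : C) :
    ∑ o : orbitRel.Quotient G Y with cl (π o.out) = c, orbitMass N o.out =
      ∑ x : orbitRel.Quotient G L with cl x.out = c,
        ({y | π y = x.out}.ncard : ℚ) * orbitMass N x.out := by
  have hcl' : ∀ I : L, cl (Quotient.mk'' I : orbitRel.Quotient G L).out = cl I := fun I => by
    obtain ⟨g, hg⟩ := orbitRel_apply.1 (Quotient.exact
      (Quotient.out_eq' (Quotient.mk'' I : orbitRel.Quotient G L)))
    simp only at hg
    rw [← hg, hcl]
  rw [← Finset.sum_fiberwise_of_maps_to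
    (t := Finset.univ.filter fun x : orbitRel.Quotient G L => cl x.out = c)
    (g := fun o : orbitRel.Quotient G Y => (Quotient.mk'' (π o.out) : orbitRel.Quotient G L))]
  · refine Finset.sum_congr rfl fun x hx => ?_
    rw [Finset.mem_filter] at hx
    have h := sum_orbitMass_fiber N hπ hNY x.out (hL _) (hfin x.out).toFinset (by simp)
    rw [Set.ncard_eq_toFinset_card _ (hfin x.out), ← h]
    refine Finset.sum_congr ?_ fun _ _ => rfl
    ext o
    have h2 := mk_out_eq_iff hπ o x.out
    rw [Quotient.out_eq'] at h2
    simp only [Finset.mem_filter, Finset.mem_univ, true_and, Finset.mem_image,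
      Set.Finite.mem_toFinset, Set.mem_ofPred_eq]
    rw [← h2]
    constructor
    · exact fun h => h.2
    · intro h
      refine ⟨?_, h⟩
      rw [← hcl' (π o.out), h]
      exact hx.2
  · intro o ho
    rw [Finset.mem_filter] at ho ⊢
    exact ⟨Finset.mem_univ _, (hcl' _).trans ho.2⟩

/-- Mass formula for a correspondence `π₁, π₂ : Y → L` shifting the invariant `cl` by `f`. -/
theorem sum_orbitMass_correspondence [Fintype (orbitRel.Quotient G L)]
    [N.Normal] {π₁ π₂ : Y → L} (hπ₁ : ∀ (g : G) y, π₁ (g • y) = g • π₁ y)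
    (hπ₂ : ∀ (g : G) y, π₂ (g • y) = g • π₂ y)
    (hNY : ∀ y : Y, N ≤ stabilizer G y) (hL : ∀ I : L, N.relIndex (stabilizer G I) ≠ 0)
    (hfin₁ : ∀ I, {y | π₁ y = I}.Finite) (hfin₂ : ∀ I, {y | π₂ y = I}.Finite)
    {C : Type*} (cl : L → C) (hcl : ∀ (g : G) I, cl (g • I) = cl I) {f : C → C}
    (hf : f.Injective) (hπ : ∀ y, cl (π₂ y) = f (cl (π₁ y))) (c : C) :
    ∑ x : orbitRel.Quotient G L with cl x.out = c,
        ({y | π₁ y = x.out}.ncard : ℚ) * orbitMass N x.out =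
      ∑ x : orbitRel.Quotient G L with cl x.out = f c,
        ({y | π₂ y = x.out}.ncard : ℚ) * orbitMass N x.out := by
  have := finite_orbits_of_finite_fibers hπ₁ hfin₁
  let _ := Fintype.ofFinite (orbitRel.Quotient G Y)
  rw [← sum_orbitMass N hπ₁ hNY hL hfin₁ cl hcl, ← sum_orbitMass N hπ₂ hNY hL hfin₂ cl hcl]
  refine Finset.sum_congr (Finset.filter_congr fun o _ => ?_) fun _ _ => rfl
  rw [hπ, hf.eq_iff]

end Mass

section Lattice

variable {V : Type*} [AddCommGroup V]

theorem exists_pow_mul_not_dvd {p : ℕ} (hp : p.Prime) {N : ℤ} (hN : N ≠ 0) :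
    ∃ (j : ℕ) (n : ℤ), ¬ (p : ℤ) ∣ n ∧ N = (p : ℤ) ^ j * n := by
  have hf : FiniteMultiplicity (p : ℤ) N :=
    Int.finiteMultiplicity_iff.2 ⟨by simpa using hp.ne_one, hN⟩
  obtain ⟨n, h1, h2⟩ := hf.exists_eq_pow_mul_and_not_dvd
  exact ⟨_, n, h2, h1⟩

theorem not_dvd_mul_int {p : ℕ} (hp : p.Prime) {a b : ℤ} (ha : ¬ (p : ℤ) ∣ a)
    (hb : ¬ (p : ℤ) ∣ b) : ¬ (p : ℤ) ∣ a * b :=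
  fun h => ((Nat.prime_iff_prime_int.1 hp).dvd_or_dvd h).elim ha hb

theorem prime_not_dvd_one {p : ℕ} (hp : p.Prime) : ¬ (p : ℤ) ∣ 1 :=
  (Nat.prime_iff_prime_int.1 hp).not_dvd_one

theorem prime_not_dvd_pow {p q : ℕ} (hp : p.Prime) (hq : q.Prime) (h : q ≠ p) (j : ℕ) :
    ¬ (q : ℤ) ∣ (p : ℤ) ^ j := fun h1 => by
  have h2 := (Nat.prime_iff_prime_int.1 hq).dvd_of_dvd_pow h1
  rw [Int.natCast_dvd_natCast, Nat.prime_dvd_prime_iff_eq hq hp] at h2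
  exact h h2

theorem mem_locAt_of_mem {p : ℕ} (hp : p.Prime) {S : Set V} {x : V} (hx : x ∈ S) :
    x ∈ locAt p S := ⟨1, prime_not_dvd_one hp, by simpa using hx⟩

theorem locAt_mono {p : ℕ} {S T : Set V} (h : S ⊆ T) : locAt p S ⊆ locAt p T :=
  fun _ ⟨n, hn, hx⟩ => ⟨n, hn, h hx⟩

theorem locAt_idem {p : ℕ} (hp : p.Prime) (S : Set V) : locAt p (locAt p S) = locAt p S := by
  refine Set.Subset.antisymm ?_ fun x hx => mem_locAt_of_mem hp hx
  rintro x ⟨n, hn, m, hm, hx⟩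
  exact ⟨m * n, not_dvd_mul_int hp hm hn, by rwa [mul_smul]⟩

/-- The localization of a lattice at a prime, as a submodule. -/
def locMod (p : ℕ) (hp : p.Prime) (I : Submodule ℤ V) : Submodule ℤ V where
  carrier := locAt p (I : Set V)
  zero_mem' := mem_locAt_of_mem hp I.zero_mem
  add_mem' := by
    rintro x y ⟨n, hn, hx⟩ ⟨m, hm, hy⟩
    refine ⟨n * m, not_dvd_mul_int hp hn hm, ?_⟩
    rw [smul_add]
    refine I.add_mem ?_ ?_
    · rw [mul_comm, mul_smul]
      exact I.smul_mem m hx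
    · rw [mul_smul]
      exact I.smul_mem n hy
  smul_mem' := by
    rintro c x ⟨n, hn, hx⟩
    exact ⟨n, hn, by rw [smul_comm]; exact I.smul_mem c hx⟩

theorem locAt_subset_locAt {p : ℕ} (hp : p.Prime) {S T : Set V} (h : S ⊆ locAt p T) :
    locAt p S ⊆ locAt p T := (locAt_mono h).trans (locAt_idem hp T).le

theorem mem_of_forall_mem_locAt {I : Submodule ℤ V} {x : V}
    (h : ∀ p : ℕ, p.Prime → x ∈ locAt p (I : Set V)) : x ∈ I := by
  let A : Ideal ℤ := Submodule.comap (LinearMap.toSpanSingleton ℤ V x) I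
  have hA : ∀ n : ℤ, n ∈ A ↔ n • x ∈ I := fun n => by simp [A]
  suffices A = ⊤ by simpa using (hA 1).1 (this ▸ Submodule.mem_top)
  obtain ⟨a, ha⟩ := IsPrincipalIdealRing.principal A
  rw [show A = Ideal.span {a} from ha, Ideal.span_singleton_eq_top, Int.isUnit_iff_natAbs_eq]
  by_contra hne
  obtain ⟨p, hp, hpa⟩ := Nat.exists_prime_and_dvd hne
  obtain ⟨n, hn, hx⟩ := h p hp
  rw [SetLike.mem_coe, ← hA, show A = Ideal.span {a} from ha, Ideal.mem_span_singleton] at hx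
  exact hn ((Int.natCast_dvd.2 hpa).trans hx)

theorem le_of_forall_locAt_subset {I J : Submodule ℤ V}
    (h : ∀ p : ℕ, p.Prime → locAt p (I : Set V) ⊆ locAt p (J : Set V)) : I ≤ J :=
  fun _ hx => mem_of_forall_mem_locAt fun p hp => h p hp (mem_locAt_of_mem hp hx)

theorem eq_of_forall_locAt_eq {I J : Submodule ℤ V}
    (h : ∀ p : ℕ, p.Prime → locAt p (I : Set V) = locAt p (J : Set V)) : I = J :=
  le_antisymm (le_of_forall_locAt_subset fun p hp => (h p hp).le)
    (le_of_forall_locAt_subset fun p hp => (h p hp).ge)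

/-- The lattice which agrees with `M` at `p` and with `I` at all other primes. -/
def glue (p : ℕ) (hp : p.Prime) (M I : Submodule ℤ V) : Submodule ℤ V where
  carrier := {x | x ∈ locAt p (M : Set V) ∧ ∃ j : ℕ, (p : ℤ) ^ j • x ∈ I}
  zero_mem' := ⟨mem_locAt_of_mem hp M.zero_mem, 0, by simp⟩
  add_mem' := by
    rintro x y ⟨hx, j, hj⟩ ⟨hy, k, hk⟩
    refine ⟨(locMod p hp M).add_mem hx hy, j + k, ?_⟩
    rw [smul_add]
    refine I.add_mem ?_ ?_
    · rw [add_comm, pow_add, mul_smul]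
      exact I.smul_mem _ hj
    · rw [pow_add, mul_smul]
      exact I.smul_mem _ hk
  smul_mem' := by
    rintro c x ⟨hx, j, hj⟩
    exact ⟨(locMod p hp M).smul_mem c hx, j, by rw [smul_comm]; exact I.smul_mem c hj⟩

theorem mem_glue {p : ℕ} (hp : p.Prime) {M I : Submodule ℤ V} {x : V} :
    x ∈ glue p hp M I ↔ x ∈ locAt p (M : Set V) ∧ ∃ j : ℕ, (p : ℤ) ^ j • x ∈ I := Iff.rfl

/-- A submodule is full if it contains a nonzero multiple of every vector. -/
def IsFull (I : Submodule ℤ V) : Prop := ∀ x : V, ∃ N : ℤ, N ≠ 0 ∧ N • x ∈ I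

variable {p : ℕ} (hp : p.Prime) {M I : Submodule ℤ V}

theorem locAt_glue_self (hI : IsFull I) :
    locAt p (glue p hp M I : Set V) = locAt p (M : Set V) := by
  refine Set.Subset.antisymm (locAt_subset_locAt hp fun x hx => hx.1) ?_
  intro x hx
  obtain ⟨N, hN, hNx⟩ := hI x
  obtain ⟨j, n, hn, rfl⟩ := exists_pow_mul_not_dvd hp hN
  exact ⟨n, hn, (locMod p hp M).smul_mem n hx, j, by rwa [← mul_smul]⟩

theorem locAt_glue_of_ne (hM : IsFull M) {q : ℕ} (hq : q.Prime) (hqp : q ≠ p) :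
    locAt q (glue p hp M I : Set V) = locAt q (I : Set V) := by
  refine Set.Subset.antisymm ?_ ?_
  · rintro x ⟨n, hn, -, j, hj⟩
    exact ⟨(p : ℤ) ^ j * n, not_dvd_mul_int hq (prime_not_dvd_pow hp hq hqp j) hn,
      by rwa [mul_smul]⟩
  · rintro x ⟨n, hn, hx⟩
    obtain ⟨N, hN, hNx⟩ := hM (n • x)
    obtain ⟨k, m, hm, rfl⟩ := exists_pow_mul_not_dvd hp hN
    refine ⟨(p : ℤ) ^ k * n, not_dvd_mul_int hq (prime_not_dvd_pow hp hq hqp k) hn,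
      ⟨m, hm, ?_⟩, 0, ?_⟩
    · rw [← mul_smul, ← mul_assoc, mul_comm m, mul_smul]
      exact hNx
    · rw [pow_zero, one_smul, mul_smul]
      exact I.smul_mem _ hx

theorem isFull_glue (hM : IsFull M) (hI : IsFull I) : IsFull (glue p hp M I) := fun x => by
  obtain ⟨N, hN, hNx⟩ := hM x
  obtain ⟨N', hN', hNx'⟩ := hI x
  refine ⟨N * N', mul_ne_zero hN hN', mem_locAt_of_mem hp ?_, 0, ?_⟩
  · rw [mul_comm, mul_smul]
    exact M.smul_mem _ hNx
  · rw [pow_zero, one_smul, mul_smul]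
    exact I.smul_mem _ hNx'

theorem IsFull.exists_smul_le (hI : IsFull I) (hM : M.FG) :
    ∃ N : ℤ, N ≠ 0 ∧ ∀ x ∈ M, N • x ∈ I := by
  refine Submodule.fg_induction (motive := fun M _ => ∃ N : ℤ, N ≠ 0 ∧ ∀ x ∈ M, N • x ∈ I) ?_ ?_ M hM
  · intro x
    obtain ⟨N, hN, hx⟩ := hI x
    refine ⟨N, hN, fun y hy => ?_⟩
    obtain ⟨c, rfl⟩ := Submodule.mem_span_singleton.1 hy
    rw [smul_comm]
    exact I.smul_mem c hx
  · rintro M₁ M₂ _ _ ⟨N, hN, h⟩ ⟨N', hN', h'⟩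
    refine ⟨N * N', mul_ne_zero hN hN', fun x hx => ?_⟩
    obtain ⟨y, hy, z, hz, rfl⟩ := Submodule.mem_sup.1 hx
    rw [smul_add]
    refine I.add_mem ?_ ?_
    · rw [mul_comm, mul_smul]
      exact I.smul_mem _ (h y hy)
    · rw [mul_smul]
      exact I.smul_mem _ (h' z hz)

theorem fg_of_smul_mem [Module ℚ V] {N : ℤ} (hN : N ≠ 0) (hI : I.FG)
    (h : ∀ x ∈ M, N • x ∈ I) : M.FG := by
  have hinj : Function.Injective (LinearMap.lsmul ℤ V N) := by
    intro x y hxy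
    simp only [LinearMap.lsmul_apply] at hxy
    rw [← Int.cast_smul_eq_zsmul ℚ, ← Int.cast_smul_eq_zsmul ℚ] at hxy
    exact smul_right_injective V (Int.cast_ne_zero.2 hN : (N : ℚ) ≠ 0) hxy
  have hle : M.map (LinearMap.lsmul ℤ V N) ≤ I := by
    rintro _ ⟨x, hx, rfl⟩
    exact h x hx
  have hn : IsNoetherian ℤ I := isNoetherian_of_fg_of_noetherian I hI
  have h2 : (M.map (LinearMap.lsmul ℤ V N)).FG := by
    have := isNoetherian_of_le hle
    exact (Submodule.fg_top _).1 (IsNoetherian.noetherian _)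
  exact Submodule.fg_of_fg_map_injective _ hinj h2

theorem fg_glue [Module ℚ V] (hI : IsFull I) (hIfg : I.FG) (hM : M.FG) : (glue p hp M I).FG := by
  obtain ⟨N, hN, h⟩ := hI.exists_smul_le hM
  refine fg_of_smul_mem hN hIfg ?_
  rintro x ⟨⟨n, hn, hx⟩, j, hj⟩
  have hc : IsCoprime n ((p : ℤ) ^ j) :=
    (((Nat.prime_iff_prime_int.1 hp).coprime_iff_not_dvd).2 hn).symm.pow_right
  obtain ⟨a, b, hab⟩ := hc
  have : N • x = a • N • n • x + (b * N) • (p : ℤ) ^ j • x := by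
    rw [← mul_smul, ← mul_smul, ← mul_smul, ← add_smul]
    congr 1
    linear_combination -N * hab
  rw [this]
  exact I.add_mem (I.smul_mem _ (h _ hx)) (I.smul_mem _ hj)

theorem span_rat_eq_top_iff [Module ℚ V] : Submodule.span ℚ (I : Set V) = ⊤ ↔ IsFull I := by
  constructor
  · intro h x
    have hx : x ∈ Submodule.span ℚ (I : Set V) := h ▸ Submodule.mem_top
    induction hx using Submodule.span_induction with
    | mem x hx => exact ⟨1, one_ne_zero, by simpa using hx⟩
    | zero => exact ⟨1, one_ne_zero, by simp⟩
    | add x y _ _ hx hy =>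
      obtain ⟨N, hN, hx⟩ := hx
      obtain ⟨N', hN', hy⟩ := hy
      refine ⟨N * N', mul_ne_zero hN hN', ?_⟩
      rw [smul_add]
      refine I.add_mem ?_ ?_
      · rw [mul_comm, mul_smul]
        exact I.smul_mem _ hx
      · rw [mul_smul]
        exact I.smul_mem _ hy
    | smul a x _ hx =>
      obtain ⟨N, hN, hx⟩ := hx
      refine ⟨a.den * N, mul_ne_zero (by simp) hN, ?_⟩
      have : ((a.den : ℤ) * N) • a • x = a.num • N • x := by
        rw [← Int.cast_smul_eq_zsmul ℚ, ← Int.cast_smul_eq_zsmul ℚ, ← Int.cast_smul_eq_zsmul ℚ,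
          ← mul_smul, ← mul_smul]
        congr 1
        push_cast
        rw [mul_right_comm, mul_comm (a.den : ℚ), Rat.mul_den_eq_num]
      rw [this]
      exact I.smul_mem _ hx
  · intro h
    rw [eq_top_iff]
    intro x _
    obtain ⟨N, hN, hx⟩ := h x
    have : x = ((N : ℚ)⁻¹) • N • x := by
      rw [← Int.cast_smul_eq_zsmul ℚ, smul_smul, inv_mul_cancel₀ (Int.cast_ne_zero.2 hN),
        one_smul]
    rw [this]
    exact Submodule.smul_mem _ _ (Submodule.subset_span hx)

/-- There are only finitely many submodules between a finitely generated one and a nonzero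
multiple of it. -/
theorem finite_submodules_between [Module ℚ V] (hI : I.FG) {m n : ℤ} (hm : m ≠ 0) (hn : n ≠ 0) :
    {J : Submodule ℤ V | (∀ x ∈ J, m • x ∈ I) ∧ ∀ x ∈ I, n • x ∈ J}.Finite := by
  let B : Submodule ℤ V := I.comap (LinearMap.lsmul ℤ V m)
  let A : Submodule ℤ V := I.map (LinearMap.lsmul ℤ V n)
  have hB : B.FG := fg_of_smul_mem hm hI fun x hx => hx
  have hfin : Finite (B.map A.mkQ) := by
    have : Module.Finite ℤ (B.map A.mkQ) := Module.Finite.iff_fg.2 (hB.map _)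
    refine Module.finite_of_fg_torsion _ ?_
    rintro ⟨_, x, hx, rfl⟩
    refine ⟨⟨n * m, mem_nonZeroDivisors_of_ne_zero (mul_ne_zero hn hm)⟩, ?_⟩
    apply Subtype.ext
    change (n * m) • A.mkQ x = 0
    rw [← map_smul, Submodule.mkQ_apply, Submodule.Quotient.mk_eq_zero, mul_smul]
    exact ⟨m • x, hx, rfl⟩
  have hfin' : {T : Set (V ⧸ A) | T ⊆ (B.map A.mkQ : Set (V ⧸ A))}.Finite :=
    Set.Finite.finite_subsets (Set.toFinite _)
  refine Set.Finite.of_finite_image (f := fun J : Submodule ℤ V => (J.map A.mkQ : Set (V ⧸ A)))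
    (hfin'.subset ?_) ?_
  · rintro _ ⟨J, ⟨hJ, -⟩, rfl⟩
    exact Submodule.map_mono (fun x hx => hJ x hx)
  · rintro J ⟨-, hJ⟩ K ⟨-, hK⟩ h
    have h1 : J.map A.mkQ = K.map A.mkQ := SetLike.coe_injective h
    have hA : ∀ J : Submodule ℤ V, (∀ x ∈ I, n • x ∈ J) → A ≤ J := by
      rintro J hJ _ ⟨x, hx, rfl⟩
      exact hJ x hx
    have h2 := congrArg (Submodule.comap A.mkQ) h1
    rwa [Submodule.comap_map_mkQ, Submodule.comap_map_mkQ, sup_eq_right.2 (hA J hJ),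
      sup_eq_right.2 (hA K hK)] at h2

end Lattice

section QuatNorm

variable {F : Type*} [Field F] [NumberField F] {c₁ c₂ : F}

omit [NumberField F] in
theorem quatNrd_mul (x y : ℍ[F, c₁, c₂]) : quatNrd (x * y) = quatNrd x * quatNrd y := by
  simp only [quatNrd, QuaternionAlgebra.re_mul, QuaternionAlgebra.imI_mul,
    QuaternionAlgebra.imJ_mul, QuaternionAlgebra.imK_mul]
  ring

omit [NumberField F] in
theorem quatNrd_algebraMap (a : F) : quatNrd (algebraMap F ℍ[F, c₁, c₂] a) = a ^ 2 := by
  simp [quatNrd, QuaternionAlgebra.algebraMap_eq, sq]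

omit [NumberField F] in
theorem quatNrd_one : quatNrd (1 : ℍ[F, c₁, c₂]) = 1 := by simp [quatNrd]

omit [NumberField F] in
theorem quatNrd_zero : quatNrd (0 : ℍ[F, c₁, c₂]) = 0 := by simp [quatNrd]

omit [NumberField F] in
theorem quatNrd_smul (a : F) (x : ℍ[F, c₁, c₂]) : quatNrd (a • x) = a ^ 2 * quatNrd x := by
  rw [Algebra.smul_def, quatNrd_mul, quatNrd_algebraMap]

omit [NumberField F] in
theorem zsmul_eq_smul_quat (n : ℤ) (x : ℍ[F, c₁, c₂]) : n • x = (n : F) • x :=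
  (Int.cast_smul_eq_zsmul F n x).symm

omit [NumberField F] in
theorem quatNrd_zsmul (n : ℤ) (x : ℍ[F, c₁, c₂]) : quatNrd (n • x) = (n : F) ^ 2 * quatNrd x := by
  rw [zsmul_eq_smul_quat, quatNrd_smul]

omit [NumberField F] in
theorem quatNrd_pow (x : ℍ[F, c₁, c₂]) (n : ℕ) : quatNrd (x ^ n) = quatNrd x ^ n := by
  induction n with
  | zero => simp [quatNrd_one]
  | succ n ih => rw [pow_succ, quatNrd_mul, ih, pow_succ]

omit [NumberField F] in
theorem mul_star_quat (x : ℍ[F, c₁, c₂]) : x * star x = algebraMap F _ (quatNrd x) := by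
  ext <;> simp [quatNrd, QuaternionAlgebra.algebraMap_eq] <;> ring

omit [NumberField F] in
theorem star_mul_quat (x : ℍ[F, c₁, c₂]) : star x * x = algebraMap F _ (quatNrd x) := by
  ext <;> simp [quatNrd, QuaternionAlgebra.algebraMap_eq] <;> ring

theorem exists_realEmbedding (hF : TotReal F) : Nonempty (F →+* ℝ) := by
  obtain ⟨φ⟩ := (inferInstance : Nonempty (F →+* ℂ))
  exact ⟨(hF φ).embedding⟩

omit [NumberField F] in
theorem quatNrd_pos (hdef : TotallyDefinite c₁ c₂) {x : ℍ[F, c₁, c₂]} (hx : x ≠ 0)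
    (σ : F →+* ℝ) : 0 < σ (quatNrd x) := by
  obtain ⟨h1, h2⟩ := hdef σ
  have h3 : 0 < σ c₁ * σ c₂ := mul_pos_of_neg_of_neg h1 h2
  simp only [quatNrd, map_add, map_sub, map_mul]
  have hsq : ∀ a : F, 0 ≤ σ a ^ 2 := fun a => sq_nonneg _
  have hre := hsq x.re
  have hi := mul_nonneg (neg_nonneg.2 h1.le) (hsq x.imI)
  have hj := mul_nonneg (neg_nonneg.2 h2.le) (hsq x.imJ)
  have hk := mul_nonneg h3.le (hsq x.imK)
  refine lt_of_le_of_ne (by nlinarith) fun h0 => hx ?_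
  have e1 : σ x.re ^ 2 = 0 := by nlinarith
  have e2 : -σ c₁ * σ x.imI ^ 2 = 0 := by nlinarith
  have e3 : -σ c₂ * σ x.imJ ^ 2 = 0 := by nlinarith
  have e4 : σ c₁ * σ c₂ * σ x.imK ^ 2 = 0 := by nlinarith
  ext
  · simpa using e1
  · simpa [h1.ne] using e2
  · simpa [h2.ne] using e3
  · simpa [h1.ne, h2.ne] using e4

theorem quatNrd_ne_zero (hF : TotReal F) (hdef : TotallyDefinite c₁ c₂) {x : ℍ[F, c₁, c₂]}
    (hx : x ≠ 0) : quatNrd x ≠ 0 := fun h => by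
  obtain ⟨σ⟩ := exists_realEmbedding hF
  have := quatNrd_pos hdef hx σ
  simp [h] at this

omit [NumberField F] in
/-- The unit attached to a quaternion of nonzero norm. -/
def quatUnit (x : ℍ[F, c₁, c₂]) (hx : quatNrd x ≠ 0) : ℍ[F, c₁, c₂]ˣ where
  val := x
  inv := (quatNrd x)⁻¹ • star x
  val_inv := by
    rw [mul_smul_comm, mul_star_quat, Algebra.algebraMap_eq_smul_one, smul_smul,
      inv_mul_cancel₀ hx, one_smul]
  inv_val := by
    rw [smul_mul_assoc, star_mul_quat, Algebra.algebraMap_eq_smul_one, smul_smul,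
      inv_mul_cancel₀ hx, one_smul]

omit [NumberField F] in
theorem quatNrd_unit_ne_zero (u : ℍ[F, c₁, c₂]ˣ) : quatNrd (u : ℍ[F, c₁, c₂]) ≠ 0 := fun h => by
  have := quatNrd_mul (u : ℍ[F, c₁, c₂]) ↑u⁻¹
  rw [Units.mul_inv, quatNrd_one, h, zero_mul] at this
  exact one_ne_zero this

omit [NumberField F] in
theorem quatNrd_inv (u : ℍ[F, c₁, c₂]ˣ) :
    quatNrd (↑u⁻¹ : ℍ[F, c₁, c₂]) = (quatNrd (u : ℍ[F, c₁, c₂]))⁻¹ := by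
  have := quatNrd_mul (u : ℍ[F, c₁, c₂]) ↑u⁻¹
  rw [Units.mul_inv, quatNrd_one] at this
  exact eq_inv_of_mul_eq_one_right this.symm

theorem exists_int_mul_isIntegral (x : F) : ∃ N : ℤ, N ≠ 0 ∧ IsIntegral ℤ ((N : F) * x) := by
  have : IsAlgebraic ℤ x := (IsFractionRing.isAlgebraic_iff ℤ ℚ F).2 (Algebra.IsAlgebraic.isAlgebraic x)
  obtain ⟨N, hN, h⟩ := this.exists_integral_multiple
  exact ⟨N, hN, by rwa [← zsmul_eq_mul]⟩

omit [NumberField F] in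
theorem intCast_isIntegral (n : ℤ) : IsIntegral ℤ (n : F) := isIntegral_intCast n

omit [NumberField F] in
theorem isIntegral_of_eq {x y : F} (h : IsIntegral ℤ x) (e : y = x) : IsIntegral ℤ y := e ▸ h

/-- The lattice of quaternions with integral coordinates. -/
def coordLattice (c₁ c₂ : F) : Submodule ℤ ℍ[F, c₁, c₂] where
  carrier := {x | IsIntegral ℤ x.re ∧ IsIntegral ℤ x.imI ∧ IsIntegral ℤ x.imJ ∧ IsIntegral ℤ x.imK}
  zero_mem' := ⟨isIntegral_zero, isIntegral_zero, isIntegral_zero, isIntegral_zero⟩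
  add_mem' := fun ⟨h1, h2, h3, h4⟩ ⟨g1, g2, g3, g4⟩ =>
    ⟨h1.add g1, h2.add g2, h3.add g3, h4.add g4⟩
  smul_mem' := fun c _ ⟨h1, h2, h3, h4⟩ => ⟨h1.smul c, h2.smul c, h3.smul c, h4.smul c⟩

theorem isFull_coordLattice : IsFull (coordLattice c₁ c₂) := fun x => by
  obtain ⟨a, ha, h1⟩ := exists_int_mul_isIntegral x.re
  obtain ⟨b, hb, h2⟩ := exists_int_mul_isIntegral x.imI
  obtain ⟨c, hc, h3⟩ := exists_int_mul_isIntegral x.imJ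
  obtain ⟨d, hd, h4⟩ := exists_int_mul_isIntegral x.imK
  refine ⟨a * b * c * d, by positivity, ?_, ?_, ?_, ?_⟩
  · have := (intCast_isIntegral (F := F) (b * c * d)).mul h1
    refine isIntegral_of_eq this ?_
    rw [zsmul_eq_smul_quat, QuaternionAlgebra.re_smul, smul_eq_mul]
    push_cast
    ring
  · have := (intCast_isIntegral (F := F) (a * c * d)).mul h2
    refine isIntegral_of_eq this ?_
    rw [zsmul_eq_smul_quat, QuaternionAlgebra.imI_smul, smul_eq_mul]
    push_cast
    ring
  · have := (intCast_isIntegral (F := F) (a * b * d)).mul h3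
    refine isIntegral_of_eq this ?_
    rw [zsmul_eq_smul_quat, QuaternionAlgebra.imJ_smul, smul_eq_mul]
    push_cast
    ring
  · have := (intCast_isIntegral (F := F) (a * b * c)).mul h4
    refine isIntegral_of_eq this ?_
    rw [zsmul_eq_smul_quat, QuaternionAlgebra.imK_smul, smul_eq_mul]
    push_cast
    ring

/-- Norms from a finitely generated lattice have bounded denominators. -/
theorem exists_int_mul_quatNrd_isIntegral {I : Submodule ℤ ℍ[F, c₁, c₂]} (hI : I.FG) :
    ∃ N : ℤ, N ≠ 0 ∧ ∀ x ∈ I, IsIntegral ℤ ((N : F) * quatNrd x) := by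
  obtain ⟨m, hm, h⟩ := (isFull_coordLattice (c₁ := c₁) (c₂ := c₂)).exists_smul_le hI
  obtain ⟨a, ha, h1⟩ := exists_int_mul_isIntegral c₁
  obtain ⟨b, hb, h2⟩ := exists_int_mul_isIntegral c₂
  refine ⟨m ^ 2 * a * b, by positivity, fun x hx => ?_⟩
  obtain ⟨g1, g2, g3, g4⟩ := h x hx
  simp only [zsmul_eq_smul_quat, QuaternionAlgebra.re_smul, QuaternionAlgebra.imI_smul,
    QuaternionAlgebra.imJ_smul, QuaternionAlgebra.imK_smul, smul_eq_mul] at g1 g2 g3 g4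
  have ia := intCast_isIntegral (F := F) a
  have ib := intCast_isIntegral (F := F) b
  refine isIntegral_of_eq (((((ia.mul ib).mul (g1.mul g1)).sub ((h1.mul ib).mul (g2.mul g2))).sub
    ((ia.mul h2).mul (g3.mul g3))).add ((h1.mul h2).mul (g4.mul g4))) ?_
  rw [quatNrd]
  push_cast
  ring

theorem quatNrd_isIntegral_of_mem {O : Subalgebra ℤ ℍ[F, c₁, c₂]}
    (hO : (Subalgebra.toSubmodule O).FG) {x : ℍ[F, c₁, c₂]} (hx : x ∈ O) :
    IsIntegral ℤ (quatNrd x) := by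
  obtain ⟨N, hN, h⟩ := exists_int_mul_quatNrd_isIntegral hO
  have h1 : IsAlmostIntegral (NumberField.RingOfIntegers F) (quatNrd x) := by
    refine ⟨(N : NumberField.RingOfIntegers F),
      mem_nonZeroDivisors_of_ne_zero (Int.cast_ne_zero.2 hN), fun n => ?_⟩
    refine ⟨⟨(N : F) * quatNrd x ^ n, ?_⟩, ?_⟩
    · rw [← quatNrd_pow]
      exact h _ (O.pow_mem hx n)
    · rw [Algebra.smul_def]
      simp
  exact isIntegral_trans _ h1.isIntegral

theorem quatNrd_mem_locAt {O : Subalgebra ℤ ℍ[F, c₁, c₂]}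
    (hO : (Subalgebra.toSubmodule O).FG) {p : ℕ} (hp : p.Prime) {x : ℍ[F, c₁, c₂]}
    (hx : x ∈ locAt p (O : Set ℍ[F, c₁, c₂])) :
    quatNrd x ∈ locAt p (integralClosure ℤ F : Set F) := by
  obtain ⟨n, hn, hx⟩ := hx
  refine ⟨n * n, not_dvd_mul_int hp hn hn, ?_⟩
  have := quatNrd_isIntegral_of_mem hO hx
  rw [quatNrd_zsmul] at this
  rw [zsmul_eq_mul]
  push_cast
  rwa [← sq]

end QuatNorm

section QuatIdeals

variable {F : Type*} [Field F] [NumberField F] {c₁ c₂ : F}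

omit [NumberField F] in
theorem mem_lmul {g : ℍ[F, c₁, c₂]ˣ} {I : Submodule ℤ ℍ[F, c₁, c₂]} {x : ℍ[F, c₁, c₂]} :
    x ∈ lmul g I ↔ (↑g⁻¹ : ℍ[F, c₁, c₂]) * x ∈ I := by
  constructor
  · rintro ⟨y, hy, rfl⟩
    simpa using hy
  · intro h
    exact ⟨_, h, by simp⟩

omit [NumberField F] in
theorem lmul_lmul (g h : ℍ[F, c₁, c₂]ˣ) (I : Submodule ℤ ℍ[F, c₁, c₂]) :
    lmul g (lmul h I) = lmul (g * h) I := by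
  ext x
  simp only [mem_lmul, mul_inv_rev, Units.val_mul, mul_assoc]

omit [NumberField F] in
theorem lmul_one (I : Submodule ℤ ℍ[F, c₁, c₂]) : lmul 1 I = I := by
  ext x
  simp [mem_lmul]

omit [NumberField F] in
theorem mem_locAt_lmul {p : ℕ} {g : ℍ[F, c₁, c₂]ˣ} {I : Submodule ℤ ℍ[F, c₁, c₂]}
    {x : ℍ[F, c₁, c₂]} : x ∈ locAt p (lmul g I : Set ℍ[F, c₁, c₂]) ↔
      (↑g⁻¹ : ℍ[F, c₁, c₂]) * x ∈ locAt p (I : Set ℍ[F, c₁, c₂]) := by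
  have : ∀ n : ℤ, (n • x ∈ lmul g I ↔ n • ((↑g⁻¹ : ℍ[F, c₁, c₂]) * x) ∈ I) := fun n => by
    rw [mem_lmul, mul_smul_comm]
  exact exists_congr fun n => and_congr_right fun _ => this n

omit [NumberField F] in
theorem locAt_lmul_congr {p : ℕ} (g : ℍ[F, c₁, c₂]ˣ) {I J : Submodule ℤ ℍ[F, c₁, c₂]}
    (h : locAt p (I : Set ℍ[F, c₁, c₂]) = locAt p (J : Set ℍ[F, c₁, c₂])) :
    locAt p (lmul g I : Set ℍ[F, c₁, c₂]) = locAt p (lmul g J : Set ℍ[F, c₁, c₂]) := by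
  ext x
  rw [mem_locAt_lmul, mem_locAt_lmul, h]

omit [NumberField F] in
theorem isFull_lmul (g : ℍ[F, c₁, c₂]ˣ) {I : Submodule ℤ ℍ[F, c₁, c₂]} (h : IsFull I) :
    IsFull (lmul g I) := fun x => by
  obtain ⟨N, hN, hx⟩ := h ((↑g⁻¹ : ℍ[F, c₁, c₂]) * x)
  exact ⟨N, hN, by rwa [mem_lmul, mul_smul_comm]⟩

omit [NumberField F] in
theorem lmul_glue {p : ℕ} (hp : p.Prime) (g : ℍ[F, c₁, c₂]ˣ) (M I : Submodule ℤ ℍ[F, c₁, c₂]) :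
    lmul g (glue p hp M I) = glue p hp (lmul g M) (lmul g I) := by
  ext x
  simp only [mem_lmul, mem_glue, mem_locAt_lmul, mul_smul_comm]

variable {O : Subalgebra ℤ ℍ[F, c₁, c₂]}

theorem isLocPrincRightIdeal_iff {I : Submodule ℤ ℍ[F, c₁, c₂]} :
    IsLocPrincRightIdeal O I ↔ I.FG ∧ IsFull I ∧ (∀ x ∈ I, ∀ r ∈ O, x * r ∈ I) ∧
      ∀ p : ℕ, p.Prime → ∃ lam : ℍ[F, c₁, c₂]ˣ, locAt p (I : Set ℍ[F, c₁, c₂]) =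
        locAt p (lmul lam (Subalgebra.toSubmodule O) : Set ℍ[F, c₁, c₂]) := by
  rw [IsLocPrincRightIdeal, span_rat_eq_top_iff]
  rfl

namespace LPIdeals

instance : SMul ℍ[F, c₁, c₂]ˣ (LPIdeals O) where
  smul g I := ⟨lmul g I.1, by
    obtain ⟨h1, h2, h3, h4⟩ := isLocPrincRightIdeal_iff.1 I.2
    refine isLocPrincRightIdeal_iff.2 ⟨h1.map _, isFull_lmul g h2, ?_, ?_⟩
    · rintro x hx r hr
      rw [mem_lmul] at hx ⊢
      rw [← mul_assoc]
      exact h3 _ hx r hr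
    · intro p hp
      obtain ⟨lam, h⟩ := h4 p hp
      refine ⟨g * lam, ?_⟩
      rw [← lmul_lmul]
      exact locAt_lmul_congr g h⟩

theorem coe_smul (g : ℍ[F, c₁, c₂]ˣ) (I : LPIdeals O) : (g • I).1 = lmul g I.1 := rfl

instance : MulAction ℍ[F, c₁, c₂]ˣ (LPIdeals O) where
  one_smul I := Subtype.ext (lmul_one I.1)
  mul_smul g h I := Subtype.ext (lmul_lmul g h I.1).symm

theorem fg (I : LPIdeals O) : I.1.FG := I.2.1

theorem isFull (I : LPIdeals O) : IsFull I.1 := (isLocPrincRightIdeal_iff.1 I.2).2.1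

theorem mul_mem (I : LPIdeals O) {x r : ℍ[F, c₁, c₂]} (hx : x ∈ I.1) (hr : r ∈ O) :
    x * r ∈ I.1 := I.2.2.2.1 x hx r hr

/-- The localization of a lattice at `p`. -/
def loc (p : ℕ) (I : LPIdeals O) : Set ℍ[F, c₁, c₂] := locAt p (I.1 : Set ℍ[F, c₁, c₂])

theorem mem_loc_smul {p : ℕ} {g : ℍ[F, c₁, c₂]ˣ} {I : LPIdeals O} {x : ℍ[F, c₁, c₂]} :
    x ∈ loc p (g • I) ↔ (↑g⁻¹ : ℍ[F, c₁, c₂]) * x ∈ loc p I := mem_locAt_lmul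

theorem loc_smul_congr {p : ℕ} (g : ℍ[F, c₁, c₂]ˣ) {I J : LPIdeals O} (h : loc p I = loc p J) :
    loc p (g • I) = loc p (g • J) := locAt_lmul_congr g h

theorem ext_loc {I J : LPIdeals O} (h : ∀ p : ℕ, p.Prime → loc p I = loc p J) : I = J :=
  Subtype.ext (eq_of_forall_locAt_eq h)

/-- The ideal `O` itself. -/
def self (hO : IsZOrder O) : LPIdeals O :=
  ⟨Subalgebra.toSubmodule O, isLocPrincRightIdeal_iff.2 ⟨hO.1, span_rat_eq_top_iff.1 hO.2,
    fun _ hx _ hr => O.mul_mem hx hr, fun p _ => ⟨1, by rw [lmul_one]⟩⟩⟩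

theorem exists_loc_eq (hO : IsZOrder O) (I : LPIdeals O) {p : ℕ} (hp : p.Prime) :
    ∃ g : ℍ[F, c₁, c₂]ˣ, loc p I = loc p (g • self hO) := I.2.2.2.2 p hp

/-- The ideal which agrees with `M` at `p` and with `I` elsewhere. -/
def glue {p : ℕ} (hp : p.Prime) (M I : LPIdeals O) : LPIdeals O :=
  ⟨_root_.glue p hp M.1 I.1, by
    refine isLocPrincRightIdeal_iff.2 ⟨fg_glue hp I.isFull I.fg M.fg,
      isFull_glue hp M.isFull I.isFull, ?_, ?_⟩
    · rintro x ⟨⟨n, hn, hx⟩, j, hj⟩ r hr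
      refine ⟨⟨n, hn, ?_⟩, j, ?_⟩
      · rw [← smul_mul_assoc]
        exact M.mul_mem hx hr
      · rw [← smul_mul_assoc]
        exact I.mul_mem hj hr
    · intro q hq
      rcases eq_or_ne q p with rfl | hqp
      · obtain ⟨g, hg⟩ := (isLocPrincRightIdeal_iff.1 M.2).2.2.2 q hq
        exact ⟨g, (locAt_glue_self hp I.isFull).trans hg⟩
      · obtain ⟨g, hg⟩ := (isLocPrincRightIdeal_iff.1 I.2).2.2.2 q hq
        exact ⟨g, (locAt_glue_of_ne hp M.isFull hq hqp).trans hg⟩⟩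

variable {p : ℕ} (hp : p.Prime)

theorem loc_glue_self (M I : LPIdeals O) : loc p (glue hp M I) = loc p M :=
  locAt_glue_self hp I.isFull

theorem loc_glue_of_ne (M I : LPIdeals O) {q : ℕ} (hq : q.Prime) (hqp : q ≠ p) :
    loc q (glue hp M I) = loc q I :=
  locAt_glue_of_ne hp M.isFull hq hqp

theorem smul_glue (g : ℍ[F, c₁, c₂]ˣ) (M I : LPIdeals O) :
    g • glue hp M I = glue hp (g • M) (g • I) := Subtype.ext (lmul_glue hp g M.1 I.1)

theorem eq_glue_iff {J M I : LPIdeals O} : J = glue hp M I ↔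
    loc p J = loc p M ∧ ∀ q : ℕ, q.Prime → q ≠ p → loc q J = loc q I := by
  constructor
  · rintro rfl
    exact ⟨loc_glue_self hp M I, fun q hq => loc_glue_of_ne hp M I hq⟩
  · rintro ⟨h1, h2⟩
    refine ext_loc fun q hq => ?_
    rcases eq_or_ne q p with rfl | hqp
    · rw [loc_glue_self, h1]
    · rw [loc_glue_of_ne hp M I hq hqp, h2 q hq hqp]

/-- Left multiplication of an ideal by `k` at the single prime `p`. -/
def twist (k : ℍ[F, c₁, c₂]ˣ) (I : LPIdeals O) : LPIdeals O := glue hp (k • I) I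

theorem loc_twist_self (k : ℍ[F, c₁, c₂]ˣ) (I : LPIdeals O) :
    loc p (twist hp k I) = loc p (k • I) := loc_glue_self hp _ _

theorem loc_twist_of_ne (k : ℍ[F, c₁, c₂]ˣ) (I : LPIdeals O) {q : ℕ} (hq : q.Prime)
    (hqp : q ≠ p) : loc q (twist hp k I) = loc q I := loc_glue_of_ne hp _ _ hq hqp

theorem smul_twist (g k : ℍ[F, c₁, c₂]ˣ) (I : LPIdeals O) :
    g • twist hp k I = twist hp (g * k * g⁻¹) (g • I) := by
  rw [twist, smul_glue, twist, ← mul_smul, ← mul_smul, inv_mul_cancel_right]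

theorem twist_twist (k l : ℍ[F, c₁, c₂]ˣ) (I : LPIdeals O) :
    twist hp k (twist hp l I) = twist hp (k * l) I := by
  rw [twist, eq_comm, eq_glue_iff]
  refine ⟨?_, fun q hq hqp => ?_⟩
  · rw [loc_twist_self, mul_smul]
    exact loc_smul_congr k (loc_twist_self hp l I).symm
  · rw [loc_twist_of_ne hp _ _ hq hqp, loc_twist_of_ne hp _ _ hq hqp]

theorem twist_one (I : LPIdeals O) : twist hp 1 I = I := by
  rw [twist, eq_comm, eq_glue_iff, one_smul]
  exact ⟨rfl, fun _ _ _ => rfl⟩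

end LPIdeals

theorem hCl_eq_card_orbits (O : Subalgebra ℤ ℍ[F, c₁, c₂]) :
    hCl O = Nat.card (MulAction.orbitRel.Quotient ℍ[F, c₁, c₂]ˣ (LPIdeals O)) := by
  refine Nat.card_congr (Quot.congr (Equiv.refl _) fun I J => ?_)
  simp only [Equiv.refl_apply]
  constructor
  · rintro ⟨g, h⟩
    exact ⟨g, Subtype.ext h.symm⟩
  · rintro ⟨g, h⟩
    exact ⟨g, (congrArg Subtype.val h).symm⟩

end QuatIdeals

section QuatClass

open scoped nonZeroDivisors NumberField

variable {F : Type*} [Field F] [NumberField F] {c₁ c₂ : F} {O : Subalgebra ℤ ℍ[F, c₁, c₂]}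

theorem mul_mem_locAt {V : Type*} [Ring V] {S : Subalgebra ℤ V} {p : ℕ} (hp : p.Prime) {x y : V}
    (hx : x ∈ locAt p (S : Set V)) (hy : y ∈ locAt p (S : Set V)) :
    x * y ∈ locAt p (S : Set V) := by
  obtain ⟨n, hn, hx⟩ := hx
  obtain ⟨m, hm, hy⟩ := hy
  exact ⟨n * m, not_dvd_mul_int hp hn hm, by
    rw [← smul_mul_smul_comm]
    exact S.mul_mem hx hy⟩

/-- The reduced norm of a lattice. -/
def nrIdeal (I : LPIdeals O) : FractionalIdeal (𝓞 F)⁰ F :=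
  ⟨Submodule.span (𝓞 F) (quatNrd '' (I.1 : Set ℍ[F, c₁, c₂])), by
    obtain ⟨N, hN, h⟩ := exists_int_mul_quatNrd_isIntegral I.fg
    refine FractionalIdeal.isFractional_span_iff.2 ⟨(N : 𝓞 F),
      mem_nonZeroDivisors_of_ne_zero (Int.cast_ne_zero.2 hN), ?_⟩
    rintro _ ⟨x, hx, rfl⟩
    refine ⟨⟨(N : F) * quatNrd x, h x hx⟩, ?_⟩
    rw [Algebra.smul_def, map_intCast]
    rfl⟩

theorem coe_nrIdeal (I : LPIdeals O) : (nrIdeal I : Submodule (𝓞 F) F) =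
    Submodule.span (𝓞 F) (quatNrd '' (I.1 : Set ℍ[F, c₁, c₂])) := rfl

theorem quatNrd_mem_nrIdeal {I : LPIdeals O} {x : ℍ[F, c₁, c₂]} (hx : x ∈ I.1) :
    quatNrd x ∈ (nrIdeal I : Submodule (𝓞 F) F) := Submodule.subset_span ⟨x, hx, rfl⟩

theorem nrIdeal_ne_zero (I : LPIdeals O) : nrIdeal I ≠ 0 := fun h => by
  obtain ⟨N, hN, hx⟩ := I.isFull 1
  have h1 := quatNrd_mem_nrIdeal hx
  rw [h, FractionalIdeal.coe_zero, Submodule.mem_bot, quatNrd_zsmul, quatNrd_one, mul_one] at h1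
  exact hN (by simpa using h1)

/-- The ideal class of the reduced norm of a lattice. -/
def nrClass (I : LPIdeals O) : ClassGroup (𝓞 F) :=
  ClassGroup.mk F (Units.mk0 (nrIdeal I) (nrIdeal_ne_zero I))

theorem nrIdeal_smul (g : ℍ[F, c₁, c₂]ˣ) (I : LPIdeals O) :
    nrIdeal (g • I) = FractionalIdeal.spanSingleton (𝓞 F)⁰ (quatNrd (g : ℍ[F, c₁, c₂])) *
      nrIdeal I := by
  apply FractionalIdeal.coeToSubmodule_injective
  change (nrIdeal (g • I) : Submodule (𝓞 F) F) = ((_ * _ : FractionalIdeal (𝓞 F)⁰ F) :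
    Submodule (𝓞 F) F)
  rw [FractionalIdeal.coe_mul, FractionalIdeal.coe_spanSingleton, coe_nrIdeal, coe_nrIdeal,
    Submodule.span_mul_span]
  congr 1
  ext x
  rw [Set.singleton_mul, Set.image_image]
  constructor
  · rintro ⟨_, ⟨y, hy, rfl⟩, rfl⟩
    exact ⟨y, hy, (quatNrd_mul _ _).symm⟩
  · rintro ⟨y, hy, rfl⟩
    exact ⟨_, ⟨y, hy, rfl⟩, quatNrd_mul _ _⟩

theorem nrClass_smul (g : ℍ[F, c₁, c₂]ˣ) (I : LPIdeals O) : nrClass (g • I) = nrClass I := by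
  have h : Units.mk0 (nrIdeal (g • I)) (nrIdeal_ne_zero _) =
      toPrincipalIdeal (𝓞 F) F (Units.mk0 _ (quatNrd_unit_ne_zero g)) *
        Units.mk0 (nrIdeal I) (nrIdeal_ne_zero I) := by
    apply Units.ext
    rw [Units.val_mul, coe_toPrincipalIdeal]
    exact nrIdeal_smul g I
  rw [nrClass, h, map_mul, nrClass, mul_eq_right, ClassGroup.mk_eq_one_iff, coe_toPrincipalIdeal,
    FractionalIdeal.coe_spanSingleton]
  exact ⟨⟨_, rfl⟩⟩

theorem mem_loc_iff_of_loc_eq (hO : IsZOrder O) {p : ℕ} {I : LPIdeals O} {g : ℍ[F, c₁, c₂]ˣ}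
    (h : I.loc p = (g • LPIdeals.self hO).loc p) {x : ℍ[F, c₁, c₂]} :
    x ∈ I.loc p ↔ (↑g⁻¹ : ℍ[F, c₁, c₂]) * x ∈ locAt p (O : Set ℍ[F, c₁, c₂]) := by
  rw [h, LPIdeals.mem_loc_smul]
  rfl

omit [NumberField F] in
theorem mul_mem_of_isIntegral {M : Submodule (𝓞 F) F} {a x : F} (ha : IsIntegral ℤ a)
    (hx : x ∈ M) : a * x ∈ M := M.smul_mem (⟨a, ha⟩ : 𝓞 F) hx

theorem mem_locAt_nrIdeal (hO : IsZOrder O) {p : ℕ} (hp : p.Prime) {I : LPIdeals O} {g : ℍ[F, c₁, c₂]ˣ}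
    (h : I.loc p = (g • LPIdeals.self hO).loc p) {x : F} :
    x ∈ locAt p ((nrIdeal I : Submodule (𝓞 F) F) : Set F) ↔
      (quatNrd (g : ℍ[F, c₁, c₂]))⁻¹ * x ∈ locAt p (integralClosure ℤ F : Set F) := by
  have hg := quatNrd_unit_ne_zero g
  constructor
  · have key : ∀ y ∈ (nrIdeal I : Submodule (𝓞 F) F),
        (quatNrd (g : ℍ[F, c₁, c₂]))⁻¹ * y ∈ locAt p (integralClosure ℤ F : Set F) := by
      intro y hy
      rw [coe_nrIdeal] at hy
      induction hy using Submodule.span_induction with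
      | mem y hy =>
        obtain ⟨z, hz, rfl⟩ := hy
        have h1 := (mem_loc_iff_of_loc_eq hO h).1 (mem_locAt_of_mem hp hz)
        have h2 := quatNrd_mem_locAt hO.1 hp h1
        rwa [quatNrd_mul, quatNrd_inv] at h2
      | zero =>
        rw [mul_zero]
        exact mem_locAt_of_mem hp (zero_mem _)
      | add y z _ _ hy hz =>
        rw [mul_add]
        exact (locMod p hp (Subalgebra.toSubmodule (integralClosure ℤ F))).add_mem hy hz
      | smul a y _ hy =>
        rw [mul_smul_comm]
        exact mul_mem_locAt hp (mem_locAt_of_mem hp a.2) hy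
    rintro ⟨n, hn, hx⟩
    obtain ⟨m, hm, h1⟩ := key _ hx
    refine ⟨m * n, not_dvd_mul_int hp hm hn, ?_⟩
    rw [mul_smul_comm, ← mul_smul] at h1
    exact h1
  · rintro ⟨m, hm, hx⟩
    have h1 : (g : ℍ[F, c₁, c₂]) ∈ I.loc p := by
      rw [mem_loc_iff_of_loc_eq hO h, Units.inv_mul]
      exact mem_locAt_of_mem hp O.one_mem
    obtain ⟨n, hn, h2⟩ := h1
    refine ⟨n * n * m, not_dvd_mul_int hp (not_dvd_mul_int hp hn hn) hm, ?_⟩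
    have h3 := mul_mem_of_isIntegral hx (quatNrd_mem_nrIdeal h2)
    rw [quatNrd_zsmul] at h3
    convert h3 using 1
    rw [zsmul_eq_mul, zsmul_eq_mul]
    push_cast
    field_simp
    rfl

theorem locAt_nrIdeal_congr (hO : IsZOrder O) {p : ℕ} (hp : p.Prime) {I J : LPIdeals O} (h : I.loc p = J.loc p) :
    locAt p ((nrIdeal I : Submodule (𝓞 F) F) : Set F) =
      locAt p ((nrIdeal J : Submodule (𝓞 F) F) : Set F) := by
  obtain ⟨g, hg⟩ := LPIdeals.exists_loc_eq hO J hp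
  ext x
  rw [mem_locAt_nrIdeal hO hp (h.trans hg), mem_locAt_nrIdeal hO hp hg]

theorem exists_int_mem_of_isCoprime {p : ℕ} (hp : p.Prime) {m : Ideal (𝓞 F)} (hm : m ≠ ⊥)
    (h : IsCoprime m (Ideal.span {(p : 𝓞 F)})) : ∃ t : ℤ, ¬ (p : ℤ) ∣ t ∧ (t : 𝓞 F) ∈ m := by
  have h0 : (Ideal.absNorm m : ℤ) ≠ 0 := by
    simpa [Ideal.absNorm_eq_zero_iff] using hm
  obtain ⟨j, t, ht, hjt⟩ := exists_pow_mul_not_dvd hp h0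
  refine ⟨t, ht, ?_⟩
  have h1 : IsCoprime m (Ideal.span {(p : 𝓞 F)} ^ j) := h.pow_right
  rw [Ideal.span_singleton_pow, Ideal.isCoprime_iff_exists] at h1
  obtain ⟨a, ha, b, hb, hab⟩ := h1
  obtain ⟨s, rfl⟩ := Ideal.mem_span_singleton.1 hb
  have h2 : (t : 𝓞 F) = t * a + s * ((Ideal.absNorm m : ℕ) : 𝓞 F) := by
    have : ((Ideal.absNorm m : ℕ) : 𝓞 F) = (p : 𝓞 F) ^ j * t := by
      have := congrArg (Int.cast : ℤ → 𝓞 F) hjt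
      push_cast at this
      exact this
    rw [this]
    linear_combination -(t : 𝓞 F) * hab
  rw [h2]
  exact m.add_mem (m.mul_mem_left _ ha) (m.mul_mem_left _ (Ideal.absNorm_mem m))

omit [NumberField F] in
theorem eq_of_forall_locAt_eq_of_ringOfIntegers {A B : Submodule (𝓞 F) F}
    (h : ∀ q : ℕ, q.Prime → locAt q (A : Set F) = locAt q (B : Set F)) : A = B :=
  Submodule.restrictScalars_injective ℤ _ _
    (eq_of_forall_locAt_eq (I := A.restrictScalars ℤ) (J := B.restrictScalars ℤ) h)

section Ideal

variable {A : Submodule (𝓞 F) F} {𝔫 𝔪 : Ideal (𝓞 F)}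

omit [NumberField F] in
theorem mul_mem_coeSubmodule_mul {c : 𝓞 F} {x : F} (hc : c ∈ 𝔫) (hx : x ∈ A) :
    (c : F) * x ∈ IsLocalization.coeSubmodule F 𝔫 * A :=
  Submodule.mul_mem_mul ⟨c, hc, rfl⟩ hx

omit [NumberField F] in
theorem coeSubmodule_mul_induction {P : F → Prop} {y : F}
    (hy : y ∈ IsLocalization.coeSubmodule F 𝔫 * A)
    (hmul : ∀ c ∈ 𝔫, ∀ x ∈ A, P ((c : F) * x)) (hadd : ∀ x y, P x → P y → P (x + y)) : P y := by
  refine Submodule.mul_induction_on hy ?_ hadd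
  rintro _ ⟨c, hc, rfl⟩ x hx
  exact hmul c hc x hx

omit [NumberField F] in
theorem coeSubmodule_mul_le : IsLocalization.coeSubmodule F 𝔫 * A ≤ A := fun _ hy =>
  coeSubmodule_mul_induction (P := fun y => y ∈ A) hy
    (fun c _ _ hx => mul_mem_of_isIntegral c.2 hx) fun _ _ => A.add_mem

omit [NumberField F] in
theorem locAt_coeSubmodule_mul_of_ne {p q : ℕ} (hp : p.Prime) (hq : q.Prime) (hqp : q ≠ p)
    {k : ℕ} (hk : (p : 𝓞 F) ^ k ∈ 𝔫) :
    locAt q ((IsLocalization.coeSubmodule F 𝔫 * A : Submodule (𝓞 F) F) : Set F) =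
      locAt q (A : Set F) := by
  refine Set.Subset.antisymm (locAt_mono coeSubmodule_mul_le) ?_
  rintro x ⟨m, hm, hx⟩
  refine ⟨(p : ℤ) ^ k * m, not_dvd_mul_int hq (prime_not_dvd_pow hp hq hqp k) hm, ?_⟩
  rw [mul_smul, zsmul_eq_mul]
  have := mul_mem_coeSubmodule_mul hk hx
  simpa using this

omit [NumberField F] in
theorem mem_locAt_coeSubmodule_mul {p : ℕ} (hp : p.Prime) {γ : F} (hγ : γ ≠ 0)
    (hA : ∀ x, x ∈ locAt p (A : Set F) ↔ γ⁻¹ * x ∈ locAt p (integralClosure ℤ F : Set F))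
    {n : 𝓞 F} (hn : (n : F) ≠ 0) (hnm : Ideal.span {n} = 𝔫 * 𝔪)
    {t : ℤ} (ht : ¬ (p : ℤ) ∣ t) (htm : (t : 𝓞 F) ∈ 𝔪) (x : F) :
    x ∈ locAt p ((IsLocalization.coeSubmodule F 𝔫 * A : Submodule (𝓞 F) F) : Set F) ↔
      (n * γ)⁻¹ * x ∈ locAt p (integralClosure ℤ F : Set F) := by
  have hn𝔫 : n ∈ 𝔫 := Ideal.mul_le_left (hnm ▸ Ideal.mem_span_singleton_self n)
  constructor
  · rintro ⟨m, hm, hx⟩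
    suffices hs : ∀ y ∈ IsLocalization.coeSubmodule F 𝔫 * A, (n * γ)⁻¹ * y ∈
        locAt p (integralClosure ℤ F : Set F) by
      obtain ⟨m', hm', h1⟩ := hs _ hx
      refine ⟨m' * m, not_dvd_mul_int hp hm' hm, ?_⟩
      rw [mul_smul_comm, ← mul_smul] at h1
      exact h1
    intro y hy
    refine coeSubmodule_mul_induction
      (P := fun y => (n * γ)⁻¹ * y ∈ locAt p (integralClosure ℤ F : Set F)) hy ?_ ?_
    · intro c hc a ha
      have h1 : c * t ∈ Ideal.span {n} := hnm ▸ Ideal.mul_mem_mul hc htm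
      obtain ⟨s, hs⟩ := Ideal.mem_span_singleton.1 h1
      have hs' : (c : F) * t = n * s := by
        have := congrArg (algebraMap (𝓞 F) F) hs
        simpa using this
      have h2 := (hA a).1 (mem_locAt_of_mem hp ha)
      obtain ⟨m', hm', h3⟩ := mul_mem_locAt hp (mem_locAt_of_mem hp s.2) h2
      refine ⟨m' * t, not_dvd_mul_int hp hm' ht, ?_⟩
      have e : (m' * t) • ((n * γ)⁻¹ * (c * a)) = m' • ((s : F) * (γ⁻¹ * a)) := by
        rw [zsmul_eq_mul, zsmul_eq_mul]
        push_cast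
        field_simp
        linear_combination (m' : F) * a * hs'
      rw [e]
      exact h3
    · intro y z hy hz
      rw [mul_add]
      exact (locMod p hp (Subalgebra.toSubmodule (integralClosure ℤ F))).add_mem hy hz
  · intro hx
    have h1 : (n : F)⁻¹ * x ∈ locAt p (A : Set F) := by
      have e : γ⁻¹ * ((n : F)⁻¹ * x) = (n * γ)⁻¹ * x := by field_simp
      rw [hA, e]
      exact hx
    obtain ⟨m, hm, h2⟩ := h1
    refine ⟨m, hm, ?_⟩
    have e : m • x = n * (m • ((n : F)⁻¹ * x)) := by
      rw [zsmul_eq_mul, zsmul_eq_mul]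
      field_simp
    rw [e]
    exact mul_mem_coeSubmodule_mul hn𝔫 h2

end Ideal

theorem coe_nrIdeal_of_loc_eq (hO : IsZOrder O) {p : ℕ} (hp : p.Prime) {I J : LPIdeals O}
    {g h : ℍ[F, c₁, c₂]ˣ}
    (hI : I.loc p = (g • LPIdeals.self hO).loc p) (hJ : J.loc p = (h • LPIdeals.self hO).loc p)
    (hq : ∀ q : ℕ, q.Prime → q ≠ p → J.loc q = I.loc q) {n : 𝓞 F}
    (hn : quatNrd (h : ℍ[F, c₁, c₂]) = n * quatNrd (g : ℍ[F, c₁, c₂]))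
    {𝔫 𝔪 : Ideal (𝓞 F)} (hnm : Ideal.span {n} = 𝔫 * 𝔪)
    (hcop : IsCoprime 𝔪 (Ideal.span {(p : 𝓞 F)})) {k : ℕ} (hk : (p : 𝓞 F) ^ k ∈ 𝔫) :
    (nrIdeal J : Submodule (𝓞 F) F) =
      IsLocalization.coeSubmodule F 𝔫 * (nrIdeal I : Submodule (𝓞 F) F) := by
  have hg0 := quatNrd_unit_ne_zero g
  have hn0 : (n : F) ≠ 0 := fun h0 => quatNrd_unit_ne_zero h (by rw [hn, h0, zero_mul])
  have h𝔪0 : 𝔪 ≠ ⊥ := by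
    rintro rfl
    rw [Ideal.mul_bot, Ideal.span_singleton_eq_bot] at hnm
    exact hn0 (by simp [hnm])
  obtain ⟨t, ht, htm⟩ := exists_int_mem_of_isCoprime hp h𝔪0 hcop
  refine eq_of_forall_locAt_eq_of_ringOfIntegers fun q hq' => ?_
  rcases eq_or_ne q p with rfl | hqp
  · ext x
    rw [mem_locAt_nrIdeal hO hp hJ, hn, mem_locAt_coeSubmodule_mul hp hg0
      (fun _ => mem_locAt_nrIdeal hO hp hI) hn0 hnm ht htm]
  · rw [locAt_nrIdeal_congr hO hq' (hq q hq' hqp), locAt_coeSubmodule_mul_of_ne hp hq' hqp hk]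

/-- Changing a lattice at one prime by an element of norm `n` multiplies the norm class by the
class of the `p`-part of `n`. -/
theorem nrClass_of_loc_eq (hO : IsZOrder O) {p : ℕ} (hp : p.Prime) {I J : LPIdeals O}
    {g h : ℍ[F, c₁, c₂]ˣ}
    (hI : I.loc p = (g • LPIdeals.self hO).loc p) (hJ : J.loc p = (h • LPIdeals.self hO).loc p)
    (hq : ∀ q : ℕ, q.Prime → q ≠ p → J.loc q = I.loc q) {n : 𝓞 F}
    (hn : quatNrd (h : ℍ[F, c₁, c₂]) = n * quatNrd (g : ℍ[F, c₁, c₂]))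
    {𝔫 𝔪 : Ideal (𝓞 F)} (h𝔫 : 𝔫 ∈ (Ideal (𝓞 F))⁰) (hnm : Ideal.span {n} = 𝔫 * 𝔪)
    (hcop : IsCoprime 𝔪 (Ideal.span {(p : 𝓞 F)})) {k : ℕ} (hk : (p : 𝓞 F) ^ k ∈ 𝔫) :
    nrClass J = ClassGroup.mk0 ⟨𝔫, h𝔫⟩ * nrClass I := by
  have key : Units.mk0 (nrIdeal J) (nrIdeal_ne_zero J) = FractionalIdeal.mk0 F ⟨𝔫, h𝔫⟩ *
      Units.mk0 (nrIdeal I) (nrIdeal_ne_zero I) := by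
    apply Units.ext
    rw [Units.val_mul, FractionalIdeal.coe_mk0, Units.val_mk0, Units.val_mk0]
    have h1 := coe_nrIdeal_of_loc_eq hO hp hI hJ hq hn hnm hcop hk
    rw [← FractionalIdeal.coe_coeIdeal (S := (𝓞 F)⁰), ← FractionalIdeal.coe_mul] at h1
    exact FractionalIdeal.coeToSubmodule_injective h1
  rw [nrClass, nrClass, ← ClassGroup.mk_mk0 F, ← map_mul, key]

end QuatClass

section QuatFinite

open scoped nonZeroDivisors NumberField
open NumberField

variable {F : Type*} [Field F] [NumberField F] {c₁ c₂ : F} {O : Subalgebra ℤ ℍ[F, c₁, c₂]}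

theorem finite_of_mul_sq_le (hF : TotReal F) {c : F} (hc : ∀ σ : F →+* ℝ, 0 < σ c) (b : F) {m : ℤ}
    (hm : m ≠ 0) :
    {x : F | IsIntegral ℤ ((m : F) * x) ∧ ∀ σ : F →+* ℝ, σ c * σ x ^ 2 ≤ σ b}.Finite := by
  let B : ℝ := 1 + ∑ φ : F →+* ℂ, ‖φ ((m : F) ^ 2 * b / c)‖
  refine ((Embeddings.finite_of_norm_le F ℂ B).preimage
    (mul_right_injective₀ (Int.cast_ne_zero.2 hm : (m : F) ≠ 0)).injOn).subset ?_
  rintro x ⟨hx, h⟩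
  refine ⟨hx, fun φ => ?_⟩
  let σ := (hF φ).embedding
  have hσ : ∀ y, φ y = (σ y : ℂ) := fun y => ((hF φ).coe_embedding_apply y).symm
  have h1 : ‖φ ((m : F) ^ 2 * b / c)‖ ≤ ∑ φ : F →+* ℂ, ‖φ ((m : F) ^ 2 * b / c)‖ :=
    Finset.single_le_sum (f := fun φ : F →+* ℂ => ‖φ ((m : F) ^ 2 * b / c)‖)
      (fun _ _ => norm_nonneg _) (Finset.mem_univ φ)
  have h2 : ‖φ ((m : F) * x)‖ ^ 2 ≤ ‖φ ((m : F) ^ 2 * b / c)‖ := by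
    rw [hσ, hσ, Complex.norm_real, Complex.norm_real, Real.norm_eq_abs, Real.norm_eq_abs, sq_abs]
    refine le_trans ?_ (le_abs_self _)
    rw [map_div₀, le_div_iff₀ (hc σ), map_mul, map_mul, map_pow, map_intCast]
    nlinarith [h σ, sq_nonneg (m : ℝ)]
  nlinarith [sq_nonneg (‖φ ((m : F) * x)‖ - 1), norm_nonneg (φ ((m : F) * x))]

theorem finite_quatNrd_eq (hF : TotReal F) (hdef : TotallyDefinite c₁ c₂)
    {I : Submodule ℤ ℍ[F, c₁, c₂]} (hI : I.FG) (b : F) : {x ∈ I | quatNrd x = b}.Finite := by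
  obtain ⟨m, hm, h⟩ := (isFull_coordLattice (c₁ := c₁) (c₂ := c₂)).exists_smul_le hI
  have h0 := finite_of_mul_sq_le hF (c := 1) (by simp) b hm
  have h1 := finite_of_mul_sq_le hF (c := -c₁) (fun σ => by
    rw [map_neg]
    exact neg_pos.2 (hdef σ).1) b hm
  have h2 := finite_of_mul_sq_le hF (c := -c₂) (fun σ => by
    rw [map_neg]
    exact neg_pos.2 (hdef σ).2) b hm
  have h3 := finite_of_mul_sq_le hF (c := c₁ * c₂) (fun σ => by
    rw [map_mul]
    exact mul_pos_of_neg_of_neg (hdef σ).1 (hdef σ).2) b hm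
  refine ((h0.prod (h1.prod (h2.prod h3))).preimage
    (QuaternionAlgebra.equivProd c₁ 0 c₂).injective.injOn).subset ?_
  rintro x ⟨hx, rfl⟩
  obtain ⟨i0, i1, i2, i3⟩ := h x hx
  have hs : ∀ σ : F →+* ℝ, 0 ≤ -σ c₁ * σ x.imI ^ 2 ∧ 0 ≤ -σ c₂ * σ x.imJ ^ 2 ∧
      0 ≤ σ c₁ * σ c₂ * σ x.imK ^ 2 ∧ σ (quatNrd x) = σ x.re ^ 2 + -σ c₁ * σ x.imI ^ 2 +
        -σ c₂ * σ x.imJ ^ 2 + σ c₁ * σ c₂ * σ x.imK ^ 2 := fun σ => by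
    obtain ⟨d1, d2⟩ := hdef σ
    refine ⟨mul_nonneg (neg_nonneg.2 d1.le) (sq_nonneg _),
      mul_nonneg (neg_nonneg.2 d2.le) (sq_nonneg _),
      mul_nonneg (mul_nonneg_of_nonpos_of_nonpos d1.le d2.le) (sq_nonneg _), ?_⟩
    simp only [quatNrd, map_add, map_sub, map_mul]
    ring
  refine ⟨⟨?_, fun σ => ?_⟩, ⟨?_, fun σ => ?_⟩, ⟨?_, fun σ => ?_⟩, ?_, fun σ => ?_⟩
  · exact isIntegral_of_eq i0 (by simp)
  · obtain ⟨e1, e2, e3, e⟩ := hs σ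
    rw [e, map_one, one_mul]
    change σ x.re ^ 2 ≤ _
    linarith
  · exact isIntegral_of_eq i1 (by simp)
  · obtain ⟨e1, e2, e3, e⟩ := hs σ
    rw [e, map_neg]
    change -σ c₁ * σ x.imI ^ 2 ≤ _
    linarith [sq_nonneg (σ x.re)]
  · exact isIntegral_of_eq i2 (by simp)
  · obtain ⟨e1, e2, e3, e⟩ := hs σ
    rw [e, map_neg]
    change -σ c₂ * σ x.imJ ^ 2 ≤ _
    linarith [sq_nonneg (σ x.re)]
  · exact isIntegral_of_eq i3 (by simp)
  · obtain ⟨e1, e2, e3, e⟩ := hs σ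
    rw [e, map_mul]
    change σ c₁ * σ c₂ * σ x.imK ^ 2 ≤ _
    linarith [sq_nonneg (σ x.re)]

theorem finite_stabilizer_quatNrd_eq (hF : TotReal F) (hdef : TotallyDefinite c₁ c₂)
    (I : LPIdeals O) (b : F) :
    {u : ℍ[F, c₁, c₂]ˣ | u • I = I ∧ quatNrd (u : ℍ[F, c₁, c₂]) = b}.Finite := by
  obtain ⟨N, hN, h1⟩ := I.isFull 1
  have hN' : (N : F) ≠ 0 := Int.cast_ne_zero.2 hN
  refine ((finite_quatNrd_eq hF hdef I.fg ((N : F) ^ 2 * b)).preimage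
    (f := fun u : ℍ[F, c₁, c₂]ˣ => N • (u : ℍ[F, c₁, c₂])) ?_).subset ?_
  · intro u _ v _ h
    simp only [zsmul_eq_smul_quat] at h
    exact Units.ext (smul_right_injective _ hN' h)
  · rintro u ⟨hu, rfl⟩
    refine ⟨?_, quatNrd_zsmul _ _⟩
    have h2 : (u : ℍ[F, c₁, c₂]) * (N • 1) ∈ (u • I).1 := ⟨_, h1, rfl⟩
    rw [hu, mul_smul_comm, mul_one] at h2
    exact h2

theorem exists_unit_of_smul_eq {u : ℍ[F, c₁, c₂]ˣ} {I : LPIdeals O} (h : u • I = I) :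
    ∃ e : (𝓞 F)ˣ, quatNrd (u : ℍ[F, c₁, c₂]) = ((e : 𝓞 F) : F) := by
  have key : ∀ v : ℍ[F, c₁, c₂]ˣ, v • I = I →
      ∃ a : 𝓞 F, quatNrd (v : ℍ[F, c₁, c₂]) = (a : F) := fun v hv => by
    have h1 := nrIdeal_smul (v : ℍ[F, c₁, c₂]ˣ) I
    rw [hv, eq_comm, mul_eq_right₀ (nrIdeal_ne_zero I)] at h1
    have h2 := FractionalIdeal.mem_spanSingleton_self (𝓞 F)⁰ (quatNrd (v : ℍ[F, c₁, c₂]))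
    rw [h1, FractionalIdeal.mem_one_iff] at h2
    obtain ⟨a, ha⟩ := h2
    exact ⟨a, ha.symm⟩
  obtain ⟨a, ha⟩ := key u h
  obtain ⟨b, hb⟩ := key u⁻¹ (inv_smul_eq_iff.2 h.symm)
  have hab : a * b = 1 := by
    apply RingOfIntegers.coe_injective
    rw [map_mul, map_one]
    change (a : F) * (b : F) = 1
    rw [← ha, ← hb, quatNrd_inv, mul_inv_cancel₀ (quatNrd_unit_ne_zero u)]
  exact ⟨Units.mkOfMulEqOne a b hab, ha⟩

end QuatFinite

section QuatUnits

open scoped nonZeroDivisors NumberField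
open NumberField

theorem card_transversal_preimage {G A : Type*} [Group G] [MulOneClass A] (ν : G →* A)
    {N S : Subgroup G} (hNS : N ≤ S) (R : Set A) (hex : ∀ s ∈ S, ∃ n ∈ N, ν (s * n) ∈ R)
    (huniq : ∀ s ∈ S, ∀ n ∈ N, ν s ∈ R → ν (s * n) ∈ R → ν n = 1) :
    {s | s ∈ S ∧ ν s ∈ R}.ncard = Nat.card (N ⊓ ν.ker : Subgroup G) * N.relIndex S := by
  have h1 : ∀ q : S ⧸ N.subgroupOf S, ∃ s : S, ν s ∈ R ∧ (s : S ⧸ N.subgroupOf S) = q := by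
    intro q
    obtain ⟨s, rfl⟩ := QuotientGroup.mk_surjective q
    obtain ⟨n, hn, h⟩ := hex s s.2
    refine ⟨s * ⟨n, hNS hn⟩, h, ?_⟩
    rw [eq_comm, QuotientGroup.eq, inv_mul_cancel_left]
    exact hn
  choose rep hrep hmk using h1
  let f : (N ⊓ ν.ker : Subgroup G) × (S ⧸ N.subgroupOf S) → {s | s ∈ S ∧ ν s ∈ R} := fun x =>
    ⟨rep x.2 * x.1, S.mul_mem (rep x.2).2 (hNS x.1.2.1), by
      rw [map_mul, MonoidHom.mem_ker.1 x.1.2.2, mul_one]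
      exact hrep _⟩
  have hf : Function.Bijective f := by
    constructor
    · rintro ⟨⟨n, hn⟩, q⟩ ⟨⟨n', hn'⟩, q'⟩ h
      have h2 : (rep q : G) * n = rep q' * n' := congrArg Subtype.val h
      have h3 : q = q' := by
        rw [← hmk q, ← hmk q', QuotientGroup.eq]
        have : (rep q : G)⁻¹ * rep q' = n * n'⁻¹ := by
          rw [inv_mul_eq_iff_eq_mul, ← mul_assoc, h2, mul_inv_cancel_right]
        change (rep q : G)⁻¹ * rep q' ∈ N
        rw [this]
        exact N.mul_mem hn.1 (N.inv_mem hn'.1)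
      subst h3
      simpa using h2
    · rintro ⟨s, hs, hsR⟩
      have h2 := hmk (⟨s, hs⟩ : S)
      rw [QuotientGroup.eq] at h2
      refine ⟨⟨⟨_, h2, ?_⟩, ((⟨s, hs⟩ : S) : S ⧸ N.subgroupOf S)⟩, ?_⟩
      · refine huniq _ (rep ((⟨s, hs⟩ : S) : S ⧸ N.subgroupOf S)).2 _ h2 (hrep _) ?_
        simpa using hsR
      · exact Subtype.ext (mul_inv_cancel_left _ _)
  rw [← Nat.card_coe_set_eq, ← Nat.card_congr (Equiv.ofBijective f hf), Nat.card_prod]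
  rfl

variable {F : Type*} [Field F] [NumberField F] {c₁ c₂ : F} {O : Subalgebra ℤ ℍ[F, c₁, c₂]}

variable (c₁ c₂) in
/-- The scalar units of the ring of integers. -/
def scalarUnits : Subgroup ℍ[F, c₁, c₂]ˣ :=
  (Units.map ((algebraMap F ℍ[F, c₁, c₂]).comp (algebraMap (𝓞 F) F)).toMonoidHom).range

omit [NumberField F] in
theorem scalarUnits_commute {n : ℍ[F, c₁, c₂]ˣ} (hn : n ∈ scalarUnits c₁ c₂)
    (x : ℍ[F, c₁, c₂]) : (n : ℍ[F, c₁, c₂]) * x = x * n := by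
  obtain ⟨e, rfl⟩ := hn
  exact Algebra.commutes _ _

instance : (scalarUnits c₁ c₂).Normal := ⟨fun n hn g => by
  have : g * n * g⁻¹ = n := by
    rw [mul_inv_eq_iff_eq_mul]
    exact Units.ext (scalarUnits_commute hn g).symm
  rwa [this]⟩

theorem scalarUnits_le_stabilizer (hA : ∀ x : F, IsIntegral ℤ x → algebraMap F ℍ[F, c₁, c₂] x ∈ O)
    (I : LPIdeals O) : scalarUnits c₁ c₂ ≤ MulAction.stabilizer ℍ[F, c₁, c₂]ˣ I := by
  have key : ∀ n ∈ scalarUnits c₁ c₂, (n • I).1 ≤ I.1 := by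
    rintro n hn _ ⟨x, hx, rfl⟩
    change (n : ℍ[F, c₁, c₂]) * x ∈ I.1
    rw [scalarUnits_commute hn]
    obtain ⟨e, rfl⟩ := hn
    exact I.mul_mem hx (hA _ (e : 𝓞 F).2)
  intro n hn
  refine Subtype.ext (le_antisymm (key n hn) fun x hx => ?_)
  rw [LPIdeals.coe_smul, mem_lmul]
  refine key n⁻¹ (inv_mem hn) ?_
  rw [LPIdeals.coe_smul, mem_lmul]
  simpa using hx

variable (c₁ c₂) in
/-- The reduced norm on units. -/
def nrdHom : ℍ[F, c₁, c₂]ˣ →* F where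
  toFun u := quatNrd (u : ℍ[F, c₁, c₂])
  map_one' := quatNrd_one
  map_mul' _ _ := quatNrd_mul _ _

variable (F) in
/-- Representatives for the units modulo squares. -/
def unitReps : Set F :=
  Set.range fun q : (𝓞 F)ˣ ⧸ (powMonoidHom 2 : (𝓞 F)ˣ →* (𝓞 F)ˣ).range => ((q.out : 𝓞 F) : F)

theorem finite_unitReps : (unitReps F).Finite := by
  have : Finite ((𝓞 F)ˣ ⧸ (powMonoidHom 2 : (𝓞 F)ˣ →* (𝓞 F)ˣ).range) := by
    have : Group.FG (𝓞 F)ˣ := Group.fg_iff_monoid_fg.2 inferInstance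
    have hfg : Group.FG ((𝓞 F)ˣ ⧸ (powMonoidHom 2 : (𝓞 F)ˣ →* (𝓞 F)ˣ).range) := inferInstance
    refine CommGroup.finite_of_fg_isMulTorsion _ fun q => ?_
    obtain ⟨e, rfl⟩ := QuotientGroup.mk_surjective q
    rw [isOfFinOrder_iff_pow_eq_one]
    refine ⟨2, two_pos, ?_⟩
    rw [← QuotientGroup.mk_pow, QuotientGroup.eq_one_iff]
    exact ⟨e, rfl⟩
  exact Set.finite_range _

omit [NumberField F] in
theorem coe_unit_injective : Function.Injective fun e : (𝓞 F)ˣ => ((e : 𝓞 F) : F) :=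
  fun _ _ h => Units.ext (RingOfIntegers.coe_injective h)

theorem ncard_stabilizer_unitReps
    (hA : ∀ x : F, IsIntegral ℤ x → algebraMap F ℍ[F, c₁, c₂] x ∈ O) (I : LPIdeals O) :
    {u : ℍ[F, c₁, c₂]ˣ | u • I = I ∧ quatNrd (u : ℍ[F, c₁, c₂]) ∈ unitReps F}.ncard =
      Nat.card (scalarUnits c₁ c₂ ⊓ (nrdHom c₁ c₂).ker : Subgroup ℍ[F, c₁, c₂]ˣ) *
        (scalarUnits c₁ c₂).relIndex (MulAction.stabilizer ℍ[F, c₁, c₂]ˣ I) := by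
  have hν : ∀ e : (𝓞 F)ˣ, nrdHom c₁ c₂ (Units.map ((algebraMap F ℍ[F, c₁, c₂]).comp
      (algebraMap (𝓞 F) F)).toMonoidHom e) = (((e ^ 2 : (𝓞 F)ˣ) : 𝓞 F) : F) := fun e => by
    refine (quatNrd_algebraMap _).trans ?_
    simp
  refine card_transversal_preimage (nrdHom c₁ c₂) (scalarUnits_le_stabilizer hA I) (unitReps F)
    ?_ ?_
  · intro s hs
    obtain ⟨e, he⟩ := exists_unit_of_smul_eq (MulAction.mem_stabilizer_iff.1 hs)
    have h1 := QuotientGroup.out_eq'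
      (e : (𝓞 F)ˣ ⧸ (powMonoidHom 2 : (𝓞 F)ˣ →* (𝓞 F)ˣ).range)
    rw [eq_comm, QuotientGroup.eq] at h1
    obtain ⟨a, ha⟩ := h1
    refine ⟨_, ⟨a, rfl⟩, (e : (𝓞 F)ˣ ⧸ (powMonoidHom 2 : (𝓞 F)ˣ →* (𝓞 F)ˣ).range), ?_⟩
    rw [map_mul, hν]
    change _ = quatNrd (s : ℍ[F, c₁, c₂]) * _
    have h2 : e * a ^ 2 = (Quotient.out
      (e : (𝓞 F)ˣ ⧸ (powMonoidHom 2 : (𝓞 F)ˣ →* (𝓞 F)ˣ).range)) := by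
      rw [← eq_inv_mul_iff_mul_eq]
      exact ha
    dsimp only
    rw [he, ← h2]
    simp
  · rintro s hs _ ⟨a, rfl⟩ ⟨q, hq⟩ ⟨q', hq'⟩
    rw [map_mul, hν, ← hq] at hq'
    have h1 : q'.out = q.out * a ^ 2 := coe_unit_injective (by simpa using hq')
    have h2 : q = q' := by
      rw [← QuotientGroup.out_eq' q, ← QuotientGroup.out_eq' q', h1, QuotientGroup.eq,
        inv_mul_cancel_left]
      exact ⟨a, rfl⟩
    rw [← h2, left_eq_mul] at h1
    rw [hν, h1]
    simp

theorem finite_stabilizer_unitReps (hF : TotReal F) (hdef : TotallyDefinite c₁ c₂)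
    (I : LPIdeals O) :
    {u : ℍ[F, c₁, c₂]ˣ | u • I = I ∧ quatNrd (u : ℍ[F, c₁, c₂]) ∈ unitReps F}.Finite := by
  refine (finite_unitReps.biUnion
    fun b _ => finite_stabilizer_quatNrd_eq hF hdef I b).subset ?_
  rintro u ⟨hu, h⟩
  exact Set.mem_biUnion h ⟨hu, rfl⟩

theorem relIndex_stabilizer_ne_zero (hF : TotReal F) (hdef : TotallyDefinite c₁ c₂)
    (hA : ∀ x : F, IsIntegral ℤ x → algebraMap F ℍ[F, c₁, c₂] x ∈ O) (I : LPIdeals O) :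
    Nat.card (scalarUnits c₁ c₂ ⊓ (nrdHom c₁ c₂).ker : Subgroup ℍ[F, c₁, c₂]ˣ) ≠ 0 ∧
      (scalarUnits c₁ c₂).relIndex (MulAction.stabilizer ℍ[F, c₁, c₂]ˣ I) ≠ 0 := by
  rw [← mul_ne_zero_iff, ← ncard_stabilizer_unitReps hA I, ← Nat.pos_iff_ne_zero,
    Set.ncard_pos (finite_stabilizer_unitReps hF hdef I)]
  have h1 := QuotientGroup.out_eq' (1 : (𝓞 F)ˣ ⧸ (powMonoidHom 2 : (𝓞 F)ˣ →* (𝓞 F)ˣ).range)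
  rw [QuotientGroup.eq_one_iff] at h1
  obtain ⟨a, ha⟩ := h1
  refine ⟨Units.map ((algebraMap F ℍ[F, c₁, c₂]).comp (algebraMap (𝓞 F) F)).toMonoidHom a,
    MulAction.mem_stabilizer_iff.1 (scalarUnits_le_stabilizer hA I ⟨a, rfl⟩), 1, ?_⟩
  dsimp only
  rw [← ha]
  refine Eq.trans ?_ (quatNrd_algebraMap _).symm
  simp

end QuatUnits

section QuatFixers

open scoped nonZeroDivisors NumberField
open NumberField MulAction

variable {F : Type*} [Field F] [NumberField F] {c₁ c₂ : F} {O : Subalgebra ℤ ℍ[F, c₁, c₂]}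

omit [NumberField F] in
theorem star_unit_quat (g : ℍ[F, c₁, c₂]ˣ) :
    star (g : ℍ[F, c₁, c₂]) = quatNrd (g : ℍ[F, c₁, c₂]) • (↑g⁻¹ : ℍ[F, c₁, c₂]) := by
  rw [Algebra.smul_def, ← star_mul_quat, Units.mul_inv_cancel_right]

omit [NumberField F] in
theorem star_conj_quat (g u : ℍ[F, c₁, c₂]ˣ) :
    star ((g * u * g⁻¹ : ℍ[F, c₁, c₂]ˣ) : ℍ[F, c₁, c₂]) = g * star (u : ℍ[F, c₁, c₂]) * ↑g⁻¹ := by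
  rw [Units.val_mul, Units.val_mul, star_mul, star_mul, star_unit_quat g, star_unit_quat g⁻¹,
    inv_inv, quatNrd_inv, smul_mul_assoc, mul_smul_comm, mul_smul_comm, smul_smul,
    inv_mul_cancel₀ (quatNrd_unit_ne_zero g), one_smul, mul_assoc]

/-- The element `a + b (u - ū)` of the commutant of `u`. -/
def commutantElt (a b : F) (u : ℍ[F, c₁, c₂]) : ℍ[F, c₁, c₂] :=
  algebraMap F _ a + b • (u - star u)

omit [NumberField F] in
theorem quatNrd_commutantElt (a b : F) (u : ℍ[F, c₁, c₂]) :
    quatNrd (commutantElt a b u) = a ^ 2 + b ^ 2 * quatNrd (u - star u) := by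
  simp [quatNrd, commutantElt, QuaternionAlgebra.algebraMap_eq]
  ring

omit [NumberField F] in
theorem sub_star_conj (g u : ℍ[F, c₁, c₂]ˣ) :
    ((g * u * g⁻¹ : ℍ[F, c₁, c₂]ˣ) : ℍ[F, c₁, c₂]) -
      star ((g * u * g⁻¹ : ℍ[F, c₁, c₂]ˣ) : ℍ[F, c₁, c₂]) =
        g * ((u : ℍ[F, c₁, c₂]) - star (u : ℍ[F, c₁, c₂])) * ↑g⁻¹ := by
  rw [star_conj_quat, mul_sub, sub_mul]
  simp

omit [NumberField F] in
theorem commutantElt_conj (a b : F) (g u : ℍ[F, c₁, c₂]ˣ) :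
    commutantElt a b ((g * u * g⁻¹ : ℍ[F, c₁, c₂]ˣ) : ℍ[F, c₁, c₂]) =
      g * commutantElt a b (u : ℍ[F, c₁, c₂]) * ↑g⁻¹ := by
  rw [commutantElt, commutantElt, sub_star_conj, mul_add, add_mul, mul_smul_comm, smul_mul_assoc,
    ← Algebra.commutes a (g : ℍ[F, c₁, c₂]), mul_assoc (algebraMap F _ a), Units.mul_inv, mul_one]

omit [NumberField F] in
theorem quatNrd_conj (g : ℍ[F, c₁, c₂]ˣ) (x : ℍ[F, c₁, c₂]) :
    quatNrd ((g : ℍ[F, c₁, c₂]) * x * (↑g⁻¹ : ℍ[F, c₁, c₂])) = quatNrd x := by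
  have := quatNrd_unit_ne_zero g
  rw [quatNrd_mul, quatNrd_mul, quatNrd_inv]
  field_simp

open Classical in
/-- The element `a + b (u - ū)` as a unit, when it is one. -/
def commutantUnit (a b : F) (u : ℍ[F, c₁, c₂]ˣ) : ℍ[F, c₁, c₂]ˣ :=
  if h : quatNrd (commutantElt a b (u : ℍ[F, c₁, c₂])) ≠ 0 then quatUnit _ h else 1

omit [NumberField F] in
theorem coe_commutantUnit {a b : F} {u : ℍ[F, c₁, c₂]ˣ}
    (h : quatNrd (commutantElt a b (u : ℍ[F, c₁, c₂])) ≠ 0) :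
    (commutantUnit a b u : ℍ[F, c₁, c₂]) = commutantElt a b (u : ℍ[F, c₁, c₂]) := by
  rw [commutantUnit, dif_pos h]
  rfl

omit [NumberField F] in
theorem commutantUnit_conj (a b : F) (g u : ℍ[F, c₁, c₂]ˣ) :
    commutantUnit a b (g * u * g⁻¹) = g * commutantUnit a b u * g⁻¹ := by
  have h0 := commutantElt_conj a b g u
  have h1 : quatNrd (commutantElt a b ((g * u * g⁻¹ : ℍ[F, c₁, c₂]ˣ) : ℍ[F, c₁, c₂])) =
      quatNrd (commutantElt a b (u : ℍ[F, c₁, c₂])) := by rw [h0, quatNrd_conj]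
  by_cases h : quatNrd (commutantElt a b (u : ℍ[F, c₁, c₂])) ≠ 0
  · apply Units.ext
    rw [coe_commutantUnit (h1 ▸ h), h0, Units.val_mul, Units.val_mul, coe_commutantUnit h]
  · rw [commutantUnit, dif_neg (h1 ▸ h), commutantUnit, dif_neg h]
    simp

omit [NumberField F] in
theorem commutantUnit_conj_self (a b : F) (u : ℍ[F, c₁, c₂]ˣ) :
    u * commutantUnit a b u * u⁻¹ = commutantUnit a b u := by
  rw [← commutantUnit_conj, mul_inv_cancel_right]

/-- The elements of the stabilizer of `I` with prescribed norm and discriminant. -/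
def fixers (I : LPIdeals O) (r d : F) : Set ℍ[F, c₁, c₂]ˣ :=
  {u | u • I = I ∧ quatNrd (u : ℍ[F, c₁, c₂]) = r ∧
    quatNrd ((u : ℍ[F, c₁, c₂]) - star (u : ℍ[F, c₁, c₂])) = d}

theorem finite_fixers (hF : TotReal F) (hdef : TotallyDefinite c₁ c₂) (I : LPIdeals O) (r d : F) :
    (fixers I r d).Finite :=
  (finite_stabilizer_quatNrd_eq hF hdef I r).subset fun _ hu => ⟨hu.1, hu.2.1⟩

theorem conj_mem_fixers {I : LPIdeals O} {r d : F} {u : ℍ[F, c₁, c₂]ˣ} (hu : u ∈ fixers I r d)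
    (g : ℍ[F, c₁, c₂]ˣ) : g * u * g⁻¹ ∈ fixers (g • I) r d := by
  refine ⟨?_, ?_, ?_⟩
  · rw [← mul_smul, inv_mul_cancel_right, mul_smul, hu.1]
  · rw [Units.val_mul, Units.val_mul, quatNrd_conj, hu.2.1]
  · rw [sub_star_conj, quatNrd_conj, hu.2.2]

variable (O) in
/-- Pairs of an ideal and an automorphism of it with prescribed norm and discriminant. -/
def FixedPair (r d : F) : Type _ := {y : LPIdeals O × ℍ[F, c₁, c₂]ˣ // y.2 ∈ fixers y.1 r d}

namespace FixedPair

variable {r d : F}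

instance : MulAction ℍ[F, c₁, c₂]ˣ (FixedPair O r d) where
  smul g y := ⟨(g • y.1.1, g * y.1.2 * g⁻¹), conj_mem_fixers y.2 g⟩
  one_smul y := Subtype.ext (Prod.ext (one_smul _ _) (by
    change 1 * y.1.2 * 1⁻¹ = _
    simp))
  mul_smul g h y := Subtype.ext (Prod.ext (mul_smul _ _ _) (by
    change g * h * y.1.2 * (g * h)⁻¹ = g * (h * y.1.2 * h⁻¹) * g⁻¹
    group))

theorem smul_fst (g : ℍ[F, c₁, c₂]ˣ) (y : FixedPair O r d) : (g • y).1.1 = g • y.1.1 := rfl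

theorem smul_snd (g : ℍ[F, c₁, c₂]ˣ) (y : FixedPair O r d) : (g • y).1.2 = g * y.1.2 * g⁻¹ := rfl

theorem scalarUnits_le_stabilizer
    (hA : ∀ x : F, IsIntegral ℤ x → algebraMap F ℍ[F, c₁, c₂] x ∈ O) (y : FixedPair O r d) :
    scalarUnits c₁ c₂ ≤ stabilizer ℍ[F, c₁, c₂]ˣ y := fun n hn => by
  refine Subtype.ext (Prod.ext (_root_.scalarUnits_le_stabilizer hA y.1.1 hn) ?_)
  change n * y.1.2 * n⁻¹ = y.1.2
  rw [mul_inv_eq_iff_eq_mul]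
  exact Units.ext (scalarUnits_commute hn _)

theorem ncard_fst_eq (I : LPIdeals O) :
    {y : FixedPair O r d | y.1.1 = I}.ncard = (fixers I r d).ncard := by
  refine Set.ncard_congr (fun y _ => y.1.2) ?_ ?_ ?_
  · rintro y rfl
    exact y.2
  · rintro y z rfl hz h
    exact Subtype.ext (Prod.ext hz.symm h)
  · intro u hu
    exact ⟨⟨(I, u), hu⟩, rfl, rfl⟩

variable {p : ℕ} (hp : p.Prime) (a b : F)

/-- The second projection of the correspondence on fixed pairs. -/
def shift (y : FixedPair O r d) : LPIdeals O :=
  LPIdeals.twist hp (commutantUnit a b y.1.2) y.1.1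

theorem shift_smul (g : ℍ[F, c₁, c₂]ˣ) (y : FixedPair O r d) :
    shift hp a b (g • y) = g • shift hp a b y := by
  rw [shift, shift, LPIdeals.smul_twist, smul_snd, commutantUnit_conj, smul_fst]

theorem bijOn_shift_eq (J : LPIdeals O) :
    Set.BijOn (fun y : FixedPair O r d => y.1.2) {y | shift hp a b y = J} (fixers J r d) := by
  have key : ∀ (u k : ℍ[F, c₁, c₂]ˣ) (I : LPIdeals O), u * k * u⁻¹ = k → u ∈ fixers I r d →
      u ∈ fixers (LPIdeals.twist hp k I) r d := fun u k I hk hu =>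
    ⟨by rw [LPIdeals.smul_twist, hk, hu.1], hu.2⟩
  refine ⟨?_, ?_, ?_⟩
  · rintro y rfl
    exact key _ _ _ (commutantUnit_conj_self a b _) y.2
  · rintro y hy z hz h
    refine Subtype.ext (Prod.ext ?_ h)
    have h1 : ∀ w : FixedPair O r d, shift hp a b w = J →
        w.1.1 = LPIdeals.twist hp (commutantUnit a b w.1.2)⁻¹ J := fun w hw => by
      rw [← hw, shift, LPIdeals.twist_twist, inv_mul_cancel, LPIdeals.twist_one]
    rw [h1 y hy, h1 z hz]
    exact congrArg (fun u => LPIdeals.twist hp (commutantUnit a b u)⁻¹ J) h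
  · intro u hu
    refine ⟨⟨(LPIdeals.twist hp (commutantUnit a b u)⁻¹ J, u), key u _ J ?_ hu⟩, ?_, rfl⟩
    · conv_rhs => rw [← commutantUnit_conj_self a b u]
      group
    · change LPIdeals.twist hp _ (LPIdeals.twist hp _ J) = J
      rw [LPIdeals.twist_twist, mul_inv_cancel, LPIdeals.twist_one]

end FixedPair

theorem nrClass_twist (hO : IsZOrder O) {p : ℕ} (hp : p.Prime) (I : LPIdeals O)
    {k : ℍ[F, c₁, c₂]ˣ} {n : 𝓞 F} (hn : quatNrd (k : ℍ[F, c₁, c₂]) = n)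
    {𝔫 𝔪 : Ideal (𝓞 F)} (h𝔫 : 𝔫 ∈ (Ideal (𝓞 F))⁰) (hnm : Ideal.span {n} = 𝔫 * 𝔪)
    (hcop : IsCoprime 𝔪 (Ideal.span {(p : 𝓞 F)})) {j : ℕ} (hj : (p : 𝓞 F) ^ j ∈ 𝔫) :
    nrClass (LPIdeals.twist hp k I) = ClassGroup.mk0 ⟨𝔫, h𝔫⟩ * nrClass I := by
  obtain ⟨g, hg⟩ := LPIdeals.exists_loc_eq hO I hp
  refine nrClass_of_loc_eq hO hp hg (h := k * g) ?_ (fun q hq => LPIdeals.loc_twist_of_ne hp k I hq)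
    ?_ h𝔫 hnm hcop hj
  · rw [LPIdeals.loc_twist_self, mul_smul]
    exact LPIdeals.loc_smul_congr k hg
  · rw [Units.val_mul, quatNrd_mul, hn]

end QuatFixers

section QuatFixMass

open scoped nonZeroDivisors NumberField Classical
open NumberField MulAction

/-- The subgroup of translations preserving a function on a commutative group. -/
def translationInvariants {C R : Type*} [CommGroup C] (A : C → R) : Subgroup C where
  carrier := {a | ∀ c, A (a * c) = A c}
  one_mem' c := by rw [one_mul]
  mul_mem' {a b} ha hb c := by rw [mul_assoc, ha, hb]
  inv_mem' {a} ha c := by rw [← ha (a⁻¹ * c), mul_inv_cancel_left]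

theorem eq_of_translationInvariants_eq_top {C R : Type*} [CommGroup C] {A : C → R}
    (h : translationInvariants A = ⊤) (c c' : C) : A c = A c' := by
  have h1 : c * c'⁻¹ ∈ translationInvariants A := h ▸ Subgroup.mem_top _
  rw [← h1 c', inv_mul_cancel_right]

variable {F : Type*} [Field F] [NumberField F] {c₁ c₂ : F} {O : Subalgebra ℤ ℍ[F, c₁, c₂]}

theorem exists_int_sq_mul_isIntegral (x : F) : ∃ m : ℤ, m ≠ 0 ∧ IsIntegral ℤ ((m : F) ^ 2 * x) := by
  obtain ⟨m, hm, h⟩ := exists_int_mul_isIntegral x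
  exact ⟨m, hm, isIntegral_of_eq ((intCast_isIntegral m).mul h) (by ring)⟩

variable (O) in
/-- The mass of the automorphisms of given norm and discriminant, over a norm class. -/
def fixMass [Fintype (orbitRel.Quotient ℍ[F, c₁, c₂]ˣ (LPIdeals O))] (r d : F)
    (c : ClassGroup (𝓞 F)) : ℚ :=
  ∑ x : orbitRel.Quotient ℍ[F, c₁, c₂]ˣ (LPIdeals O) with nrClass x.out = c,
    ((fixers x.out r d).ncard : ℚ) * orbitMass (scalarUnits c₁ c₂) x.out

variable [Fintype (orbitRel.Quotient ℍ[F, c₁, c₂]ˣ (LPIdeals O))]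

theorem fixMass_mk0_mul (hF : TotReal F) (hdef : TotallyDefinite c₁ c₂) (hO : IsZOrder O)
    (hA : ∀ x : F, IsIntegral ℤ x → algebraMap F ℍ[F, c₁, c₂] x ∈ O) {r d : F}
    {a b : F} {n : 𝓞 F} (hn : a ^ 2 + b ^ 2 * d = n) (hn0 : n ≠ 0) {p : ℕ} (hp : p.Prime)
    {𝔫 𝔪 : Ideal (𝓞 F)} (h𝔫 : 𝔫 ∈ (Ideal (𝓞 F))⁰) (hnm : Ideal.span {n} = 𝔫 * 𝔪)
    (hcop : IsCoprime 𝔪 (Ideal.span {(p : 𝓞 F)})) {j : ℕ} (hj : (p : 𝓞 F) ^ j ∈ 𝔫)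
    (c : ClassGroup (𝓞 F)) :
    fixMass O r d (ClassGroup.mk0 ⟨𝔫, h𝔫⟩ * c) = fixMass O r d c := by
  have hn0' : (n : F) ≠ 0 := fun h => hn0 (RingOfIntegers.coe_injective (h.trans (map_zero _).symm))
  have h2 : ∀ I : LPIdeals O, {y : FixedPair O r d | y.1.1 = I}.Finite := fun I => by
    refine Set.Finite.of_finite_image (f := fun y => y.1.2)
      ((finite_fixers hF hdef I r d).subset ?_) ?_
    · rintro _ ⟨y, rfl, rfl⟩
      exact y.2
    · rintro y rfl z hz h
      exact Subtype.ext (Prod.ext hz.symm h)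
  have h3 : ∀ I : LPIdeals O, {y : FixedPair O r d | y.shift hp a b = I}.Finite := fun I =>
    Set.Finite.of_finite_image (f := fun y => y.1.2)
      ((FixedPair.bijOn_shift_eq hp a b I).image_eq ▸ finite_fixers hF hdef I r d)
      (FixedPair.bijOn_shift_eq hp a b I).injOn
  have key := sum_orbitMass_correspondence (scalarUnits c₁ c₂) (L := LPIdeals O)
    (Y := FixedPair O r d) FixedPair.smul_fst (FixedPair.shift_smul hp a b)
    (FixedPair.scalarUnits_le_stabilizer hA)
    (fun I => (relIndex_stabilizer_ne_zero hF hdef hA I).2) h2 h3 nrClass nrClass_smul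
    (mul_right_injective (ClassGroup.mk0 ⟨𝔫, h𝔫⟩)) (fun y => ?_) c
  · rw [fixMass, fixMass]
    refine (Eq.trans (Finset.sum_congr rfl fun x _ => ?_)
      (key.trans (Finset.sum_congr rfl fun x _ => ?_))).symm
    · rw [FixedPair.ncard_fst_eq]
    · rw [← (FixedPair.bijOn_shift_eq hp a b x.out).image_eq,
        (FixedPair.bijOn_shift_eq hp a b x.out).injOn.ncard_image]
  · have e : quatNrd (commutantElt a b (y.1.2 : ℍ[F, c₁, c₂])) = n := by
      rw [quatNrd_commutantElt, y.2.2.2, hn]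
    exact nrClass_twist hO hp y.1.1 (by rw [coe_commutantUnit (e ▸ hn0'), e]) h𝔫 hnm hcop hj

theorem fixMass_eq_of_ne_zero (hF : TotReal F) (hdef : TotallyDefinite c₁ c₂) (hO : IsZOrder O)
    (hA : ∀ x : F, IsIntegral ℤ x → algebraMap F ℍ[F, c₁, c₂] x ∈ O) (r : F) {d : F}
    (hd : d ≠ 0) (c c' : ClassGroup (𝓞 F)) : fixMass O r d c = fixMass O r d c' := by
  by_cases hex : ∃ (I : LPIdeals O) (u : ℍ[F, c₁, c₂]ˣ), u ∈ fixers I r d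
  swap
  · have h0 : ∀ I : LPIdeals O, fixers I r d = ∅ := fun I =>
      Set.eq_empty_of_forall_notMem fun u hu => hex ⟨I, u, hu⟩
    simp [fixMass, h0]
  obtain ⟨I, u, hu⟩ := hex
  have hpos : ∀ σ : F →+* ℝ, 0 < σ d := fun σ => by
    rw [← hu.2.2]
    refine quatNrd_pos hdef (fun h => hd ?_) σ
    rw [← hu.2.2, h, quatNrd_zero]
  obtain ⟨m, hm, hmd⟩ := exists_int_sq_mul_isIntegral d
  have hm' : (m : F) ≠ 0 := Int.cast_ne_zero.2 hm
  let d' : 𝓞 F := ⟨(m : F) ^ 2 * d, hmd⟩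
  have hd' : (d' : F) = (m : F) ^ 2 * d := rfl
  refine eq_of_translationInvariants_eq_top (classGroup_eq_top_of_norm_form hF (d := d') ?_ ?_ _ ?_)
    c c'
  · intro h
    have : (d' : F) = 0 := by simp [h]
    rw [hd'] at this
    exact mul_ne_zero (pow_ne_zero 2 hm') hd this
  · intro σ
    rw [hd', map_mul, map_pow, map_intCast]
    have : (m : ℝ) ≠ 0 := Int.cast_ne_zero.2 hm
    exact mul_pos (by positivity) (hpos σ)
  · rintro a b 𝔫 𝔪 h𝔫 p hp hne hnm hcop ⟨j, hj⟩ c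
    refine fixMass_mk0_mul hF hdef hO hA (a := a) (b := b * m) ?_ hne hp h𝔫 hnm hcop hj c
    refine Eq.trans ?_ (show (a : F) ^ 2 + (d' : F) * (b : F) ^ 2 =
      ((a ^ 2 + d' * b ^ 2 : 𝓞 F) : F) by simp)
    rw [hd']
    ring

end QuatFixMass

section QuatHecke

open scoped nonZeroDivisors NumberField Classical
open NumberField MulAction

theorem eq_of_mul_eq_mul_translate {C : Type*} [Group C] [Finite C] {M : C → ℚ}
    {a b : ℚ} (ha : 0 < a) (hb : 0 < b) {c₀ : C} (h : ∀ c, a * M c = b * M (c₀ * c)) (c : C) :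
    M (c₀ * c) = M c := by
  have h1 : ∀ c, M (c₀ * c) = a / b * M c := fun c => by
    rw [div_mul_eq_mul_div, h, mul_div_cancel_left₀ _ hb.ne']
  have h2 : ∀ k : ℕ, M (c₀ ^ k * c) = (a / b) ^ k * M c := fun k => by
    induction k with
    | zero => simp
    | succ k ih => rw [pow_succ', mul_assoc, h1, ih, pow_succ', mul_assoc]
  have h3 := h2 (orderOf c₀)
  rw [pow_orderOf_eq_one, one_mul, eq_comm, mul_left_eq_self₀] at h3
  rcases h3 with h3 | h3
  · rw [h1, (pow_eq_one_iff_of_nonneg (div_pos ha hb).le (orderOf_pos c₀).ne').1 h3, one_mul]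
  · rw [h1, h3, mul_zero]

variable {F : Type*} [Field F] [NumberField F] {c₁ c₂ : F} {O : Subalgebra ℤ ℍ[F, c₁, c₂]}

/-- `J` is a neighbour of `I` of type `x` at `p`. -/
def Neighbour (hO : IsZOrder O) (p : ℕ) (x : ℍ[F, c₁, c₂]ˣ) (I J : LPIdeals O) : Prop :=
  (∃ g : ℍ[F, c₁, c₂]ˣ, I.loc p = (g • LPIdeals.self hO).loc p ∧
    J.loc p = ((g * x) • LPIdeals.self hO).loc p) ∧
  ∀ q : ℕ, q.Prime → q ≠ p → J.loc q = I.loc q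

namespace Neighbour

variable {hO : IsZOrder O} {p : ℕ} {x : ℍ[F, c₁, c₂]ˣ} {I J : LPIdeals O}

theorem symm (h : Neighbour hO p x I J) : Neighbour hO p x⁻¹ J I := by
  obtain ⟨⟨g, h1, h2⟩, h3⟩ := h
  exact ⟨⟨g * x, h2, by rwa [mul_inv_cancel_right]⟩, fun q hq hqp => (h3 q hq hqp).symm⟩

theorem comm : Neighbour hO p x⁻¹ J I ↔ Neighbour hO p x I J :=
  ⟨fun h => inv_inv x ▸ h.symm, symm⟩

theorem smul (h : Neighbour hO p x I J) (g : ℍ[F, c₁, c₂]ˣ) :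
    Neighbour hO p x (g • I) (g • J) := by
  obtain ⟨⟨k, h1, h2⟩, h3⟩ := h
  refine ⟨⟨g * k, ?_, ?_⟩, fun q hq hqp => LPIdeals.loc_smul_congr g (h3 q hq hqp)⟩
  · rw [mul_smul]
    exact LPIdeals.loc_smul_congr g h1
  · rw [mul_assoc, mul_smul]
    exact LPIdeals.loc_smul_congr g h2

theorem smul_mem (hp : p.Prime) (h : Neighbour hO p x I J) {m : ℤ}
    (hm : m • (x : ℍ[F, c₁, c₂]) ∈ O) {y : ℍ[F, c₁, c₂]} (hy : y ∈ J.1) : m • y ∈ I.1 := by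
  obtain ⟨⟨g, h1, h2⟩, h3⟩ := h
  refine mem_of_forall_mem_locAt fun q hq => ?_
  rcases eq_or_ne q p with rfl | hqp
  · have h4 := (mem_loc_iff_of_loc_eq hO h2).1 (mem_locAt_of_mem hq hy)
    refine (mem_loc_iff_of_loc_eq hO h1).2 ?_
    have e : (↑g⁻¹ : ℍ[F, c₁, c₂]) * (m • y) =
        (m • (x : ℍ[F, c₁, c₂])) * ((↑(g * x)⁻¹ : ℍ[F, c₁, c₂]) * y) := by
      rw [mul_inv_rev, Units.val_mul, mul_assoc, smul_mul_assoc, Units.mul_inv_cancel_left,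
        mul_smul_comm]
    rw [e]
    exact mul_mem_locAt hq (mem_locAt_of_mem hq hm) h4
  · have h4 : y ∈ I.loc q := h3 q hq hqp ▸ mem_locAt_of_mem hq hy
    exact (locMod q hq I.1).smul_mem m h4

theorem finite_setOf (hp : p.Prime) (x : ℍ[F, c₁, c₂]ˣ) (I : LPIdeals O) :
    {J | Neighbour hO p x I J}.Finite := by
  have hfull : ∀ y : ℍ[F, c₁, c₂], ∃ m : ℤ, m ≠ 0 ∧ m • y ∈ O := (LPIdeals.self hO).isFull
  obtain ⟨m, hm, h1⟩ := hfull x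
  obtain ⟨n, hn, h2⟩ := hfull ↑x⁻¹
  refine Set.Finite.of_finite_image (f := Subtype.val)
    ((finite_submodules_between I.fg hm hn).subset ?_) Subtype.val_injective.injOn
  rintro _ ⟨J, hJ, rfl⟩
  exact ⟨fun y hy => hJ.smul_mem hp h1 hy, fun y hy => hJ.symm.smul_mem hp h2 hy⟩

theorem nonempty_setOf (hp : p.Prime) (x : ℍ[F, c₁, c₂]ˣ) (I : LPIdeals O) :
    {J | Neighbour hO p x I J}.Nonempty := by
  obtain ⟨g, hg⟩ := LPIdeals.exists_loc_eq hO I hp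
  exact ⟨LPIdeals.glue hp ((g * x) • LPIdeals.self hO) I,
    ⟨g, hg, LPIdeals.loc_glue_self hp _ _⟩, fun q => LPIdeals.loc_glue_of_ne hp _ _⟩

theorem ncard_setOf_le (hp : p.Prime) (x : ℍ[F, c₁, c₂]ˣ) (I I' : LPIdeals O) :
    {J | Neighbour hO p x I J}.ncard ≤ {J | Neighbour hO p x I' J}.ncard := by
  obtain ⟨g, hg⟩ := LPIdeals.exists_loc_eq hO I hp
  obtain ⟨g', hg'⟩ := LPIdeals.exists_loc_eq hO I' hp
  refine Set.ncard_le_ncard_of_injOn (fun J => LPIdeals.glue hp ((g' * g⁻¹) • J) I') ?_ ?_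
    (finite_setOf hp x I')
  · rintro J ⟨⟨k, h1, h2⟩, h3⟩
    refine ⟨⟨g' * g⁻¹ * k, ?_, ?_⟩, fun q => LPIdeals.loc_glue_of_ne hp _ _⟩
    · have := LPIdeals.loc_smul_congr (g' * g⁻¹) (hg.symm.trans h1)
      rw [← mul_smul, ← mul_smul, inv_mul_cancel_right] at this
      exact hg'.trans this
    · rw [LPIdeals.loc_glue_self, mul_assoc _ k, mul_smul _ (k * x)]
      exact LPIdeals.loc_smul_congr _ h2
  · rintro J₁ ⟨-, h1⟩ J₂ ⟨-, h2⟩ h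
    refine LPIdeals.ext_loc fun q hq => ?_
    rcases eq_or_ne q p with rfl | hqp
    · have h3 := congrArg (LPIdeals.loc q) h
      simp only [LPIdeals.loc_glue_self] at h3
      have h4 := LPIdeals.loc_smul_congr (g' * g⁻¹)⁻¹ h3
      rwa [inv_smul_smul, inv_smul_smul] at h4
    · rw [h1 q hq hqp, h2 q hq hqp]

theorem ncard_setOf_eq (hp : p.Prime) (x : ℍ[F, c₁, c₂]ˣ) (I I' : LPIdeals O) :
    {J | Neighbour hO p x I J}.ncard = {J | Neighbour hO p x I' J}.ncard :=
  le_antisymm (ncard_setOf_le hp x I I') (ncard_setOf_le hp x I' I)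

end Neighbour

/-- Pairs of neighbours. -/
def NeighbourPair (hO : IsZOrder O) (p : ℕ) (x : ℍ[F, c₁, c₂]ˣ) : Type _ :=
  {y : LPIdeals O × LPIdeals O // Neighbour hO p x y.1 y.2}

namespace NeighbourPair

variable {hO : IsZOrder O} {p : ℕ} {x : ℍ[F, c₁, c₂]ˣ}

instance : MulAction ℍ[F, c₁, c₂]ˣ (NeighbourPair hO p x) where
  smul g y := ⟨(g • y.1.1, g • y.1.2), y.2.smul g⟩
  one_smul _ := Subtype.ext (Prod.ext (one_smul _ _) (one_smul _ _))
  mul_smul _ _ _ := Subtype.ext (Prod.ext (mul_smul _ _ _) (mul_smul _ _ _))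

theorem smul_fst (g : ℍ[F, c₁, c₂]ˣ) (y : NeighbourPair hO p x) : (g • y).1.1 = g • y.1.1 := rfl

theorem smul_snd (g : ℍ[F, c₁, c₂]ˣ) (y : NeighbourPair hO p x) : (g • y).1.2 = g • y.1.2 := rfl

theorem bijOn_fst_eq (I : LPIdeals O) : Set.BijOn (fun y : NeighbourPair hO p x => y.1.2)
    {y | y.1.1 = I} {J | Neighbour hO p x I J} := by
  refine ⟨?_, ?_, fun J hJ => ⟨⟨(I, J), hJ⟩, rfl, rfl⟩⟩
  · rintro y rfl
    exact y.2
  · rintro y rfl z hz h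
    exact Subtype.ext (Prod.ext hz.symm h)

theorem bijOn_snd_eq (J : LPIdeals O) : Set.BijOn (fun y : NeighbourPair hO p x => y.1.1)
    {y | y.1.2 = J} {I | Neighbour hO p x⁻¹ J I} := by
  refine ⟨?_, ?_, fun I hI => ⟨⟨(I, J), Neighbour.comm.1 hI⟩, rfl, rfl⟩⟩
  · rintro y rfl
    exact y.2.symm
  · rintro y rfl z hz h
    exact Subtype.ext (Prod.ext h hz.symm)

end NeighbourPair

variable [Fintype (orbitRel.Quotient ℍ[F, c₁, c₂]ˣ (LPIdeals O))]

variable (O) in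
/-- The mass of a norm class. -/
def classMass (c : ClassGroup (𝓞 F)) : ℚ :=
  ∑ x : orbitRel.Quotient ℍ[F, c₁, c₂]ˣ (LPIdeals O) with nrClass x.out = c,
    orbitMass (scalarUnits c₁ c₂) x.out

theorem classMass_mk0_mul (hF : TotReal F) (hdef : TotallyDefinite c₁ c₂) (hO : IsZOrder O)
    (hA : ∀ x : F, IsIntegral ℤ x → algebraMap F ℍ[F, c₁, c₂] x ∈ O)
    {x : ℍ[F, c₁, c₂]ˣ} {n : 𝓞 F} (hn : quatNrd (x : ℍ[F, c₁, c₂]) = n) {p : ℕ} (hp : p.Prime)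
    {𝔫 𝔪 : Ideal (𝓞 F)} (h𝔫 : 𝔫 ∈ (Ideal (𝓞 F))⁰) (hnm : Ideal.span {n} = 𝔫 * 𝔪)
    (hcop : IsCoprime 𝔪 (Ideal.span {(p : 𝓞 F)})) {j : ℕ} (hj : (p : 𝓞 F) ^ j ∈ 𝔫)
    (c : ClassGroup (𝓞 F)) :
    classMass O (ClassGroup.mk0 ⟨𝔫, h𝔫⟩ * c) = classMass O c := by
  have hcard : ∀ (y : ℍ[F, c₁, c₂]ˣ),
      (0 : ℚ) < {J | Neighbour hO p y (LPIdeals.self hO) J}.ncard := fun y =>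
    Nat.cast_pos.2 ((Set.ncard_pos (Neighbour.finite_setOf hp y _)).2
      (Neighbour.nonempty_setOf hp y _))
  refine eq_of_mul_eq_mul_translate (hcard x) (hcard x⁻¹) (fun c => ?_) c
  have h1 : ∀ I : LPIdeals O, {y : NeighbourPair hO p x | y.1.1 = I}.Finite := fun I =>
    Set.Finite.of_finite_image ((NeighbourPair.bijOn_fst_eq I).image_eq ▸
      Neighbour.finite_setOf hp x I) (NeighbourPair.bijOn_fst_eq I).injOn
  have h2 : ∀ I : LPIdeals O, {y : NeighbourPair hO p x | y.1.2 = I}.Finite := fun I =>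
    Set.Finite.of_finite_image ((NeighbourPair.bijOn_snd_eq I).image_eq ▸
      Neighbour.finite_setOf hp x⁻¹ I) (NeighbourPair.bijOn_snd_eq I).injOn
  have key := sum_orbitMass_correspondence (scalarUnits c₁ c₂) (L := LPIdeals O)
    (Y := NeighbourPair hO p x) NeighbourPair.smul_fst NeighbourPair.smul_snd
    (fun y n hn => Subtype.ext (Prod.ext (scalarUnits_le_stabilizer hA y.1.1 hn)
      (scalarUnits_le_stabilizer hA y.1.2 hn)))
    (fun I => (relIndex_stabilizer_ne_zero hF hdef hA I).2) h1 h2 nrClass nrClass_smul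
    (mul_right_injective (ClassGroup.mk0 ⟨𝔫, h𝔫⟩)) (fun y => ?_) c
  · rw [classMass, classMass, Finset.mul_sum, Finset.mul_sum]
    refine Eq.trans (Finset.sum_congr rfl fun z _ => ?_)
      (key.trans (Finset.sum_congr rfl fun z _ => ?_))
    · rw [Neighbour.ncard_setOf_eq hp x _ z.out, ← (NeighbourPair.bijOn_fst_eq z.out).image_eq,
        (NeighbourPair.bijOn_fst_eq z.out).injOn.ncard_image]
    · rw [Neighbour.ncard_setOf_eq hp x⁻¹ _ z.out, ← (NeighbourPair.bijOn_snd_eq z.out).image_eq,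
        (NeighbourPair.bijOn_snd_eq z.out).injOn.ncard_image]
  · obtain ⟨⟨g, hg, hg'⟩, h3⟩ := y.2
    exact nrClass_of_loc_eq hO hp hg hg' h3 (by rw [Units.val_mul, quatNrd_mul, hn, mul_comm])
      h𝔫 hnm hcop hj

theorem classMass_eq (hF : TotReal F) (hdef : TotallyDefinite c₁ c₂) (hO : IsZOrder O)
    (hA : ∀ x : F, IsIntegral ℤ x → algebraMap F ℍ[F, c₁, c₂] x ∈ O)
    (c c' : ClassGroup (𝓞 F)) : classMass O c = classMass O c' := by
  obtain ⟨m, hm, hmd⟩ := exists_int_sq_mul_isIntegral (-c₁)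
  let d' : 𝓞 F := ⟨(m : F) ^ 2 * -c₁, hmd⟩
  have hd' : (d' : F) = (m : F) ^ 2 * -c₁ := rfl
  have hpos : ∀ σ : F →+* ℝ, 0 < σ d' := fun σ => by
    rw [hd', map_mul, map_pow, map_intCast, map_neg]
    have : (m : ℝ) ≠ 0 := Int.cast_ne_zero.2 hm
    exact mul_pos (by positivity) (neg_pos.2 (hdef σ).1)
  refine eq_of_translationInvariants_eq_top (classGroup_eq_top_of_norm_form hF (d := d') ?_ hpos
    _ ?_) c c'
  · rintro h
    obtain ⟨σ⟩ := exists_realEmbedding hF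
    have := hpos σ
    simp [h] at this
  · rintro a b 𝔫 𝔪 h𝔫 p hp hne hnm hcop ⟨j, hj⟩ c
    have e : quatNrd (⟨a, b * m, 0, 0⟩ : ℍ[F, c₁, c₂]) = ((a ^ 2 + d' * b ^ 2 : 𝓞 F) : F) := by
      refine Eq.trans ?_ (show (a : F) ^ 2 + (d' : F) * (b : F) ^ 2 =
        ((a ^ 2 + d' * b ^ 2 : 𝓞 F) : F) by simp)
      rw [hd', quatNrd]
      ring
    have hne' : quatNrd (⟨a, b * m, 0, 0⟩ : ℍ[F, c₁, c₂]) ≠ 0 := fun h =>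
      hne (RingOfIntegers.coe_injective ((e.symm.trans h).trans (map_zero _).symm))
    exact classMass_mk0_mul hF hdef hO hA (x := quatUnit _ hne') e hp h𝔫 hnm hcop hj c

end QuatHecke

section QuatFibers

open scoped nonZeroDivisors NumberField Classical Finset
open NumberField MulAction

variable {F : Type*} [Field F] [NumberField F] {c₁ c₂ : F} {O : Subalgebra ℤ ℍ[F, c₁, c₂]}

theorem fixers_zero_le_scalarUnits (hF : TotReal F) (hdef : TotallyDefinite c₁ c₂)
    {I : LPIdeals O} {r : F} : fixers I r 0 ⊆ scalarUnits c₁ c₂ := by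
  rintro u ⟨h1, -, h3⟩
  have h4 : star (u : ℍ[F, c₁, c₂]) = u := by
    by_contra h
    exact quatNrd_ne_zero hF hdef (sub_ne_zero.2 (Ne.symm h)) h3
  rw [QuaternionAlgebra.star_eq_self] at h4
  obtain ⟨e, he⟩ := exists_unit_of_smul_eq h1
  have h5 : ((u : ℍ[F, c₁, c₂]).re) ^ 2 = ((e : 𝓞 F) : F) := by
    rw [← he, ← quatNrd_algebraMap (c₁ := c₁) (c₂ := c₂), h4]
    rfl
  have h6 : IsIntegral ℤ (u : ℍ[F, c₁, c₂]).re :=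
    IsIntegral.of_pow two_pos (h5 ▸ (e : 𝓞 F).2)
  let a : 𝓞 F := ⟨_, h6⟩
  have h7 : a ^ 2 = e := RingOfIntegers.coe_injective
    ((map_pow (algebraMap (𝓞 F) F) a 2).trans h5)
  obtain ⟨b, hb⟩ : IsUnit a := (isUnit_pow_iff two_ne_zero).1 (h7 ▸ e.isUnit)
  refine ⟨b, Units.ext ?_⟩
  change algebraMap F ℍ[F, c₁, c₂] ((b : 𝓞 F) : F) = u
  rw [hb, h4]
  rfl

theorem fixers_zero_eq (hF : TotReal F) (hdef : TotallyDefinite c₁ c₂)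
    (hA : ∀ x : F, IsIntegral ℤ x → algebraMap F ℍ[F, c₁, c₂] x ∈ O) (I J : LPIdeals O) (r : F) :
    fixers I r 0 = fixers J r 0 := by
  ext u
  exact ⟨fun h => ⟨scalarUnits_le_stabilizer hA J (fixers_zero_le_scalarUnits hF hdef h), h.2⟩,
    fun h => ⟨scalarUnits_le_stabilizer hA I (fixers_zero_le_scalarUnits hF hdef h), h.2⟩⟩

theorem ncard_eq_sum_ncard_fiber {α β : Type*} {s : Set α} (hs : s.Finite) {f : α → β}
    {t : Finset β} (h : ∀ a ∈ s, f a ∈ t) : s.ncard = ∑ b ∈ t, {a ∈ s | f a = b}.ncard := by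
  rw [Set.ncard_eq_toFinset_card s hs,
    Finset.card_eq_sum_card_fiberwise (f := f) (t := t) fun a ha => h a (by simpa using ha)]
  refine Finset.sum_congr rfl fun b _ => ?_
  rw [← Set.ncard_coe_finset]
  congr 1
  ext a
  simp

variable [Fintype (orbitRel.Quotient ℍ[F, c₁, c₂]ˣ (LPIdeals O))]

theorem fixMass_eq (hF : TotReal F) (hdef : TotallyDefinite c₁ c₂) (hO : IsZOrder O)
    (hA : ∀ x : F, IsIntegral ℤ x → algebraMap F ℍ[F, c₁, c₂] x ∈ O) (r d : F)
    (c c' : ClassGroup (𝓞 F)) : fixMass O r d c = fixMass O r d c' := by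
  rcases ne_or_eq d 0 with hd | rfl
  · exact fixMass_eq_of_ne_zero hF hdef hO hA r hd c c'
  · have key : ∀ c, fixMass O r 0 c =
        ((fixers (LPIdeals.self hO) r 0).ncard : ℚ) * classMass O c := fun c => by
      rw [fixMass, classMass, Finset.mul_sum]
      refine Finset.sum_congr rfl fun x _ => ?_
      rw [fixers_zero_eq hF hdef hA x.out (LPIdeals.self hO)]
    rw [key, key, classMass_eq hF hdef hO hA c c']

theorem card_filter_nrClass_eq (hF : TotReal F) (hdef : TotallyDefinite c₁ c₂) (hO : IsZOrder O)
    (hA : ∀ x : F, IsIntegral ℤ x → algebraMap F ℍ[F, c₁, c₂] x ∈ O) (c c' : ClassGroup (𝓞 F)) :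
    #{x : orbitRel.Quotient ℍ[F, c₁, c₂]ˣ (LPIdeals O) | nrClass x.out = c} =
      #{x : orbitRel.Quotient ℍ[F, c₁, c₂]ˣ (LPIdeals O) | nrClass x.out = c'} := by
  let S : LPIdeals O → Set ℍ[F, c₁, c₂]ˣ := fun I =>
    {u | u • I = I ∧ quatNrd (u : ℍ[F, c₁, c₂]) ∈ unitReps F}
  have hS : ∀ I, (S I).Finite := finite_stabilizer_unitReps hF hdef
  let f : ℍ[F, c₁, c₂]ˣ → F × F := fun u =>
    (quatNrd (u : ℍ[F, c₁, c₂]), quatNrd ((u : ℍ[F, c₁, c₂]) - star (u : ℍ[F, c₁, c₂])))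
  let T : Finset (F × F) := Finset.univ.biUnion
    fun x : orbitRel.Quotient ℍ[F, c₁, c₂]ˣ (LPIdeals O) => (hS x.out).toFinset.image f
  have hT : ∀ t ∈ T, t.1 ∈ unitReps F := fun t ht => by
    simp only [T, Finset.mem_biUnion, Finset.mem_image, Set.Finite.mem_toFinset] at ht
    obtain ⟨_, _, u, hu, rfl⟩ := ht
    exact hu.2
  let κ : ℕ := Nat.card (scalarUnits c₁ c₂ ⊓ (nrdHom c₁ c₂).ker : Subgroup ℍ[F, c₁, c₂]ˣ)
  have hκ : (κ : ℚ) ≠ 0 :=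
    Nat.cast_ne_zero.2 (relIndex_stabilizer_ne_zero hF hdef hA (LPIdeals.self hO)).1
  have h1 : ∀ x : orbitRel.Quotient ℍ[F, c₁, c₂]ˣ (LPIdeals O), (κ : ℚ) =
      ∑ t ∈ T, ((fixers x.out t.1 t.2).ncard : ℚ) * orbitMass (scalarUnits c₁ c₂) x.out :=
    fun x => by
    have h2 : (S x.out).ncard = ∑ t ∈ T, (fixers x.out t.1 t.2).ncard := by
      rw [ncard_eq_sum_ncard_fiber (hS x.out) (f := f) (t := T) fun u hu =>
        Finset.mem_biUnion.2 ⟨x, Finset.mem_univ _, Finset.mem_image_of_mem f (by simpa using hu)⟩]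
      refine Finset.sum_congr rfl fun t ht => ?_
      congr 1
      ext u
      constructor
      · rintro ⟨hu, rfl⟩
        exact ⟨hu.1, rfl, rfl⟩
      · rintro ⟨h, h', h''⟩
        exact ⟨⟨h, h'.symm ▸ hT t ht⟩, Prod.ext h' h''⟩
    have h3 := relIndex_stabilizer_ne_zero hF hdef hA x.out
    rw [← Finset.sum_mul, ← Nat.cast_sum, ← h2, orbitMass]
    have h4 : (S x.out).ncard = κ * _ := ncard_stabilizer_unitReps hA x.out
    rw [h4, Nat.cast_mul, mul_inv_cancel_right₀ (Nat.cast_ne_zero.2 h3.2)]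
  have key : ∀ c, (κ : ℚ) *
      #{x : orbitRel.Quotient ℍ[F, c₁, c₂]ˣ (LPIdeals O) | nrClass x.out = c} =
        ∑ t ∈ T, fixMass O t.1 t.2 c := fun c => by
    simp only [fixMass]
    rw [Finset.sum_comm, ← Finset.sum_congr rfl fun x _ => h1 x, Finset.sum_const, nsmul_eq_mul,
      mul_comm]
  have h5 := (key c).trans ((Finset.sum_congr rfl fun t _ =>
    fixMass_eq hF hdef hO hA t.1 t.2 c c').trans (key c').symm)
  exact_mod_cast mul_left_cancel₀ hκ h5

omit [Fintype (orbitRel.Quotient ℍ[F, c₁, c₂]ˣ (LPIdeals O))] in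
theorem card_classGroup_dvd_hCl (hF : TotReal F) (hdef : TotallyDefinite c₁ c₂) (hO : IsZOrder O)
    (hA : ∀ x : F, IsIntegral ℤ x → algebraMap F ℍ[F, c₁, c₂] x ∈ O) :
    Nat.card (ClassGroup (𝓞 F)) ∣ hCl O := by
  rw [hCl_eq_card_orbits]
  rcases finite_or_infinite (orbitRel.Quotient ℍ[F, c₁, c₂]ˣ (LPIdeals O)) with h | h
  · let := Fintype.ofFinite (orbitRel.Quotient ℍ[F, c₁, c₂]ˣ (LPIdeals O))
    have key : Fintype.card (orbitRel.Quotient ℍ[F, c₁, c₂]ˣ (LPIdeals O)) =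
        Fintype.card (ClassGroup (𝓞 F)) *
          #{x : orbitRel.Quotient ℍ[F, c₁, c₂]ˣ (LPIdeals O) | nrClass x.out = 1} := by
      rw [← Finset.card_univ,
        Finset.card_eq_sum_card_fiberwise
          (f := fun x : orbitRel.Quotient ℍ[F, c₁, c₂]ˣ (LPIdeals O) => nrClass x.out)
          (t := Finset.univ) fun _ _ => Finset.mem_coe.2 (Finset.mem_univ _),
        Finset.sum_congr rfl fun c _ => card_filter_nrClass_eq hF hdef hO hA c 1,
        Finset.sum_const, Finset.card_univ, smul_eq_mul]
    rw [Nat.card_eq_fintype_card, Nat.card_eq_fintype_card, key]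
    exact dvd_mul_right _ _
  · rw [Nat.card_eq_zero_of_infinite (α := orbitRel.Quotient ℍ[F, c₁, c₂]ˣ (LPIdeals O))]
    exact dvd_zero _

theorem hPic_integralClosure (F : Type*) [Field F] [NumberField F] :
    hPic (integralClosure ℤ F) = Nat.card (ClassGroup (𝓞 F)) := by
  let φ : (FractionalIdeal (𝓞 F)⁰ F)ˣ ≃* (Submodule (integralClosure ℤ F) F)ˣ :=
    FractionalIdeal.unitsMulEquivSubmodule (R := 𝓞 F) (S := (𝓞 F)⁰) (P := F)
  have hφ : ∀ x : Fˣ, (φ (toPrincipalIdeal (𝓞 F) F x) : Submodule (integralClosure ℤ F) F) =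
      Submodule.span (integralClosure ℤ F) {(x : F)} := fun x => by
    change ((toPrincipalIdeal (𝓞 F) F x : FractionalIdeal (𝓞 F)⁰ F) : Submodule (𝓞 F) F) = _
    rw [coe_toPrincipalIdeal, FractionalIdeal.coe_spanSingleton]
    rfl
  have h : (toPrincipalIdeal (𝓞 F) F).range.map φ.toMonoidHom =
      principalSub (integralClosure ℤ F) := by
    ext u
    constructor
    · rintro ⟨_, ⟨x, rfl⟩, rfl⟩
      exact ⟨x, x.isUnit, hφ x⟩
    · rintro ⟨x, hx, hu⟩
      exact ⟨_, ⟨hx.unit, rfl⟩, Units.ext ((hφ hx.unit).trans hu.symm)⟩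
  exact Nat.card_congr ((ClassGroup.equiv F).trans (QuotientGroup.congr _ _ φ h)).symm.toEquiv

end QuatFibers

theorem class_number_of_F_dvd_class_number_of_D
    {F : Type*} [Field F] [NumberField F] {c₁ c₂ : F}
    (hF : TotReal F) (hdeg : Even (Module.finrank ℚ F))
    (hdef : TotallyDefinite c₁ c₂) (hunram : UnramifiedAtAllFinitePlaces c₁ c₂)
    (O : Subalgebra ℤ ℍ[F, c₁, c₂]) (hO : IsMaximalOrder O) :
    hPic (integralClosure ℤ F) ∣ hCl O := by
  rw [hPic_integralClosure]
  exact card_classGroup_dvd_hCl hF hdef hO.1.1 fun x hx => (hO.1.2 x).2 hx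

end
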